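/- arXiv:0908.1093 — 8 statements merged into one kernel-verified Lean document; each statement's English description precedes it below -/
import Mathlib

section
/- (Gordon's Lemma) Suppose p is a positive integer, V : ℤ → ℝ satisfies V(n + p) = V(n) for all integers n with −p + 1 ≤ n ≤ p, E ∈ ℝ, and u : ℤ → ℝ solves u(n+1) + u(n−1) + V(n)u(n) = E u(n) for all n ∈ ℤ. Then max{ ‖(u(−p+1), u(−p))‖, ‖(u(p+1), u(p))‖, ‖(u(2p+1), u(2p))‖ } ≥ (1/2) ‖(u(1), u(0))‖, where ‖·‖ is the Euclidean norm on ℝ². -/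
/-- Euclidean norm of a vector `(x, y) ∈ ℝ²`. -/
noncomputable def norm2 (x y : ℝ) : ℝ := Real.sqrt (x ^ 2 + y ^ 2)

theorem norm2_eq_norm (x y : ℝ) : norm2 x y = ‖(⟨x, y⟩ : ℂ)‖ :=
  (Complex.norm_eq_sqrt_sq_add_sq ⟨x, y⟩).symm

/-- If `w + z = t v` with `1 ≤ |t|`, then `‖v‖ ≤ ‖w‖ + ‖z‖`. -/
theorem norm_le_of_smul_eq_add {F : Type*} [SeminormedAddCommGroup F] [NormedSpace ℝ F]
    {t : ℝ} {v w z : F} (ht : 1 ≤ |t|) (h : w + z = t • v) : ‖v‖ ≤ ‖w‖ + ‖z‖ :=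
  calc ‖v‖ ≤ |t| * ‖v‖ := le_mul_of_one_le_left (norm_nonneg v) ht
    _ = ‖w + z‖ := by rw [h, norm_smul, Real.norm_eq_abs]
    _ ≤ ‖w‖ + ‖z‖ := norm_add_le w z

/-- If `w + z = t v` with `|t| ≤ 1`, then `‖z‖ ≤ ‖v‖ + ‖w‖`. -/
theorem norm_le_of_add_eq_smul {F : Type*} [SeminormedAddCommGroup F] [NormedSpace ℝ F]
    {t : ℝ} {v w z : F} (ht : |t| ≤ 1) (h : w + z = t • v) : ‖z‖ ≤ ‖v‖ + ‖w‖ :=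
  calc ‖z‖ = ‖t • v - w‖ := by rw [← h, add_sub_cancel_left]
    _ ≤ ‖t • v‖ + ‖w‖ := norm_sub_le _ _
    _ ≤ ‖v‖ + ‖w‖ := by
      rw [norm_smul, Real.norm_eq_abs]
      gcongr
      exact mul_le_of_le_one_left (norm_nonneg v) ht

/-- The transfer matrix over `n` sites has determinant one, and it also propagates solutions
over any translated window on which the potential takes the same values. -/
theorem exists_transfer_matrix (V : ℤ → ℝ) (E : ℝ) (u : ℤ → ℝ)
    (hu : ∀ n : ℤ, u (n + 1) + u (n - 1) + V n * u n = E * u n) (n : ℕ) :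
    ∃ a b c d : ℝ, a * d - b * c = 1 ∧
      ∀ m : ℤ, (∀ j : ℤ, 1 ≤ j → j ≤ n → V (m + j) = V j) →
        u (m + n + 1) = a * u (m + 1) + b * u m ∧ u (m + n) = c * u (m + 1) + d * u m := by
  induction n with
  | zero => exact ⟨1, 0, 0, 1, by norm_num, fun m _ => by simp⟩
  | succ n ih =>
    obtain ⟨a, b, c, d, hdet, h⟩ := ih
    refine ⟨(E - V (n + 1)) * a - c, (E - V (n + 1)) * b - d, a, b, by linear_combination hdet,
      fun m hm => ?_⟩
    obtain ⟨h₁, h₂⟩ := h m fun j hj hjn => hm j hj (by push_cast; lia)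
    have hrec := hu (m + n + 1)
    have hVm : V (m + n + 1) = V (n + 1) := by
      rw [add_assoc]
      exact hm (n + 1) (by lia) (by push_cast; rfl)
    rw [add_sub_cancel_right, hVm] at hrec
    push_cast
    rw [← add_assoc]
    exact ⟨by linear_combination hrec + (E - V (n + 1)) * h₁ - h₂, h₁⟩

/-- Gordon's Lemma: if the potential `V` is `p`-periodic on `[-p+1, p]` and `u` solves the
difference equation `u(n+1) + u(n-1) + V(n)u(n) = E u(n)`, then
`max{‖(u(-p+1),u(-p))‖, ‖(u(p+1),u(p))‖, ‖(u(2p+1),u(2p))‖} ≥ (1/2)‖(u(1),u(0))‖`. -/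
theorem gordon_lemma (p : ℤ) (hp : 0 < p) (V : ℤ → ℝ) (E : ℝ)
    (hV : ∀ n : ℤ, -p + 1 ≤ n → n ≤ p → V (n + p) = V n)
    (u : ℤ → ℝ)
    (hu : ∀ n : ℤ, u (n + 1) + u (n - 1) + V n * u n = E * u n) :
    (1 / 2) * norm2 (u 1) (u 0) ≤
      max (norm2 (u (-p + 1)) (u (-p)))
        (max (norm2 (u (p + 1)) (u p)) (norm2 (u (2 * p + 1)) (u (2 * p)))) := by
  lift p to ℕ using hp.le
  obtain ⟨a, b, c, d, hdet, h⟩ := exists_transfer_matrix V E u hu p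
  obtain ⟨h₁, h₁'⟩ := h (-p) fun j hj hjp => by
    rw [← hV (-p + j) (by lia) (by lia)]
    congr 1
    ring
  obtain ⟨h₂, h₂'⟩ := h 0 fun j _ _ => by rw [zero_add]
  obtain ⟨h₃, h₃'⟩ := h p fun j hj hjp => by
    rw [add_comm]
    exact hV j (by lia) hjp
  simp only [neg_add_cancel, zero_add, ← two_mul] at h₁ h₁' h₂ h₂' h₃ h₃'
  simp only [norm2_eq_norm]
  set x : ℤ → ℂ := fun m => ⟨u (m + 1), u m⟩ with hx
  have key₁ : x (-p) + x p = (a + d) • x 0 := by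
    apply Complex.ext <;> simp [hx]
    · linear_combination h₂ - d * h₁ + b * h₁' - u (-p + 1) * hdet
    · linear_combination h₂' - a * h₁' + c * h₁ - u (-p) * hdet
  have key₂ : x (2 * p) + x 0 = (a + d) • x p := by
    apply Complex.ext <;> simp [hx]
    · linear_combination h₃ - d * h₂ + b * h₂' - u 1 * hdet
    · linear_combination h₃' - a * h₂' + c * h₂ - u 0 * hdet
  change 1 / 2 * ‖x 0‖ ≤ max ‖x (-p)‖ (max ‖x p‖ ‖x (2 * p)‖)
  have hm₁ : ‖x (-p)‖ ≤ max ‖x (-p)‖ (max ‖x p‖ ‖x (2 * p)‖) := le_max_left _ _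
  have hm₂ : ‖x p‖ ≤ max ‖x (-p)‖ (max ‖x p‖ ‖x (2 * p)‖) := by simp
  have hm₃ : ‖x (2 * p)‖ ≤ max ‖x (-p)‖ (max ‖x p‖ ‖x (2 * p)‖) := by simp
  rcases le_total |a + d| 1 with ht | ht
  · linarith [norm_le_of_add_eq_smul ht key₂]
  · linarith [norm_le_of_smul_eq_add ht key₁]
end

section
/- Suppose α ∈ ℝ is Liouville. Then for every λ > 0 and every ω ∈ ℝ, the potential V(n) = 2λ cos(2π(ω + nα)) is a Gordon potential. -/
/-- An irrational `α` is Liouville if there is a sequence of rationals `p_k/q_k` with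
`q_k → ∞` and `|α − p_k/q_k| < k^{−q_k}` for every `k ≥ 1`. -/
def IsLiouvilleFrequency (α : ℝ) : Prop :=
  Irrational α ∧
  ∃ p : ℕ → ℤ, ∃ q : ℕ → ℕ, (∀ k, 0 < q k) ∧ Filter.Tendsto q Filter.atTop Filter.atTop ∧
    ∀ k : ℕ, 0 < k → |α - (p k : ℝ) / (q k : ℝ)| < 1 / (k : ℝ) ^ q k

/-- A bounded potential `V : ℤ → ℝ` is a Gordon potential if there are positive integers
`q_k → ∞` such that for every `C > 0`,
`lim_{k → ∞} max_{1 ≤ n ≤ q_k} |V(n) − V(n ± q_k)| · C^{q_k} = 0`. -/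
def GordonPotential (V : ℤ → ℝ) : Prop :=
  (∃ M : ℝ, ∀ n : ℤ, |V n| ≤ M) ∧
  ∃ q : ℕ → ℕ, (∀ k, 0 < q k) ∧ Filter.Tendsto q Filter.atTop Filter.atTop ∧
    ∀ C : ℝ, 0 < C →
      Filter.Tendsto
        (fun k => (⨆ n : Finset.Icc (1 : ℤ) (q k : ℤ), |V n - V (n + q k)|) * C ^ q k)
        Filter.atTop (nhds 0) ∧
      Filter.Tendsto
        (fun k => (⨆ n : Finset.Icc (1 : ℤ) (q k : ℤ), |V n - V (n - q k)|) * C ^ q k)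
        Filter.atTop (nhds 0)

lemma abs_cos_sub_cos_le (x y : ℝ) : |Real.cos x - Real.cos y| ≤ |x - y| := by
  have h := Real.lipschitzWith_cos.dist_le_mul x y
  simpa [Real.dist_eq] using h

/-- Shifting an almost Mathieu potential by `m` changes it by at most a multiple of the distance
of `m * α` to any integer. -/
lemma abs_almostMathieu_sub_shift_le {lam : ℝ} (hlam : 0 < lam) (α ω : ℝ) (n m p : ℤ) :
    |2 * lam * Real.cos (2 * Real.pi * (ω + n * α))
      - 2 * lam * Real.cos (2 * Real.pi * (ω + (n + m : ℤ) * α))|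
      ≤ 4 * Real.pi * lam * |m * α - p| := by
  have hper : Real.cos (2 * Real.pi * (ω + (n + m : ℤ) * α))
      = Real.cos (2 * Real.pi * (ω + (n + m : ℤ) * α) - p * (2 * Real.pi)) :=
    (Real.cos_sub_int_mul_two_pi _ p).symm
  have hdiff : 2 * Real.pi * (ω + n * α)
      - (2 * Real.pi * (ω + (n + m : ℤ) * α) - p * (2 * Real.pi))
      = -(2 * Real.pi) * (m * α - p) := by
    push_cast
    ring
  have hcos := abs_cos_sub_cos_le (2 * Real.pi * (ω + n * α))
    (2 * Real.pi * (ω + (n + m : ℤ) * α) - p * (2 * Real.pi))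
  rw [hdiff, abs_mul, abs_neg, abs_of_pos Real.two_pi_pos, ← hper] at hcos
  rw [← mul_sub, abs_mul, abs_of_pos (by positivity : 0 < 2 * lam)]
  calc _ ≤ 2 * lam * (2 * Real.pi * |m * α - p|) := by gcongr
    _ = _ := by ring

/-- Nonnegative quantities bounded by a multiple of `q k * k ^ (-q k)` decay faster than any
exponential in `q k`. -/
lemma tendsto_mul_pow_zero_of_le {q : ℕ → ℕ} (hq : Filter.Tendsto q Filter.atTop Filter.atTop)
    {f : ℕ → ℝ} {A : ℝ} (hA : 0 ≤ A) (hf0 : ∀ k, 0 ≤ f k)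
    (hf : ∀ k, 0 < k → f k ≤ A * (q k * (1 / (k : ℝ) ^ q k))) {C : ℝ} (hC : 0 < C) :
    Filter.Tendsto (fun k => f k * C ^ q k) Filter.atTop (nhds 0) := by
  have hlim : Filter.Tendsto (fun k => A * (q k * (1 / 2 : ℝ) ^ q k)) Filter.atTop (nhds 0) := by
    have h := (tendsto_self_mul_const_pow_of_lt_one (r := (1 / 2 : ℝ)) (by norm_num)
      (by norm_num)).comp hq
    simpa using h.const_mul A
  refine squeeze_zero' (Filter.Eventually.of_forall fun k => by have := hf0 k; positivity) ?_ hlim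
  filter_upwards [Filter.eventually_gt_atTop 0,
    tendsto_natCast_atTop_atTop.eventually_ge_atTop (2 * C)] with k hk hkC
  have hk' : (0 : ℝ) < k := by exact_mod_cast hk
  have hratio : C / k ≤ 1 / 2 := by
    rw [div_le_div_iff₀ hk' two_pos]
    linarith
  calc f k * C ^ q k ≤ A * (q k * (1 / (k : ℝ) ^ q k)) * C ^ q k := by gcongr; exact hf k hk
    _ = A * (q k * (C / k) ^ q k) := by rw [div_pow]; ring
    _ ≤ A * (q k * (1 / 2 : ℝ) ^ q k) := by gcongr

/-- For Liouville `α`, every almost Mathieu potential `n ↦ 2λ cos(2π(ω + nα))` is a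
Gordon potential. -/
theorem almost_mathieu_gordon (α : ℝ) (hα : IsLiouvilleFrequency α)
    (lam : ℝ) (hlam : 0 < lam) (ω : ℝ) :
    GordonPotential (fun n : ℤ => 2 * lam * Real.cos (2 * Real.pi * (ω + n * α))) := by
  obtain ⟨-, p, q, hq0, hq, happrox⟩ := hα
  have hdist : ∀ k, 0 < k → |q k * α - p k| ≤ q k * (1 / (k : ℝ) ^ q k) := by
    intro k hk
    have hqk : (0 : ℝ) < q k := by exact_mod_cast hq0 k
    have heq : q k * α - p k = q k * (α - p k / q k) := by field_simp
    rw [heq, abs_mul, abs_of_pos hqk]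
    gcongr
    exact (happrox k hk).le
  have hA : 0 ≤ 4 * Real.pi * lam := by positivity
  refine ⟨⟨2 * lam, fun n => ?_⟩, q, hq0, hq, fun C hC => ⟨?_, ?_⟩⟩
  · rw [abs_mul, abs_of_pos (by positivity : 0 < 2 * lam)]
    exact mul_le_of_le_one_right (by positivity) (Real.abs_cos_le_one _)
  · refine tendsto_mul_pow_zero_of_le hq hA (fun k => Real.iSup_nonneg fun n => abs_nonneg _)
      (fun k hk => Real.iSup_le (fun n => ?_) (by positivity)) hC
    refine (abs_almostMathieu_sub_shift_le hlam α ω n (q k) (p k)).trans ?_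
    gcongr
    exact_mod_cast hdist k hk
  · refine tendsto_mul_pow_zero_of_le hq hA (fun k => Real.iSup_nonneg fun n => abs_nonneg _)
      (fun k hk => Real.iSup_le (fun n => ?_) (by positivity)) hC
    refine (abs_almostMathieu_sub_shift_le hlam α ω n (-(q k)) (-(p k))).trans ?_
    gcongr
    have hneg : ((-(q k : ℤ) : ℤ) : ℝ) * α - (-(p k) : ℤ) = -(q k * α - p k) := by
      push_cast
      ring
    rw [hneg, abs_neg]
    exact hdist k hk
end

section
/- (Avron–Simon) Suppose α ∈ ℝ is Liouville. Then for every λ > 0 and every ω ∈ ℝ, the almost Mathieu operator H^{λ,α}_ω has no eigenvalues; that is, for every E ∈ ℝ there is no nonzero ψ ∈ ℓ²(ℤ, ℂ) with H^{λ,α}_ω ψ = E ψ. -/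
section OrderedProduct

variable {R : Type*} [NormedRing R]

/-- The ordered product `f (n + m - 1) * ⋯ * f (n + 1) * f n`. -/
def orderedProd (f : ℤ → R) (n : ℤ) : ℕ → R
  | 0 => 1
  | m + 1 => f (n + m) * orderedProd f n m

variable [NormOneClass R]

lemma norm_orderedProd_le {f : ℤ → R} {C : ℝ} (hf : ∀ n, ‖f n‖ ≤ C) (n : ℤ) (m : ℕ) :
    ‖orderedProd f n m‖ ≤ C ^ m := by
  have hC : 0 ≤ C := (norm_nonneg _).trans (hf 0)
  induction m with
  | zero => simp [orderedProd]
  | succ m ih =>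
    rw [pow_succ']
    exact (norm_mul_le _ _).trans (mul_le_mul (hf _) ih (norm_nonneg _) hC)

lemma norm_orderedProd_add_sub_le {f : ℤ → R} {C δ : ℝ} (hC : 1 ≤ C) (hf : ∀ n, ‖f n‖ ≤ C)
    {q : ℤ} (hδ : ∀ n, ‖f (n + q) - f n‖ ≤ δ) (n : ℤ) (m : ℕ) :
    ‖orderedProd f (n + q) m - orderedProd f n m‖ ≤ m * C ^ m * δ := by
  have hδ0 : 0 ≤ δ := (norm_nonneg _).trans (hδ 0)
  induction m with
  | zero => simp [orderedProd]
  | succ m ih =>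
    have hsplit : orderedProd f (n + q) (m + 1) - orderedProd f n (m + 1) =
        f (n + q + m) * (orderedProd f (n + q) m - orderedProd f n m) +
          (f (n + m + q) - f (n + m)) * orderedProd f n m := by
      rw [orderedProd, orderedProd, add_right_comm n q m]
      noncomm_ring
    have h₁ := (norm_mul_le (f (n + q + m)) (orderedProd f (n + q) m - orderedProd f n m)).trans
      (mul_le_mul (hf _) ih (norm_nonneg _) (by positivity))
    have h₂ := (norm_mul_le (f (n + m + q) - f (n + m)) (orderedProd f n m)).trans
      (mul_le_mul (hδ _) (norm_orderedProd_le hf n m) (norm_nonneg _) hδ0)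
    have h₃ : δ * C ^ m ≤ δ * C ^ (m + 1) :=
      mul_le_mul_of_nonneg_left (pow_le_pow_right₀ hC m.le_succ) hδ0
    rw [hsplit]
    refine (norm_add_le _ _).trans ?_
    push_cast
    calc _ ≤ C * (m * C ^ m * δ) + δ * C ^ (m + 1) := add_le_add h₁ (h₂.trans h₃)
      _ = _ := by ring

end OrderedProduct

section GordonBound

attribute [local instance] Matrix.linftyOpNormedRing

lemma Matrix.mulVec_mulVec_fin_two (M : Matrix (Fin 2) (Fin 2) ℂ) (v : Fin 2 → ℂ) :
    M.mulVec (M.mulVec v) = M.trace • M.mulVec v - M.det • v := by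
  ext i
  fin_cases i <;>
    simp [Matrix.mulVec, dotProduct, Fin.sum_univ_two, Matrix.trace_fin_two,
      Matrix.det_fin_two] <;> ring

lemma Matrix.norm_trace_fin_two_le (M : Matrix (Fin 2) (Fin 2) ℂ) : ‖M.trace‖ ≤ 2 * ‖M‖ := by
  have h (i : Fin 2) : ‖M i i‖ ≤ ‖M‖ := by
    have h₁ := Matrix.linfty_opNorm_mulVec M (Pi.single i 1)
    have h₂ := norm_le_pi_norm (M.mulVec (Pi.single i 1)) i
    rw [Matrix.mulVec_single_one] at h₁ h₂
    rw [Pi.norm_single, norm_one, mul_one] at h₁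
    exact h₂.trans h₁
  rw [Matrix.trace_fin_two]
  linarith [norm_add_le (M 0 0) (M 1 1), h 0, h 1]

lemma Matrix.linfty_opNorm_fin_two_le {M : Matrix (Fin 2) (Fin 2) ℂ} {c : ℝ}
    (h : ∀ i, ‖M i 0‖ + ‖M i 1‖ ≤ c) : ‖M‖ ≤ c := by
  lift c to NNReal using (by positivity : 0 ≤ ‖M 0 0‖ + ‖M 0 1‖).trans (h 0)
  rw [Matrix.linfty_opNorm_def, NNReal.coe_le_coe]
  refine Finset.sup_le fun i _ => ?_
  rw [Fin.sum_univ_two, ← NNReal.coe_le_coe]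
  exact_mod_cast h i

/-- Gordon's three-block estimate: nearly equal unimodular matrices cannot carry a vector
simultaneously to small vectors after one step backward, one step forward and two steps forward. -/
lemma gordon_bound {A B D : Matrix (Fin 2) (Fin 2) ℂ} {x y z w : Fin 2 → ℂ}
    (hA : A.det = 1) (hB : B.det = 1) (hxy : A.mulVec x = y) (hyz : B.mulVec y = z)
    (hzw : D.mulVec z = w) (hBA : ‖B - A‖ ≤ 1 / 8) (hDB : ‖D - B‖ ≤ 1 / 8) :
    ‖y‖ ≤ 4 * (‖x‖ + ‖z‖ + ‖w‖) := by
  have hx := norm_nonneg x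
  have hy := norm_nonneg y
  have hz := norm_nonneg z
  have hw := norm_nonneg w
  have e₁ := Matrix.mulVec_mulVec_fin_two A x
  have e₂ := Matrix.mulVec_mulVec_fin_two B y
  rw [hxy, hA, one_smul] at e₁
  rw [hyz, hB, one_smul] at e₂
  have b₁ : ‖(B - A).mulVec y‖ ≤ 1 / 8 * ‖y‖ :=
    (Matrix.linfty_opNorm_mulVec _ _).trans (by gcongr)
  have b₂ : ‖(D - B).mulVec z‖ ≤ 1 / 8 * ‖z‖ :=
    (Matrix.linfty_opNorm_mulVec _ _).trans (by gcongr)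
  rw [Matrix.sub_mulVec, hyz, e₁] at b₁
  rw [Matrix.sub_mulVec, hzw, e₂] at b₂
  by_cases ht : ‖B.trace‖ ≤ 1
  · have hy' : y = (w - (B.trace • z - y)) + (B.trace • z) - w := by abel_nf
    have hn : ‖y‖ ≤ ‖w - (B.trace • z - y)‖ + ‖B.trace • z‖ + ‖w‖ := by
      conv_lhs => rw [hy']
      exact (norm_sub_le _ _).trans (by gcongr; exact norm_add_le _ _)
    rw [norm_smul] at hn
    have : ‖B.trace‖ * ‖z‖ ≤ 1 * ‖z‖ := by gcongr
    linarith
  · have htA : 3 / 4 ≤ ‖A.trace‖ := by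
      have h₁ := Matrix.norm_trace_fin_two_le (B - A)
      rw [Matrix.trace_sub] at h₁
      have := norm_sub_norm_le B.trace A.trace
      linarith
    have hy' : A.trace • y = z + x - (z - (A.trace • y - x)) := by abel_nf
    have hn : ‖A.trace • y‖ ≤ ‖z‖ + ‖x‖ + ‖z - (A.trace • y - x)‖ := by
      conv_lhs => rw [hy']
      exact (norm_sub_le _ _).trans (by gcongr; exact norm_add_le _ _)
    rw [norm_smul] at hn
    have : 3 / 4 * ‖y‖ ≤ ‖A.trace‖ * ‖y‖ := by gcongr
    linarith

end GordonBound

section Schrodinger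

open Filter Topology

/-- The one-step transfer matrix of `u (n + 1) + u (n - 1) + V n * u n = E * u n`. -/
def transferMatrix (V : ℤ → ℝ) (E : ℝ) (n : ℤ) : Matrix (Fin 2) (Fin 2) ℂ :=
  !![((E - V n : ℝ) : ℂ), -1; 1, 0]

attribute [local instance] Matrix.linftyOpNormedRing Matrix.linfty_opNormOneClass

lemma norm_transferMatrix_le {V : ℤ → ℝ} {K : ℝ} (hV : ∀ n, |V n| ≤ K) (E : ℝ) (n : ℤ) :
    ‖transferMatrix V E n‖ ≤ |E| + K + 1 := by
  have hK : 0 ≤ K := (abs_nonneg _).trans (hV 0)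
  have h : |E - V n| ≤ |E| + K := (abs_sub _ _).trans (by gcongr; exact hV n)
  refine Matrix.linfty_opNorm_fin_two_le fun i => ?_
  fin_cases i
  · simpa [transferMatrix, ← Complex.ofReal_sub] using h
  · simp [transferMatrix]
    positivity

lemma norm_transferMatrix_sub_le (V : ℤ → ℝ) (E : ℝ) (m n : ℤ) :
    ‖transferMatrix V E m - transferMatrix V E n‖ ≤ |V m - V n| := by
  refine Matrix.linfty_opNorm_fin_two_le fun i => ?_
  fin_cases i
  · simp [transferMatrix, ← Complex.ofReal_sub, abs_sub_comm]
  · simp [transferMatrix]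

lemma det_orderedProd_transferMatrix (V : ℤ → ℝ) (E : ℝ) (n : ℤ) (m : ℕ) :
    (orderedProd (transferMatrix V E) n m).det = 1 := by
  induction m with
  | zero => simp [orderedProd]
  | succ m ih => rw [orderedProd, Matrix.det_mul, ih]; simp [transferMatrix, Matrix.det_fin_two]

lemma orderedProd_transferMatrix_mulVec {V : ℤ → ℝ} {E : ℝ} {u : ℤ → ℂ}
    (hu : ∀ n, u (n + 1) + u (n - 1) + V n * u n = E * u n) (n : ℤ) (m : ℕ) :
    (orderedProd (transferMatrix V E) n m).mulVec ![u n, u (n - 1)] =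
      ![u (n + m), u (n + m - 1)] := by
  induction m with
  | zero => simp [orderedProd]
  | succ m ih =>
    rw [orderedProd, ← Matrix.mulVec_mulVec, ih]
    have h := hu (n + m)
    ext i
    fin_cases i
    · simp [transferMatrix, ← add_assoc]
      linear_combination -h
    · simp [transferMatrix, ← add_assoc]

lemma eq_zero_of_recurrence {V : ℤ → ℝ} {E : ℝ} {u : ℤ → ℂ}
    (hu : ∀ n, u (n + 1) + u (n - 1) + V n * u n = E * u n)
    (h₀ : u 0 = 0) (h₁ : u (-1) = 0) (n : ℤ) : u n = 0 := by
  suffices h : u n = 0 ∧ u (n - 1) = 0 from h.1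
  induction n using Int.induction_on with
  | zero => exact ⟨h₀, by simpa using h₁⟩
  | succ n ih =>
    have h := hu n
    rw [ih.1, ih.2] at h
    exact ⟨by simpa using h, by simpa using ih.1⟩
  | pred n ih =>
    have h := hu (-n - 1)
    rw [ih.2, sub_add_cancel, ih.1] at h
    exact ⟨ih.2, by simpa using h⟩

/-- **Gordon's lemma**: a bounded potential with sufficiently good almost periods admits no nonzero
solution vanishing at infinity. -/
theorem eq_zero_of_gordon {V : ℤ → ℝ} {E K : ℝ} (hV : ∀ n, |V n| ≤ K) {q : ℕ → ℕ}
    (hq : Tendsto q atTop atTop) {δ : ℕ → ℝ} (hδ : ∀ᶠ k in atTop, ∀ n, |V (n + q k) - V n| ≤ δ k)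
    (hsmall : Tendsto (fun k => q k * (|E| + K + 1) ^ q k * δ k) atTop (𝓝 0)) {u : ℤ → ℂ}
    (hu : ∀ n, u (n + 1) + u (n - 1) + V n * u n = E * u n)
    (hu₀ : Tendsto u cofinite (𝓝 0)) (n : ℤ) : u n = 0 := by
  have hK : 0 ≤ K := (abs_nonneg _).trans (hV 0)
  have hC : 1 ≤ |E| + K + 1 := by linarith [abs_nonneg E]
  let Φ : ℤ → Fin 2 → ℂ := fun n => ![u n, u (n - 1)]
  have hΦ : Tendsto Φ cofinite (𝓝 0) := by
    refine tendsto_pi_nhds.2 fun i => ?_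
    fin_cases i
    · simpa [Φ] using hu₀
    · simpa [Φ, Function.comp_def] using hu₀.comp (sub_left_injective (b := (1 : ℤ))).tendsto_cofinite
  have hlim (c : ℤ) (hc : c ≠ 0) : Tendsto (fun k => ‖Φ (c * q k)‖) atTop (𝓝 0) := by
    have h₁ : Tendsto (fun m : ℕ => c * (m : ℤ)) atTop cofinite := by
      rw [← Nat.cofinite_eq_atTop]
      exact ((mul_right_injective₀ hc).comp Nat.cast_injective).tendsto_cofinite
    simpa using (hΦ.comp (h₁.comp hq)).norm
  have hbound : ∀ᶠ k in atTop,
      ‖Φ 0‖ ≤ 4 * (‖Φ (-1 * q k)‖ + ‖Φ (1 * q k)‖ + ‖Φ (2 * q k)‖) := by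
    filter_upwards [hδ, hsmall.eventually_le_const (show (0 : ℝ) < 1 / 8 by norm_num)] with k hk hs
    have hclose (n : ℤ) := (norm_orderedProd_add_sub_le hC (norm_transferMatrix_le hV E)
      (fun n => (norm_transferMatrix_sub_le V E _ _).trans (hk n)) n (q k)).trans hs
    have hstep (n : ℤ) := orderedProd_transferMatrix_mulVec hu n (q k)
    refine gordon_bound (det_orderedProd_transferMatrix V E (-q k) (q k))
      (det_orderedProd_transferMatrix V E (-q k + q k) (q k))
      (D := orderedProd (transferMatrix V E) (-q k + q k + q k) (q k)) ?_ ?_ ?_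
      (hclose _) (hclose _)
    · simpa [Φ] using hstep (-q k)
    · simpa [Φ] using hstep 0
    · simpa [Φ, two_mul] using hstep (q k)
  have hΦ0 : Φ 0 = 0 := by
    refine norm_le_zero_iff.1 (ge_of_tendsto ?_ hbound)
    simpa using (((hlim (-1) (by simp)).add (hlim 1 (by simp))).add (hlim 2 (by simp))).const_mul 4
  exact eq_zero_of_recurrence hu (by simpa [Φ] using congrFun hΦ0 0)
    (by simpa [Φ] using congrFun hΦ0 1) n

end Schrodinger

section AlmostMathieu

open Filter Topology

lemma lp.tendsto_cofinite_zero {ι : Type*} (ψ : lp (fun _ : ι => ℂ) 2) :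
    Tendsto (fun n => ψ n) cofinite (𝓝 0) := by
  have h := (lp.memℓp ψ).summable (by norm_num) |>.tendsto_cofinite_zero
  rw [tendsto_zero_iff_norm_tendsto_zero]
  have h' := h.sqrt
  simpa using h'

lemma abs_cosine_potential_add_sub_le {lam : ℝ} (hlam : 0 ≤ lam) (α ω : ℝ) (n : ℤ) (q : ℕ)
    (p : ℤ) :
    |2 * lam * Real.cos (2 * Real.pi * (ω + (n + q : ℤ) * α)) -
      2 * lam * Real.cos (2 * Real.pi * (ω + n * α))| ≤ 4 * Real.pi * lam * |q * α - p| := by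
  have h : Real.cos (2 * Real.pi * (ω + (n + q : ℤ) * α)) =
      Real.cos (2 * Real.pi * (ω + n * α) + 2 * Real.pi * (q * α - p)) := by
    rw [← Real.cos_sub_int_mul_two_pi _ p]
    push_cast
    ring_nf
  rw [h, ← mul_sub, abs_mul, abs_of_nonneg (by positivity : 0 ≤ 2 * lam)]
  have := Real.abs_cos_sub_cos_le (2 * Real.pi * (ω + n * α) + 2 * Real.pi * (q * α - p))
    (2 * Real.pi * (ω + n * α))
  rw [add_sub_cancel_left, abs_mul, abs_of_pos Real.two_pi_pos] at this
  calc _ ≤ 2 * lam * (2 * Real.pi * |q * α - p|) := by gcongr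
    _ = _ := by ring

lemma tendsto_liouville_error {q : ℕ → ℕ} (hq : Tendsto q atTop atTop) {C : ℝ} (hC : 0 < C)
    (c : ℝ) : Tendsto (fun k : ℕ => q k * C ^ q k * (c * (q k * (1 / (k : ℝ) ^ q k))))
      atTop (𝓝 0) := by
  have h : Tendsto (fun k => |c| * ((q k : ℝ) ^ 2 * (1 / 2 : ℝ) ^ q k)) atTop (𝓝 0) := by
    simpa using ((tendsto_pow_const_mul_const_pow_of_abs_lt_one 2
      (show |(1 / 2 : ℝ)| < 1 by norm_num [abs_of_pos])).comp hq).const_mul |c|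
  refine squeeze_zero_norm' ?_ h
  filter_upwards [tendsto_natCast_atTop_atTop.eventually_ge_atTop (2 * C)] with k hk
  have hk0 : (0 : ℝ) < k := by linarith
  have hle : C / k ≤ 1 / 2 := by
    rw [div_le_div_iff₀ hk0 two_pos]
    linarith
  have hrw : q k * C ^ q k * (c * (q k * (1 / (k : ℝ) ^ q k))) =
      c * ((q k : ℝ) ^ 2 * (C / k) ^ q k) := by
    rw [div_pow]
    ring
  rw [hrw, norm_mul, Real.norm_eq_abs, Real.norm_of_nonneg (by positivity)]
  gcongr

end AlmostMathieu

/-- Avron–Simon: for Liouville `α`, the almost Mathieu operator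
`(Hψ)(n) = ψ(n+1) + ψ(n−1) + 2λ cos(2π(ω + nα))ψ(n)` on `ℓ²(ℤ, ℂ)` has no eigenvalues. -/
theorem avron_simon_no_eigenvalues (α : ℝ) (hα : IsLiouvilleFrequency α)
    (lam : ℝ) (hlam : 0 < lam) (ω : ℝ)
    (H : lp (fun _ : ℤ => ℂ) 2 →L[ℂ] lp (fun _ : ℤ => ℂ) 2)
    (hH : ∀ (ψ : lp (fun _ : ℤ => ℂ) 2) (n : ℤ),
      (H ψ) n = ψ (n + 1) + ψ (n - 1) +
        (↑(2 * lam * Real.cos (2 * Real.pi * (ω + n * α))) : ℂ) * ψ n) :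
    ∀ E : ℝ, ¬∃ ψ : lp (fun _ : ℤ => ℂ) 2, ψ ≠ 0 ∧ H ψ = (E : ℂ) • ψ := by
  rintro E ⟨ψ, hψ, hE⟩
  obtain ⟨-, p, q, hq0, hq, hpq⟩ := hα
  refine hψ (lp.ext (funext fun n => ?_))
  have hbound (n : ℤ) : |2 * lam * Real.cos (2 * Real.pi * (ω + n * α))| ≤ 2 * lam := by
    rw [abs_mul, abs_of_pos (by positivity : 0 < 2 * lam)]
    exact mul_le_of_le_one_right (by positivity) (Real.abs_cos_le_one _)
  refine eq_zero_of_gordon (E := E) hbound hq ?_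
    (tendsto_liouville_error hq (by positivity) (4 * Real.pi * lam)) (u := fun n => ψ n)
    (fun n => ?_) (lp.tendsto_cofinite_zero ψ) n
  · filter_upwards [Filter.eventually_gt_atTop 0] with k hk n
    refine (abs_cosine_potential_add_sub_le hlam.le α ω n (q k) (p k)).trans ?_
    have hqk : (0 : ℝ) < q k := by exact_mod_cast hq0 k
    have h : (q k : ℝ) * α - p k = q k * (α - p k / q k) := by field_simp
    rw [h, abs_mul, abs_of_pos hqk]
    have := (hpq k hk).le
    gcongr
  · rw [← hH, hE, lp.coeFn_smul, Pi.smul_apply, smul_eq_mul]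
end

section
/- (Jitomirskaya–Simon Lemma) Suppose V : ℤ → ℝ is a Jitomirskaya–Simon potential and E ∈ ℝ. Then the difference equation u(n+1) + u(n−1) + V(n)u(n) = E u(n) has no nonzero square-summable solution u : ℤ → ℝ. -/
/-- A bounded potential `V : ℤ → ℝ` is a Jitomirskaya–Simon potential if there exist
`B > 4 log(3 + 2‖V‖_∞)` and integers `m_k → ∞` such that for every `k`,
`sup_{n ∈ ℤ} |V(2m_k − n) − V(n)| < e^{−B m_k}`. -/
def JitomirskayaSimonPotential (V : ℤ → ℝ) : Prop :=
  BddAbove (Set.range fun n : ℤ => |V n|) ∧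
  ∃ B : ℝ, B > 4 * Real.log (3 + 2 * (⨆ n : ℤ, |V n|)) ∧
    ∃ m : ℕ → ℤ, Filter.Tendsto m Filter.atTop Filter.atTop ∧
      ∀ k : ℕ, ∀ n : ℤ, |V (2 * m k - n) - V n| < Real.exp (-B * m k)

section Auxiliary

open Filter Topology

variable {V u : ℤ → ℝ} {E : ℝ}

/-- A square-summable function on `ℤ` tends to zero along the cofinite filter. -/
theorem tendsto_cofinite_zero_of_summable_sq (hs : Summable fun n : ℤ => u n ^ 2) :
    Tendsto u cofinite (𝓝 0) := by
  have h := (hs.tendsto_cofinite_zero).sqrt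
  simp only [Real.sqrt_sq_eq_abs, Real.sqrt_zero] at h
  exact (tendsto_zero_iff_abs_tendsto_zero u).2 h

/-- An eigenvalue with square-summable eigenfunction is bounded by the norm of the operator. -/
theorem abs_energy_le {M : ℝ} (hM : ∀ n, |V n| ≤ M) (hu : u ≠ 0)
    (heq : ∀ n : ℤ, u (n + 1) + u (n - 1) + V n * u n = E * u n)
    (hs : Summable fun n : ℤ => u n ^ 2) : |E| ≤ 2 + M := by
  obtain ⟨a, ha⟩ := Function.ne_iff.1 hu
  have ha : 0 < |u a| := abs_pos.2 ha
  have h0 := (tendsto_zero_iff_abs_tendsto_zero u).1 (tendsto_cofinite_zero_of_summable_sq hs)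
  have hfin : {n | ¬ |u n| < |u a|}.Finite := h0.eventually_lt_const ha
  obtain ⟨b, hb, hmax⟩ := Set.exists_max_image _ (fun n => |u n|) hfin ⟨a, lt_irrefl _⟩
  have hab : |u a| ≤ |u b| := not_lt.1 hb
  have hle : ∀ n, |u n| ≤ |u b| := fun n => by
    by_cases hn : |u n| < |u a|
    · exact hn.le.trans hab
    · exact hmax n hn
  have hE : |E| * |u b| ≤ (2 + M) * |u b| := by
    rw [← abs_mul, ← heq b]
    calc _ ≤ |u (b + 1)| + |u (b - 1)| + |V b * u b| := abs_add_three _ _ _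
      _ ≤ |u b| + |u b| + M * |u b| := by
        rw [abs_mul]
        exact add_le_add (add_le_add (hle _) (hle _)) (by gcongr; exact hM b)
      _ = _ := by ring
  exact le_of_mul_le_mul_right hE (ha.trans_le hab)

/-- Bound on the Wronskian of a square-summable solution and its reflection about `m`, evaluated
at the centre of the reflection. -/
theorem abs_reflected_wronskian_le {m : ℤ} {δ : ℝ} (hδ : 0 ≤ δ)
    (hV : ∀ n, |V (2 * m - n) - V n| ≤ δ)
    (heq : ∀ n : ℤ, u (n + 1) + u (n - 1) + V n * u n = E * u n)
    (hs : Summable fun n : ℤ => u n ^ 2) :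
    |u m * (u (m + 1) - u (m - 1))| ≤ δ * ∑' n, u n ^ 2 := by
  let w : ℕ → ℝ := fun j => u (m + j + 1) * u (m - j) - u (m + j) * u (m - j - 1)
  let g : ℕ → ℝ := fun j => δ / 2 * (u (m + 1 + j) ^ 2 + u (m - 1 - j) ^ 2)
  have inj₁ : ∀ a : ℤ, Function.Injective fun j : ℕ => a + j := fun a i j h => by simpa using h
  have inj₂ : ∀ a : ℤ, Function.Injective fun j : ℕ => a - j := fun a i j h => by simpa using h
  have s₁ : Summable fun j : ℕ => u (m + 1 + j) ^ 2 := hs.comp_injective (inj₁ _)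
  have s₂ : Summable fun j : ℕ => u (m - 1 - j) ^ 2 := hs.comp_injective (inj₂ _)
  have t₁ : ∑' j : ℕ, u (m + 1 + j) ^ 2 ≤ ∑' n, u n ^ 2 :=
    tsum_comp_le_tsum_of_inj hs (fun _ => sq_nonneg _) (inj₁ _)
  have t₂ : ∑' j : ℕ, u (m - 1 - j) ^ 2 ≤ ∑' n, u n ^ 2 :=
    tsum_comp_le_tsum_of_inj hs (fun _ => sq_nonneg _) (inj₂ _)
  have hg : Summable g := (s₁.add s₂).mul_left _
  have h0 := tendsto_cofinite_zero_of_summable_sq hs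
  have z₁ : ∀ a : ℤ, Tendsto (fun j : ℕ => u (a + j)) atTop (𝓝 0) := fun a => by
    simpa [Nat.cofinite_eq_atTop, Function.comp_def] using h0.comp (inj₁ a).tendsto_cofinite
  have z₂ : ∀ a : ℤ, Tendsto (fun j : ℕ => u (a - j)) atTop (𝓝 0) := fun a => by
    simpa [Nat.cofinite_eq_atTop, Function.comp_def] using h0.comp (inj₂ a).tendsto_cofinite
  have hw : Tendsto w atTop (𝓝 0) := by
    have h := ((z₁ (m + 1)).mul (z₂ m)).sub ((z₁ m).mul (z₂ (m - 1)))
    simp only [mul_zero, sub_zero] at h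
    refine h.congr fun j => ?_
    simp only [w, add_right_comm m 1, sub_right_comm m 1]
  have hd : ∀ j, dist (w j) (w j.succ) ≤ g j := fun j => by
    have e₁ := heq (m + 1 + j)
    have e₂ := heq (m - 1 - j)
    have hv := hV (m + 1 + j)
    have i₁ : 2 * m - (m + 1 + (j : ℤ)) = m - 1 - j := by ring
    rw [i₁] at hv
    have i₂ : m + 1 + (j : ℤ) - 1 = m + j := by ring
    have i₃ : m - 1 - (j : ℤ) + 1 = m - j := by ring
    rw [i₂] at e₁
    rw [i₃] at e₂
    have i₄ : m + ((j + 1 : ℕ) : ℤ) = m + 1 + j := by push_cast; ring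
    have i₅ : m - ((j + 1 : ℕ) : ℤ) = m - 1 - j := by push_cast; ring
    have i₆ : m + (j : ℤ) + 1 = m + 1 + j := by ring
    have i₇ : m - (j : ℤ) - 1 = m - 1 - j := by ring
    simp only [w, g, Nat.succ_eq_add_one, i₄, i₅, i₆, i₇, Real.dist_eq]
    have key : u (m + 1 + j) * u (m - j) - u (m + j) * u (m - 1 - j) -
        (u (m + 1 + j + 1) * u (m - 1 - j) - u (m + 1 + j) * u (m - 1 - j - 1)) =
        -(V (m - 1 - j) - V (m + 1 + j)) * (u (m + 1 + j) * u (m - 1 - j)) := by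
      linear_combination u (m + 1 + j) * e₂ - u (m - 1 - j) * e₁
    rw [key, abs_mul, abs_neg]
    have hab : |u (m + 1 + j) * u (m - 1 - j)| ≤
        (u (m + 1 + j) ^ 2 + u (m - 1 - j) ^ 2) / 2 := by
      rw [abs_le]
      constructor <;>
        nlinarith [sq_nonneg (u (m + 1 + j) + u (m - 1 - j)),
          sq_nonneg (u (m + 1 + j) - u (m - 1 - j))]
    calc _ ≤ δ * ((u (m + 1 + j) ^ 2 + u (m - 1 - j) ^ 2) / 2) := by gcongr
      _ = _ := by ring
  have h := dist_le_tsum_of_dist_le_of_tendsto₀ g hd hg hw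
  simp only [w, g, Nat.cast_zero, add_zero, sub_zero, Real.dist_eq, tsum_mul_left,
    s₁.tsum_add s₂] at h
  calc _ = |u (m + 1) * u m - u m * u (m - 1)| := by ring_nf
    _ ≤ _ := h
    _ ≤ δ / 2 * (∑' n, u n ^ 2 + ∑' n, u n ^ 2) := by gcongr
    _ = _ := by ring

/-- Growth bound, towards the left, for a solution of a second-order difference equation with
bounded coefficient `a` and inhomogeneity bounded by `ε`. -/
theorem abs_le_pow_mul_of_recurrence {a v : ℤ → ℝ} {C ε D : ℝ} {m : ℤ} (hC : 2 ≤ C)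
    (ha : ∀ n, |a n| ≤ C - 1) (hv : ∀ n, |v (n - 1) + v (n + 1) - a n * v n| ≤ ε)
    (h₀ : |v m| ≤ D) (h₁ : |v (m + 1)| ≤ D) (j : ℕ) :
    |v (m - j)| ≤ C ^ j * (D + ε) ∧ |v (m - j + 1)| ≤ C ^ j * (D + ε) := by
  have hε : 0 ≤ ε := (abs_nonneg _).trans (hv 0)
  suffices h : |v (m - j)| + ε ≤ C ^ j * (D + ε) ∧ |v (m - j + 1)| + ε ≤ C ^ j * (D + ε) from
    ⟨by linarith [h.1], by linarith [h.2]⟩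
  induction j with
  | zero => simpa using ⟨h₀, h₁⟩
  | succ j ih =>
    obtain ⟨ih₀, ih₁⟩ := ih
    set X := C ^ j * (D + ε) with hX
    have i₁ : m - ((j + 1 : ℕ) : ℤ) = m - j - 1 := by push_cast; ring
    have hXC : C ^ (j + 1) * (D + ε) = C * X := by rw [hX]; ring
    have hXε : 0 ≤ X - ε := by linarith [abs_nonneg (v (m - j))]
    rw [i₁, hXC, sub_add_cancel]
    constructor
    · have h := hv (m - j)
      have hav : |a (m - j) * v (m - j)| ≤ (C - 1) * (X - ε) := by
        rw [abs_mul]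
        exact mul_le_mul (ha _) (by linarith) (abs_nonneg _) (by linarith)
      have h3 : |v (m - j - 1)| ≤ ε + |a (m - j) * v (m - j)| + |v (m - j + 1)| := by
        have e : v (m - j - 1) = (v (m - j - 1) + v (m - j + 1) - a (m - j) * v (m - j))
            + a (m - j) * v (m - j) + -v (m - j + 1) := by ring
        rw [e]
        refine (abs_add_three _ _ _).trans ?_
        rw [abs_neg]
        gcongr
      nlinarith
    · nlinarith

/-- Near-reflection symmetry of the potential forces a square-summable solution to be almost
symmetric or almost antisymmetric near the origin. -/
theorem exists_sign_reflection_le {m : ℕ} {C r : ℝ} (hC : 3 ≤ C) (hr₀ : 0 ≤ r) (hr₁ : r ≤ 1)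
    (hEV : ∀ n, |E - V n| ≤ C - 1) (hV : ∀ n : ℤ, |V (2 * m - n) - V n| ≤ (r ^ m) ^ 2)
    (heq : ∀ n : ℤ, u (n + 1) + u (n - 1) + V n * u n = E * u n)
    (hs : Summable fun n : ℤ => u n ^ 2) :
    |u 0| ≤ |u (2 * m)| + (C * r) ^ m * ((C + 1) * √(∑' n, u n ^ 2)) ∧
      |u 1| ≤ |u (2 * m - 1)| + (C * r) ^ m * ((C + 1) * √(∑' n, u n ^ 2)) := by
  set S := √(∑' n, u n ^ 2) with hS
  have hT : 0 ≤ ∑' n, u n ^ 2 := tsum_nonneg fun _ => sq_nonneg _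
  have hS₀ : 0 ≤ S := Real.sqrt_nonneg _
  have hS₂ : S ^ 2 = ∑' n, u n ^ 2 := Real.sq_sqrt hT
  have huS : ∀ n, |u n| ≤ S := fun n => by
    rw [hS, ← Real.sqrt_sq_eq_abs]
    exact Real.sqrt_le_sqrt (hs.le_tsum n fun _ _ => sq_nonneg _)
  have hrm₀ : 0 ≤ r ^ m := pow_nonneg hr₀ m
  have hrm₁ : r ^ m ≤ 1 := pow_le_one₀ hr₀ hr₁
  have hW := abs_reflected_wronskian_le (sq_nonneg _) hV heq hs
  rw [← hS₂, ← mul_pow] at hW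
  set q := r ^ m * S with hq
  have hq₀ : 0 ≤ q := by positivity
  obtain ⟨σ, hσ, h₀, h₁⟩ : ∃ σ : ℝ, |σ| = 1 ∧ |u m + σ * u (2 * m - m)| ≤ C * q ∧
      |u (m + 1) + σ * u (2 * m - (m + 1))| ≤ C * q := by
    have i₁ : 2 * (m : ℤ) - m = m := by ring
    have i₂ : 2 * (m : ℤ) - (m + 1) = m - 1 := by ring
    rw [i₁, i₂]
    by_cases hsm : |u m| ≤ q
    · refine ⟨1, by simp, ?_, ?_⟩
      · rw [one_mul, ← two_mul, abs_mul, abs_two]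
        nlinarith
      · have e : u (m + 1) + 1 * u (m - 1) = (E - V m) * u m := by linear_combination heq m
        rw [e, abs_mul]
        exact mul_le_mul ((hEV m).trans (by linarith)) hsm (abs_nonneg _) (by linarith)
    · push Not at hsm
      refine ⟨-1, by simp, ?_, ?_⟩
      · rw [neg_one_mul, add_neg_cancel, abs_zero]
        positivity
      · rw [neg_one_mul, ← sub_eq_add_neg]
        rw [abs_mul] at hW
        by_contra! hlt
        have hdiff : q < |u (m + 1) - u (m - 1)| := by nlinarith
        linarith [mul_lt_mul'' hsm hdiff hq₀ hq₀, sq q]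
  have hrec : ∀ n : ℤ,
      |(u (n - 1) + σ * u (2 * m - (n - 1))) + (u (n + 1) + σ * u (2 * m - (n + 1)))
      - (E - V n) * (u n + σ * u (2 * m - n))| ≤ q := fun n => by
    have e := heq (2 * m - n)
    have i₁ : 2 * (m : ℤ) - n + 1 = 2 * m - (n - 1) := by ring
    have i₂ : 2 * (m : ℤ) - n - 1 = 2 * m - (n + 1) := by ring
    rw [i₁, i₂] at e
    have key : (u (n - 1) + σ * u (2 * m - (n - 1))) + (u (n + 1) + σ * u (2 * m - (n + 1)))
        - (E - V n) * (u n + σ * u (2 * m - n)) =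
        -(σ * ((V (2 * m - n) - V n) * u (2 * m - n))) := by
      linear_combination heq n + σ * e
    rw [key, abs_neg, abs_mul, hσ, one_mul, abs_mul]
    calc _ ≤ (r ^ m) ^ 2 * S := by gcongr; exacts [hV n, huS _]
      _ ≤ r ^ m * S := by gcongr; nlinarith
  have hfin := abs_le_pow_mul_of_recurrence (v := fun n => u n + σ * u (2 * m - n))
    (by linarith) hEV hrec h₀ h₁ m
  have hbd : C ^ m * (C * q + q) = (C * r) ^ m * ((C + 1) * S) := by rw [hq, mul_pow]; ring
  simp only [sub_self, zero_add, sub_zero, hbd] at hfin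
  have tri : ∀ x y : ℝ, |x| ≤ |y| + |x + σ * y| := fun x y => by
    have h := abs_sub (x + σ * y) (σ * y)
    rw [add_sub_cancel_right, abs_mul, hσ, one_mul] at h
    linarith
  exact ⟨(tri _ _).trans (by gcongr; exact hfin.1), (tri _ _).trans (by gcongr; exact hfin.2)⟩

/-- A solution of the difference equation vanishing at `0` and `1` is zero. -/
theorem eq_zero_of_initial_eq_zero
    (heq : ∀ n : ℤ, u (n + 1) + u (n - 1) + V n * u n = E * u n) (h₀ : u 0 = 0)
    (h₁ : u 1 = 0) : u = 0 := by
  have h : ∀ n : ℤ, u n = 0 ∧ u (n + 1) = 0 := fun n => by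
    induction n with
    | zero => exact ⟨h₀, by simpa using h₁⟩
    | succ i ih =>
      refine ⟨ih.2, ?_⟩
      have e := heq (i + 1)
      rw [add_sub_cancel_right, ih.1, ih.2] at e
      simpa using e
    | pred i ih =>
      rw [sub_add_cancel]
      refine ⟨?_, ih.1⟩
      have e := heq (-i)
      rw [ih.1, ih.2] at e
      simpa using e
  exact funext fun n => (h n).1

end Auxiliary

/-- Jitomirskaya–Simon Lemma: for a Jitomirskaya–Simon potential `V` and any `E ∈ ℝ`, the
difference equation `u(n+1) + u(n−1) + V(n)u(n) = E u(n)` has no nonzero square-summable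
solution. -/
theorem jitomirskaya_simon_lemma (V : ℤ → ℝ) (hV : JitomirskayaSimonPotential V) (E : ℝ) :
    ¬∃ u : ℤ → ℝ, u ≠ 0 ∧
      (∀ n : ℤ, u (n + 1) + u (n - 1) + V n * u n = E * u n) ∧
      Summable (fun n : ℤ => (u n) ^ 2) := by
  rintro ⟨u, hu, heq, hs⟩
  obtain ⟨hbdd, B, hB, m, hm, hsym⟩ := hV
  set M := ⨆ n : ℤ, |V n|
  have hM : ∀ n, |V n| ≤ M := le_ciSup hbdd
  have hM₀ : 0 ≤ M := (abs_nonneg _).trans (hM 0)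
  have hE := abs_energy_le hM hu heq hs
  set C := 3 + 2 * M with hCdef
  have hC : 3 ≤ C := by linarith
  have hlog : 0 < Real.log C := Real.log_pos (by linarith)
  have hEV : ∀ n, |E - V n| ≤ C - 1 := fun n => by
    have h := abs_sub E (V n)
    linarith [hM n]
  set r := Real.exp (-B / 2) with hr
  have hr₁ : r ≤ 1 := Real.exp_le_one_iff.2 (by linarith)
  have hCr : C * r < 1 := by
    rw [hr, ← Real.exp_log (show 0 < C by linarith), ← Real.exp_add, Real.exp_lt_one_iff]
    linarith
  have hp : Filter.Tendsto (fun k => (m k).toNat) Filter.atTop Filter.atTop :=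
    Filter.tendsto_atTop.2 fun b => (hm.eventually_ge_atTop (b : ℤ)).mono fun k hk => by omega
  have hest : ∀ᶠ k in Filter.atTop,
      |u 0| ≤ |u (2 * ((m k).toNat : ℤ))| +
        (C * r) ^ (m k).toNat * ((C + 1) * √(∑' n, u n ^ 2)) ∧
      |u 1| ≤ |u (2 * ((m k).toNat : ℤ) - 1)| +
        (C * r) ^ (m k).toNat * ((C + 1) * √(∑' n, u n ^ 2)) := by
    filter_upwards [hm.eventually_ge_atTop 0] with k hk
    refine exists_sign_reflection_le hC (Real.exp_pos _).le hr₁ hEV (fun n => ?_) heq hs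
    have hexp : (r ^ (m k).toNat) ^ 2 = Real.exp (-B * m k) := by
      have hcast : ((m k).toNat : ℝ) = (m k : ℝ) := by exact_mod_cast Int.toNat_of_nonneg hk
      rw [hr, ← Real.exp_nat_mul, ← Real.exp_nat_mul, hcast]
      congr 1
      push_cast
      ring
    rw [hexp, Int.toNat_of_nonneg hk]
    exact (hsym k n).le
  have hzero := (tendsto_zero_iff_abs_tendsto_zero u).1 (tendsto_cofinite_zero_of_summable_sq hs)
  have hlim : ∀ a : ℤ, Filter.Tendsto (fun k => |u (2 * ((m k).toNat : ℤ) - a)| +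
      (C * r) ^ (m k).toNat * ((C + 1) * √(∑' n, u n ^ 2))) Filter.atTop (nhds 0) := fun a => by
    have inj : Function.Injective fun j : ℕ => 2 * (j : ℤ) - a := fun i j h => by
      simpa using h
    have t₁ := (Nat.cofinite_eq_atTop ▸ hzero.comp inj.tendsto_cofinite).comp hp
    have t₂ := ((tendsto_pow_atTop_nhds_zero_of_lt_one
      (mul_nonneg (by linarith) (Real.exp_pos _).le) hCr).comp hp).mul_const
      ((C + 1) * √(∑' n, u n ^ 2))
    simpa [Function.comp_def] using t₁.add t₂
  have h₀ : |u 0| ≤ 0 := ge_of_tendsto (by simpa using hlim 0) (hest.mono fun k hk => hk.1)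
  have h₁ : |u 1| ≤ 0 := ge_of_tendsto (hlim 1) (hest.mono fun k hk => hk.2)
  exact hu (eq_zero_of_initial_eq_zero heq (abs_nonpos_iff.1 h₀) (abs_nonpos_iff.1 h₁))
end

section
/- (Jitomirskaya–Simon) For every λ > 0 and every irrational α ∈ ℝ, there is a dense G_δ subset G of the circle ℝ/ℤ such that for every ω ∈ G, the almost Mathieu operator H^{λ,α}_ω has no eigenvalues; that is, for every E ∈ ℝ there is no nonzero ψ ∈ ℓ²(ℤ, ℂ) with H^{λ,α}_ω ψ = E ψ. -/
open Filter Topology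

/-- If a square-summable solution of `u (n + 1) + u (n - 1) = q n * u n` has a coefficient `q` that
is nearly symmetric about `m`, then the Wronskian of `u` and its reflection is small at `m`. -/
theorem norm_mul_norm_sub_le_of_almost_symmetric {u q : ℤ → ℂ} {S δ : ℝ} {m : ℤ}
    (hu : ∀ n, u (n + 1) + u (n - 1) = q n * u n)
    (hS : ∀ s : Finset ℤ, ∑ n ∈ s, ‖u n‖ ^ 2 ≤ S)
    (hlim : Tendsto (fun n : ℕ => u n) atTop (𝓝 0))
    (hq : ∀ n, ‖q n - q (2 * m - n)‖ ≤ δ) :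
    ‖u m‖ * ‖u (m + 1) - u (m - 1)‖ ≤ δ * S := by
  have hδ : 0 ≤ δ := (norm_nonneg _).trans (hq 0)
  have hbound : ∀ n, ‖u n‖ ^ 2 ≤ S := fun n => by simpa using hS {n}
  set W : ℤ → ℂ := fun n => u (n + 1) * u (2 * m - n) - u n * u (2 * m - n - 1) with hW
  have hstep : ∀ n, W (n + 1) - W n = (q (n + 1) - q (2 * m - (n + 1))) *
      (u (n + 1) * u (2 * m - (n + 1))) := by
    intro n
    have h1 := hu (n + 1)
    have h2 := hu (2 * m - (n + 1))
    rw [show n + 1 - 1 = n by ring] at h1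
    rw [show 2 * m - (n + 1) + 1 = 2 * m - n by ring] at h2
    simp only [hW]
    rw [show 2 * m - n - 1 = 2 * m - (n + 1) by ring]
    linear_combination u (2 * m - (n + 1)) * h1 - u (n + 1) * h2
  have hinj₁ : Function.Injective (fun k : ℕ => m + k + 1) := fun a b h => by
    simp only at h; omega
  have hinj₂ : Function.Injective (fun k : ℕ => 2 * m - (m + k + 1)) := fun a b h => by
    simp only at h; omega
  have hprod : ∀ N : ℕ,
      ∑ k ∈ Finset.range N, ‖u (m + k + 1)‖ * ‖u (2 * m - (m + k + 1))‖ ≤ S := by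
    intro N
    have h1 := hS ((Finset.range N).map ⟨_, hinj₁⟩)
    have h2 := hS ((Finset.range N).map ⟨_, hinj₂⟩)
    rw [Finset.sum_map] at h1 h2
    simp only [Function.Embedding.coeFn_mk] at h1 h2
    have h3 : ∑ k ∈ Finset.range N, ‖u (m + k + 1)‖ * ‖u (2 * m - (m + k + 1))‖ ≤
        ∑ k ∈ Finset.range N,
          (‖u (m + k + 1)‖ ^ 2 + ‖u (2 * m - (m + k + 1))‖ ^ 2) / 2 :=
      Finset.sum_le_sum fun k _ => by
        nlinarith [sq_nonneg (‖u (m + k + 1)‖ - ‖u (2 * m - (m + k + 1))‖)]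
    rw [← Finset.sum_div, Finset.sum_add_distrib] at h3
    linarith
  have hdiff : ∀ N : ℕ, ‖W m‖ ≤ ‖W (m + N)‖ + δ * S := by
    intro N
    have htel : W (m + N) - W m = ∑ k ∈ Finset.range N, (W (m + k + 1) - W (m + k)) := by
      have := Finset.sum_range_sub (fun k : ℕ => W (m + k)) N
      simp only [Nat.cast_add, Nat.cast_one, Nat.cast_zero, add_zero, ← add_assoc] at this
      exact this.symm
    have hsum : ‖W (m + N) - W m‖ ≤ δ * S := by
      rw [htel]
      calc _ ≤ ∑ k ∈ Finset.range N, δ * (‖u (m + k + 1)‖ * ‖u (2 * m - (m + k + 1))‖) := by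
            refine norm_sum_le_of_le _ fun k _ => ?_
            rw [hstep, norm_mul, norm_mul]
            exact mul_le_mul_of_nonneg_right (hq _) (by positivity)
        _ ≤ δ * S := by
            rw [← Finset.mul_sum]
            exact mul_le_mul_of_nonneg_left (hprod N) hδ
    have := norm_sub_norm_le (W m) (W (m + N))
    rw [norm_sub_rev] at hsum
    linarith
  have hshift : ∀ c : ℤ, Tendsto (fun N : ℕ => ‖u (c + N)‖) atTop (𝓝 0) := by
    intro c
    have h1 : Tendsto (fun N : ℕ => (c + N).toNat) atTop atTop :=
      tendsto_atTop.2 fun b => by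
        filter_upwards [eventually_ge_atTop (b + c.natAbs)] with N hN
        omega
    have h2 := (hlim.comp h1).norm
    rw [norm_zero] at h2
    refine h2.congr' ?_
    filter_upwards [eventually_ge_atTop c.natAbs] with N hN
    simp only [Function.comp_apply]
    rw [Int.toNat_of_nonneg (by omega)]
  have hWlim : Tendsto (fun N : ℕ => ‖W (m + N)‖) atTop (𝓝 0) := by
    have h := ((hshift (m + 1)).add (hshift m)).mul_const (√S)
    rw [add_zero, zero_mul] at h
    refine squeeze_zero (fun _ => norm_nonneg _) (fun N => ?_) h
    have hb : ∀ n, ‖u n‖ ≤ √S := fun n => Real.le_sqrt_of_sq_le (hbound n)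
    calc ‖W (m + N)‖ ≤ ‖u (m + N + 1)‖ * ‖u (2 * m - (m + N))‖ +
          ‖u (m + N)‖ * ‖u (2 * m - (m + N) - 1)‖ := by
          simp only [hW]
          refine (norm_sub_le _ _).trans_eq ?_
          rw [norm_mul, norm_mul]
      _ ≤ ‖u (m + N + 1)‖ * √S + ‖u (m + N)‖ * √S := by
          gcongr <;> exact hb _
      _ = (‖u (m + 1 + N)‖ + ‖u (m + N)‖) * √S := by
          rw [add_right_comm m 1, add_mul]
  have hlast : ‖W m‖ ≤ δ * S := by
    have := ge_of_tendsto' (hWlim.add_const (δ * S)) hdiff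
    rwa [zero_add] at this
  have hWm : W m = u m * (u (m + 1) - u (m - 1)) := by
    simp only [hW]
    rw [show 2 * m - m = m by ring]
    ring
  rwa [hWm, norm_mul] at hlast

/-- Approximate solutions of a second-order difference equation with bounded coefficient grow at
most exponentially. -/
theorem norm_le_pow_mul_of_approx_solution {w q : ℤ → ℂ} {K A ε : ℝ} {m : ℤ}
    (hK : ∀ n, ‖q n‖ ≤ K) (hε : 0 ≤ ε)
    (hw : ∀ n, ‖w (n + 1) + w (n - 1) - q n * w n‖ ≤ ε)
    (h0 : ‖w m‖ ≤ A) (h1 : ‖w (m + 1)‖ ≤ A) (k : ℕ) :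
    ‖w (m - k)‖ + ε ≤ (K + 2) ^ k * (A + ε) ∧
      ‖w (m - k + 1)‖ + ε ≤ (K + 2) ^ k * (A + ε) := by
  have hK0 : 0 ≤ K := (norm_nonneg _).trans (hK 0)
  induction k with
  | zero => simpa using ⟨h0, h1⟩
  | succ k ih =>
    obtain ⟨iha, ihb⟩ := ih
    set B := (K + 2) ^ k * (A + ε) with hB
    have hB' : (K + 2) ^ (k + 1) * (A + ε) = (K + 2) * B := by rw [hB]; ring
    rw [hB']
    have hε' : ε ≤ B := by linarith [norm_nonneg (w (m - k))]
    have e1 : m - ((k + 1 : ℕ) : ℤ) = m - k - 1 := by push_cast; ring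
    rw [e1, sub_add_cancel]
    constructor
    · have h := hw (m - k)
      have hid : w (m - k - 1) = (w (m - k + 1) + w (m - k - 1) - q (m - k) * w (m - k)) -
          w (m - k + 1) + q (m - k) * w (m - k) := by ring
      have h2 : ‖q (m - k) * w (m - k)‖ ≤ K * (B - ε) := by
        rw [norm_mul]
        exact mul_le_mul (hK _) (by linarith) (norm_nonneg _) hK0
      have h3 : ‖w (m - k - 1)‖ ≤ ε + (B - ε) + K * (B - ε) := by
        rw [hid]
        exact norm_add_le_of_le (norm_sub_le_of_le h (by linarith)) h2
      nlinarith
    · nlinarith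

/-- A square-summable solution whose coefficient is nearly symmetric about `m` is nearly even or
nearly odd about `m`, down to the origin. -/
theorem norm_le_of_almost_symmetric {u q : ℤ → ℂ} {K T η : ℝ} {m : ℕ}
    (hu : ∀ n, u (n + 1) + u (n - 1) = q n * u n)
    (hT : 0 ≤ T) (hS : ∀ s : Finset ℤ, ∑ n ∈ s, ‖u n‖ ^ 2 ≤ T ^ 2)
    (hlim : Tendsto (fun n : ℕ => u n) atTop (𝓝 0))
    (hK : ∀ n, ‖q n‖ ≤ K) (hη : 0 ≤ η) (hη1 : η ≤ 1)
    (hq : ∀ n, ‖q n - q (2 * m - n)‖ ≤ η ^ 2) :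
    ‖u 0‖ ≤ (K + 2) ^ m * ((K + 3) * (η * T)) + ‖u (2 * m)‖ ∧
      ‖u 1‖ ≤ (K + 2) ^ m * ((K + 3) * (η * T)) + ‖u (2 * m - 1)‖ := by
  have hK0 : 0 ≤ K := (norm_nonneg _).trans (hK 0)
  have hηT : 0 ≤ η * T := mul_nonneg hη hT
  have hb : ∀ n, ‖u n‖ ≤ T := fun n =>
    le_of_sq_le_sq (by simpa using hS {n}) hT
  have hwron := norm_mul_norm_sub_le_of_almost_symmetric hu hS hlim hq
  obtain ⟨σ, hσ, hσm, hσm1⟩ : ∃ σ : ℂ, ‖σ‖ = 1 ∧ ‖u m + σ * u m‖ ≤ (K + 2) * (η * T) ∧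
      ‖u (m + 1) + σ * u (m - 1)‖ ≤ (K + 2) * (η * T) := by
    by_cases hcase : ‖u m‖ ≤ η * T
    · refine ⟨1, norm_one, ?_, ?_⟩
      · rw [one_mul]
        refine (norm_add_le_of_le hcase hcase).trans ?_
        nlinarith
      · rw [one_mul, hu, norm_mul]
        refine (mul_le_mul (hK _) hcase (norm_nonneg _) hK0).trans ?_
        nlinarith
    · refine ⟨-1, by simp, by simpa using by positivity, ?_⟩
      have hle : ‖u (m + 1) - u (m - 1)‖ ≤ η * T := by
        by_contra! h
        push Not at hcase
        nlinarith [mul_lt_mul'' hcase h hηT hηT]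
      rw [neg_one_mul, ← sub_eq_add_neg]
      nlinarith
  have hw : ∀ n : ℤ, ‖(u (n + 1) + σ * u (2 * m - (n + 1))) +
      (u (n - 1) + σ * u (2 * m - (n - 1))) - q n * (u n + σ * u (2 * m - n))‖ ≤ η * T := by
    intro n
    have h1 := hu n
    have h2 := hu (2 * m - n)
    have e : (u (n + 1) + σ * u (2 * m - (n + 1))) +
      (u (n - 1) + σ * u (2 * m - (n - 1))) - q n * (u n + σ * u (2 * m - n)) =
      -σ * ((q n - q (2 * m - n)) * u (2 * m - n)) := by
      rw [show 2 * (m : ℤ) - (n + 1) = 2 * m - n - 1 by ring,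
        show 2 * (m : ℤ) - (n - 1) = 2 * m - n + 1 by ring]
      linear_combination h1 + σ * h2
    rw [e, norm_mul, norm_neg, hσ, one_mul, norm_mul]
    refine mul_le_mul ((hq n).trans ?_) (hb _) (norm_nonneg _) hη
    nlinarith
  obtain ⟨ha, hb'⟩ := norm_le_pow_mul_of_approx_solution
    (w := fun n => u n + σ * u (2 * m - n)) (m := m) (A := (K + 2) * (η * T)) hK hηT hw
    (by simpa [show 2 * (m : ℤ) - m = m by ring] using hσm)
    (by simpa [show 2 * (m : ℤ) - (m + 1) = m - 1 by ring] using hσm1) m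
  simp only [sub_self, zero_add, sub_zero] at ha hb'
  have key : ∀ x y : ℂ, ‖x‖ ≤ ‖x + σ * y‖ + ‖y‖ := fun x y => by
    have := norm_sub_le (x + σ * y) (σ * y)
    rwa [add_sub_cancel_right, norm_mul, hσ, one_mul] at this
  have hA : (K + 2) * (η * T) + η * T = (K + 3) * (η * T) := by ring
  rw [hA] at ha hb'
  constructor
  · linarith [key (u 0) (u (2 * m))]
  · linarith [key (u 1) (u (2 * m - 1))]

/-- A second-order difference equation whose bounded coefficient is superexponentially close to
being symmetric about infinitely many centres has no nonzero square-summable solution. -/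
theorem eq_zero_of_frequently_almost_symmetric {u q : ℤ → ℂ} {K : ℝ}
    (hu : ∀ n, u (n + 1) + u (n - 1) = q n * u n)
    (hsum : Summable fun n => ‖u n‖ ^ 2) (hK : ∀ n, ‖q n‖ ≤ K)
    (hq : ∃ᶠ m : ℕ in atTop, ∀ n, ‖q n - q (2 * m - n)‖ ≤ (1 / (m.factorial : ℝ)) ^ 2) (n : ℤ) :
    u n = 0 := by
  set T := √(∑' n, ‖u n‖ ^ 2)
  have hT2 : T ^ 2 = ∑' n, ‖u n‖ ^ 2 := Real.sq_sqrt (tsum_nonneg fun _ => sq_nonneg _)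
  have hS : ∀ s : Finset ℤ, ∑ n ∈ s, ‖u n‖ ^ 2 ≤ T ^ 2 := fun s => by
    rw [hT2]
    exact hsum.sum_le_tsum s fun _ _ => sq_nonneg _
  have hcof : Tendsto (fun n : ℤ => ‖u n‖) cofinite (𝓝 0) := by
    have := hsum.tendsto_cofinite_zero.sqrt
    simpa [Real.sqrt_sq] using this
  have hsub : ∀ f : ℕ → ℤ, Function.Injective f →
      Tendsto (fun m => ‖u (f m)‖) atTop (𝓝 0) := fun f hf => by
    rw [← Nat.cofinite_eq_atTop]
    exact hcof.comp hf.tendsto_cofinite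
  have hlim : Tendsto (fun n : ℕ => u n) atTop (𝓝 0) :=
    tendsto_zero_iff_norm_tendsto_zero.2 (hsub _ Nat.cast_injective)
  have hgrow : Tendsto (fun m : ℕ => (K + 2) ^ m * ((K + 3) * (1 / (m.factorial : ℝ) * T)))
      atTop (𝓝 0) := by
    have := (FloorSemiring.tendsto_pow_div_factorial_atTop (K + 2)).mul_const ((K + 3) * T)
    rw [zero_mul] at this
    exact this.congr fun m => by ring
  have hall : ∃ᶠ m : ℕ in atTop,
      ‖u 0‖ ≤ (K + 2) ^ m * ((K + 3) * (1 / (m.factorial : ℝ) * T)) + ‖u (2 * m)‖ ∧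
      ‖u 1‖ ≤ (K + 2) ^ m * ((K + 3) * (1 / (m.factorial : ℝ) * T)) + ‖u (2 * m - 1)‖ := by
    refine hq.mono fun m hm => ?_
    refine norm_le_of_almost_symmetric hu (Real.sqrt_nonneg _) hS hlim hK (by positivity) ?_ hm
    rw [div_le_one (by positivity)]
    exact_mod_cast m.factorial_pos
  have h0 : u 0 = 0 := by
    have h := hgrow.add (hsub (fun m => 2 * m) fun a b h => by simp only at h; omega)
    rw [add_zero] at h
    exact norm_le_zero_iff.1 (ge_of_tendsto_of_frequently h (hall.mono fun _ => And.left))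
  have h1 : u 1 = 0 := by
    have h := hgrow.add (hsub (fun m => 2 * m - 1) fun a b h => by simp only at h; omega)
    rw [add_zero] at h
    exact norm_le_zero_iff.1 (ge_of_tendsto_of_frequently h (hall.mono fun _ => And.right))
  have hpair : u n = 0 ∧ u (n + 1) = 0 := by
    induction n using Int.induction_on with
    | zero => exact ⟨h0, by simpa using h1⟩
    | succ k ih =>
      refine ⟨ih.2, ?_⟩
      have := hu (k + 1)
      rwa [add_sub_cancel_right, ih.1, ih.2, mul_zero, add_zero] at this
    | pred k ih =>
      rw [sub_add_cancel]
      refine ⟨?_, ih.1⟩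
      have := hu (-k)
      rwa [ih.1, ih.2, mul_zero, zero_add] at this
  exact hpair.1

/-- Generic phases are approximated, along infinitely many `m`, by `-mα` to within any prescribed
accuracy. -/
theorem exists_dense_isGδ_frequently_norm_lt {α : ℝ} (hα : Irrational α) {ρ : ℕ → ℝ}
    (hρ : ∀ m, 0 < ρ m) :
    ∃ G : Set (AddCircle (1 : ℝ)), Dense G ∧ IsGδ G ∧
      ∀ θ ∈ G, ∃ᶠ m : ℕ in atTop, ‖θ + θ + (2 * m) • (α : AddCircle (1 : ℝ))‖ < ρ m := by
  set U : ℕ → Set (AddCircle (1 : ℝ)) := fun k => ⋃ m : ℕ, ⋃ _ : k ≤ m,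
    {θ | ‖θ + θ + (2 * m) • (α : AddCircle (1 : ℝ))‖ < ρ m} with hU
  have hUo : ∀ k, IsOpen (U k) := fun k =>
    isOpen_iUnion fun m => isOpen_iUnion fun _ => isOpen_lt (by fun_prop) continuous_const
  have hdense : DenseRange (· • (α : AddCircle (1 : ℝ)) : ℤ → AddCircle (1 : ℝ)) :=
    AddCircle.denseRange_zsmul_coe_iff.2 (by simpa using hα)
  have hUd : ∀ k, Dense (U k) := by
    intro k
    rw [dense_iff_inter_open]
    rintro V hV ⟨θ, hθ⟩
    have hcl : MapClusterPt (-θ) atTop (· • (α : AddCircle (1 : ℝ)) : ℕ → AddCircle (1 : ℝ)) :=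
      ((mapClusterPt_atTop_nsmul_tfae _ _).out 0 3).2 (hdense (-θ))
    have hVn : -V ∈ 𝓝 (-θ) := hV.neg.mem_nhds (by simpa using hθ)
    obtain ⟨m, hm, hkm⟩ := ((hcl.frequently hVn).and_eventually (eventually_ge_atTop k)).exists
    refine ⟨-(m • (α : AddCircle (1 : ℝ))), hm, ?_⟩
    simp only [hU, Set.mem_iUnion]
    refine ⟨m, hkm, ?_⟩
    have : -(m • (α : AddCircle (1 : ℝ))) + -(m • (α : AddCircle (1 : ℝ))) +
        (2 * m) • (α : AddCircle (1 : ℝ)) = 0 := by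
      rw [two_mul, add_smul]; abel
    simpa only [Set.mem_ofPred_eq, this, norm_zero] using hρ m
  refine ⟨⋂ k, U k, dense_iInter_of_isOpen_nat hUo hUd, .iInter_of_isOpen hUo, fun θ hθ => ?_⟩
  rw [frequently_atTop]
  intro k
  have := Set.mem_iInter.1 hθ k
  simp only [hU, Set.mem_iUnion] at this
  obtain ⟨m, hkm, hm⟩ := this
  exact ⟨m, hkm, hm⟩

/-- Reflecting the cosine potential about `m` changes it by at most a multiple of the distance
from `2ω + 2mα` to the integers. -/
theorem abs_cos_sub_cos_reflect_le (ω α : ℝ) (m : ℕ) (n : ℤ) :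
    |Real.cos (2 * Real.pi * (ω + n * α)) -
        Real.cos (2 * Real.pi * (ω + ((2 * m - n : ℤ) : ℝ) * α))| ≤
      2 * Real.pi *
        ‖(ω : AddCircle (1 : ℝ)) + ω + (2 * m) • (α : AddCircle (1 : ℝ))‖ := by
  have hcoe : (ω : AddCircle (1 : ℝ)) + ω + (2 * m) • (α : AddCircle (1 : ℝ)) =
      ((ω + ω + (2 * m : ℕ) • α : ℝ) : AddCircle (1 : ℝ)) := rfl
  rw [hcoe, UnitAddCircle.norm_eq]
  set j := round (ω + ω + (2 * m : ℕ) • α)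
  have hrefl : Real.cos (2 * Real.pi * (ω + ((2 * m - n : ℤ) : ℝ) * α)) =
      Real.cos (2 * Real.pi * (ω + n * α) - 2 * Real.pi * (ω + ω + (2 * m : ℕ) • α - j)) := by
    rw [← Real.cos_neg, ← Real.cos_add_int_mul_two_pi _ j]
    congr 1
    simp only [nsmul_eq_mul]
    push_cast
    ring
  rw [hrefl]
  refine (Real.abs_cos_sub_cos_le _ _).trans_eq ?_
  rw [sub_sub_cancel, abs_mul, abs_of_pos Real.two_pi_pos]

/-- Jitomirskaya–Simon: for every `λ > 0` and irrational `α`, there is a dense `G_δ` set of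
phases `ω` in the circle `ℝ/ℤ` for which the almost Mathieu operator `H^{λ,α}_ω` has no
eigenvalues. Here `Hop ω` is assumed to act on `ℓ²(ℤ, ℂ)` by
`(Hop ω ψ)(n) = ψ(n+1) + ψ(n−1) + 2λ cos(2π(ω + nα))ψ(n)`. -/
theorem jitomirskaya_simon_generic_phase (lam α : ℝ) (hlam : 0 < lam) (hα : Irrational α)
    (Hop : ℝ → (lp (fun _ : ℤ => ℂ) 2 →L[ℂ] lp (fun _ : ℤ => ℂ) 2))
    (hHop : ∀ (ω : ℝ) (ψ : lp (fun _ : ℤ => ℂ) 2) (n : ℤ),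
      (Hop ω ψ) n = ψ (n + 1) + ψ (n - 1) +
        (↑(2 * lam * Real.cos (2 * Real.pi * (ω + n * α))) : ℂ) * ψ n) :
    ∃ G : Set (AddCircle (1 : ℝ)), Dense G ∧ IsGδ G ∧
      ∀ ω : ℝ, (↑ω : AddCircle (1 : ℝ)) ∈ G →
        ∀ E : ℝ, ¬∃ ψ : lp (fun _ : ℤ => ℂ) 2, ψ ≠ 0 ∧ Hop ω ψ = (E : ℂ) • ψ := by
  obtain ⟨G, hGd, hGδ, hG⟩ := exists_dense_isGδ_frequently_norm_lt hα
    (ρ := fun m => (1 / (m.factorial : ℝ)) ^ 2 / (4 * Real.pi * lam)) fun m => by positivity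
  refine ⟨G, hGd, hGδ, ?_⟩
  rintro ω hω E ⟨ψ, hψ, hev⟩
  apply hψ
  set V : ℤ → ℝ := fun n => 2 * lam * Real.cos (2 * Real.pi * (ω + n * α)) with hV
  have hVb : ∀ n, |V n| ≤ 2 * lam := fun n => by
    rw [hV, abs_mul, abs_of_pos (by positivity : 0 < 2 * lam)]
    exact mul_le_of_le_one_right (by positivity) (Real.abs_cos_le_one _)
  have hrec : ∀ n, ψ (n + 1) + ψ (n - 1) = ((E : ℂ) - (V n : ℂ)) * ψ n := fun n => by
    have h1 := hHop ω ψ n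
    rw [hev, lp.coeFn_smul, Pi.smul_apply, smul_eq_mul] at h1
    linear_combination -h1
  have hsum : Summable fun n => ‖ψ n‖ ^ 2 := by
    simpa using (memℓp_gen_iff (by norm_num)).1 (lp.memℓp ψ)
  have hbound : ∀ n, ‖(E : ℂ) - (V n : ℂ)‖ ≤ |E| + 2 * lam := fun n =>
    norm_sub_le_of_le (by simp) (by simpa using hVb n)
  ext n
  refine eq_zero_of_frequently_almost_symmetric hrec hsum hbound ?_ n
  refine (hG _ hω).mono fun m hm n => ?_
  rw [sub_sub_sub_cancel_left, norm_sub_rev, ← Complex.ofReal_sub, Complex.norm_real,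
    Real.norm_eq_abs, hV, ← mul_sub, abs_mul, abs_of_pos (by positivity : 0 < 2 * lam)]
  rw [lt_div_iff₀ (by positivity)] at hm
  nlinarith [mul_le_mul_of_nonneg_left (abs_cos_sub_cos_reflect_le ω α m n)
    (by positivity : 0 ≤ 2 * lam)]
end

section
/- (Jitomirskaya localization, solution form) Suppose λ > 1, α ∈ ℝ is Diophantine, and ω ∈ ℝ is non-resonant for α. Let E ∈ ℝ and let u : ℤ → ℝ be a nonzero solution of u(n+1) + u(n−1) + 2λ cos(2π(ω + nα)) u(n) = E u(n) satisfying |u(n)| ≤ C(1 + |n|)^δ for some constants C > 0 and δ > 0 and all n ∈ ℤ. Then u decays exponentially: there exist constants C' > 0 and β > 0 such that |u(n)| ≤ C' e^{−β|n|} for all n ∈ ℤ. -/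
namespace AlmostMathieu

/-- Determinants of the Dirichlet restrictions `E - H` of the almost Mathieu operator to the
sites `0, …, n - 2`, as functions of the phase `θ`; the index is shifted so that the sequence
starts with the value `0` attached to the empty string of length `-1`. -/
noncomputable def dirDet (lam α E : ℝ) : ℕ → ℝ → ℝ
  | 0, _ => 0
  | 1, _ => 1
  | n + 2, θ => (E - 2 * lam * Real.cos (2 * Real.pi * (θ + n * α))) * dirDet lam α E (n + 1) θ
      - dirDet lam α E n θ

section Algebra

variable {lam α E : ℝ}

lemma dirDet_zero (θ : ℝ) : dirDet lam α E 0 θ = 0 := by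
  simp [dirDet]

lemma dirDet_one (θ : ℝ) : dirDet lam α E 1 θ = 1 := by
  simp [dirDet]

lemma dirDet_add_two (n : ℕ) (θ : ℝ) : dirDet lam α E (n + 2) θ =
    (E - 2 * lam * Real.cos (2 * Real.pi * (θ + n * α))) * dirDet lam α E (n + 1) θ
      - dirDet lam α E n θ := by
  rw [dirDet]

lemma dirDet_two (θ : ℝ) :
    dirDet lam α E 2 θ = E - 2 * lam * Real.cos (2 * Real.pi * θ) := by
  rw [dirDet_add_two 0, dirDet_one, dirDet_zero]
  simp

lemma dirDet_add (k l : ℕ) (θ : ℝ) : dirDet lam α E (k + l + 1) θ =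
    dirDet lam α E (k + 1) θ * dirDet lam α E (l + 1) (θ + k * α)
      - dirDet lam α E k θ * dirDet lam α E l (θ + (k + 1) * α) := by
  induction l using Nat.strong_induction_on with
  | _ l ih =>
    match l with
    | 0 => simp [dirDet_zero, dirDet_one]
    | 1 => simp [dirDet_add_two, dirDet_zero, dirDet_one]; ring
    | l + 2 =>
      have h1 := ih (l + 1) (by omega)
      have h0 := ih l (by omega)
      have e : k + (l + 2) + 1 = (k + l + 1) + 2 := by ring
      rw [e, dirDet_add_two, show k + l + 1 + 1 = k + (l + 1) + 1 by ring, h1, h0,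
        dirDet_add_two (l + 1) (θ + k * α), dirDet_add_two l (θ + (k + 1) * α)]
      have c1 : θ + k * α + ((l + 1 : ℕ) : ℝ) * α = θ + ((k + l + 1 : ℕ) : ℝ) * α := by
        push_cast; ring
      have c2 : θ + (k + 1) * α + (l : ℝ) * α = θ + ((k + l + 1 : ℕ) : ℝ) * α := by
        push_cast; ring
      rw [c1, c2]
      ring

lemma dirDet_reflect (k : ℕ) (θ : ℝ) :
    dirDet lam α E (k + 1) (-θ - ((k : ℝ) - 1) * α) = dirDet lam α E (k + 1) θ := by
  induction k using Nat.strong_induction_on generalizing θ with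
  | _ k ih =>
    match k with
    | 0 => simp [dirDet_one]
    | 1 => simp [dirDet_two]
    | k + 2 =>
      have h1 := ih (k + 1) (by omega) (θ + α)
      have h0 := ih k (by omega) (θ + 2 * α)
      have hl := dirDet_add (lam := lam) (α := α) (E := E) 1 (k + 1) θ
      rw [show 1 + (k + 1) + 1 = k + 2 + 1 by ring, dirDet_two] at hl
      rw [show k + 2 + 1 = (k + 1) + 2 by ring, dirDet_add_two,
        show k + 1 + 2 = k + 2 + 1 by ring, hl]
      have c1 : -θ - (((k + 2 : ℕ) : ℝ) - 1) * α = -(θ + α) - (((k + 1 : ℕ) : ℝ) - 1) * α := by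
        push_cast; ring
      have c2 : -θ - (((k + 2 : ℕ) : ℝ) - 1) * α = -(θ + 2 * α) - ((k : ℝ) - 1) * α := by
        push_cast; ring
      have c3 : 2 * Real.pi * (-θ - (((k + 2 : ℕ) : ℝ) - 1) * α + ((k + 1 : ℕ) : ℝ) * α)
          = -(2 * Real.pi * θ) := by
        push_cast; ring
      rw [c3, Real.cos_neg, c1, h1, ← c1, c2, h0]
      have d1 : θ + ((1 : ℕ) : ℝ) * α = θ + α := by simp
      have d2 : θ + (((1 : ℕ) : ℝ) + 1) * α = θ + 2 * α := by push_cast; ring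
      rw [d1, d2, dirDet_one, one_mul]

lemma solution_wronskian {ω : ℝ} {u : ℤ → ℝ}
    (hsol : ∀ n : ℤ,
      u (n + 1) + u (n - 1) + 2 * lam * Real.cos (2 * Real.pi * (ω + n * α)) * u n = E * u n)
    (a : ℤ) (i : ℕ) :
    u (a + i) * dirDet lam α E (i + 2) (ω + a * α)
      = u (a - 1) + dirDet lam α E (i + 1) (ω + a * α) * u (a + i + 1) := by
  induction i with
  | zero =>
    have h := hsol a
    simp only [Nat.cast_zero, add_zero, zero_add, dirDet_two, dirDet_one]
    linarith
  | succ i ih =>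
    have h := hsol (a + i + 1)
    rw [dirDet_add_two]
    have c1 : (a + ((i + 1 : ℕ) : ℤ)) = a + i + 1 := by push_cast; ring
    have c2 : ω + a * α + ((i + 1 : ℕ) : ℝ) * α = ω + ((a + i + 1 : ℤ) : ℝ) * α := by
      push_cast; ring
    rw [c1, c2]
    rw [show a + (i : ℤ) + 1 - 1 = a + i by ring] at h
    rw [show i + 1 + 1 = i + 2 by ring]
    linear_combination (-(dirDet lam α E (i + 2) (ω + a * α))) * h + ih

/-- The solution inside an interval in terms of its values at the two neighbouring sites. -/
lemma solution_eq {ω : ℝ} {u : ℤ → ℝ}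
    (hsol : ∀ n : ℤ,
      u (n + 1) + u (n - 1) + 2 * lam * Real.cos (2 * Real.pi * (ω + n * α)) * u n = E * u n)
    (a : ℤ) (i l : ℕ) :
    u (a + i) * dirDet lam α E (i + l + 2) (ω + a * α)
      = dirDet lam α E (l + 1) (ω + (a + i + 1) * α) * u (a - 1)
        + dirDet lam α E (i + 1) (ω + a * α) * u (a + i + l + 1) := by
  induction l using Nat.strong_induction_on with
  | _ l ih =>
    match l with
    | 0 =>
      have := solution_wronskian hsol a i
      simpa [dirDet_one] using this
    | 1 =>
      have h := solution_wronskian hsol a i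
      have h2 := hsol (a + i + 1)
      rw [show a + (i : ℤ) + 1 - 1 = a + i by ring] at h2
      rw [dirDet_add_two, dirDet_two]
      have c : ω + a * α + ((i + 1 : ℕ) : ℝ) * α = ω + ((a + i + 1 : ℤ) : ℝ) * α := by
        push_cast; ring
      rw [c]
      rw [show i + 1 + 1 = i + 2 by ring]
      push_cast at h2 ⊢
      linear_combination
        (E - 2 * lam * Real.cos (2 * Real.pi * (ω + (a + i + 1) * α))) * h
          - dirDet lam α E (i + 1) (ω + a * α) * h2
    | l + 2 =>
      have h1 := ih (l + 1) (by omega)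
      have h0 := ih l (by omega)
      have h2 := hsol (a + i + l + 2)
      rw [show a + (i : ℤ) + l + 2 - 1 = a + i + l + 1 by ring] at h2
      rw [show i + (l + 2) + 2 = (i + l + 2) + 2 by ring, dirDet_add_two,
        show l + 2 + 1 = (l + 1) + 2 by ring, dirDet_add_two (l + 1)]
      rw [show i + (l + 1) + 2 = i + l + 2 + 1 by ring] at h1
      have c : ω + a * α + ((i + l + 2 : ℕ) : ℝ) * α = ω + ((a + i + l + 2 : ℤ) : ℝ) * α := by
        push_cast; ring
      have c' : ω + (a + i + 1) * α + ((l + 1 : ℕ) : ℝ) * α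
          = ω + ((a + i + l + 2 : ℤ) : ℝ) * α := by
        push_cast; ring
      rw [c, c']
      rw [show a + (i : ℤ) + ((l + 2 : ℕ) : ℤ) + 1 = a + i + l + 2 + 1 by push_cast; ring]
      rw [show a + (i : ℤ) + ((l + 1 : ℕ) : ℤ) + 1 = a + i + l + 2 by push_cast; ring] at h1
      linear_combination
        (E - 2 * lam * Real.cos (2 * Real.pi * (ω + ((a + i + l + 2 : ℤ) : ℝ) * α))) * h1 - h0
          - dirDet lam α E (i + 1) (ω + a * α) * h2

lemma exists_trig_poly (s : ℝ) (n : ℕ) :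
    ∃ A B : Polynomial ℝ, A.degree < n ∧ B.degree < (n - 1 : ℕ) ∧
      ∀ t : ℝ, dirDet lam α E n (t + s) = A.eval (Real.cos (2 * Real.pi * t))
        + Real.sin (2 * Real.pi * t) * B.eval (Real.cos (2 * Real.pi * t)) := by
  induction n using Nat.strong_induction_on with
  | _ n ih =>
    match n with
    | 0 => exact ⟨0, 0, by simp, by simp, fun t => by simp [dirDet_zero]⟩
    | 1 => exact ⟨1, 0, by simp, by simp, fun t => by simp [dirDet_one]⟩
    | n + 2 =>
      obtain ⟨A1, B1, hA1, hB1, h1⟩ := ih (n + 1) (by omega)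
      obtain ⟨A0, B0, hA0, hB0, h0⟩ := ih n (by omega)
      set φ : ℝ := 2 * Real.pi * (s + n * α) with hφ
      refine ⟨Polynomial.C E * A1 - Polynomial.C (2 * lam * Real.cos φ) * (A1 * Polynomial.X)
          + Polynomial.C (2 * lam * Real.sin φ) * (B1 - B1 * Polynomial.X * Polynomial.X) - A0,
        Polynomial.C E * B1 - Polynomial.C (2 * lam * Real.cos φ) * (B1 * Polynomial.X)
          + Polynomial.C (2 * lam * Real.sin φ) * A1 - B0, ?_, ?_, ?_⟩
      · rw [Polynomial.degree_lt_iff_coeff_zero] at *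
        intro m hm
        obtain ⟨m, rfl⟩ : ∃ j, m = j + 2 := ⟨m - 2, by omega⟩
        simp only [Polynomial.coeff_sub, Polynomial.coeff_add, Polynomial.coeff_C_mul,
          Polynomial.coeff_mul_X]
        rw [hA1 (m + 2) (by omega), hA1 (m + 1) (by omega), hB1 (m + 2) (by omega),
          hB1 m (by omega), hA0 (m + 2) (by omega)]
        ring
      · rw [Polynomial.degree_lt_iff_coeff_zero] at *
        intro m hm
        obtain ⟨m, rfl⟩ : ∃ j, m = j + 1 := ⟨m - 1, by omega⟩
        simp only [Polynomial.coeff_sub, Polynomial.coeff_add, Polynomial.coeff_C_mul,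
          Polynomial.coeff_mul_X]
        rw [hA1 (m + 1) (by omega), hB1 (m + 1) (by omega), hB1 m (by omega),
          hB0 (m + 1) (by omega)]
        ring
      · intro t
        rw [dirDet_add_two, h1, h0]
        have c : Real.cos (2 * Real.pi * (t + s + n * α))
            = Real.cos (2 * Real.pi * t) * Real.cos φ - Real.sin (2 * Real.pi * t) * Real.sin φ := by
          rw [← Real.cos_add, hφ]; congr 1; ring
        rw [c]
        simp only [Polynomial.eval_sub, Polynomial.eval_add, Polynomial.eval_mul,
          Polynomial.eval_C, Polynomial.eval_X]
        have := Real.sin_sq_add_cos_sq (2 * Real.pi * t)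
        linear_combination (2 * lam * Real.sin φ
          * Polynomial.eval (Real.cos (2 * Real.pi * t)) B1) * this

/-- After centring the phase, the determinant is a polynomial in the cosine. -/
lemma exists_cos_poly (lam α E : ℝ) (k : ℕ) :
    ∃ R : Polynomial ℝ, R.degree < (k + 1 : ℕ) ∧
      ∀ t : ℝ, dirDet lam α E (k + 1) (t - ((k : ℝ) - 1) / 2 * α)
        = R.eval (Real.cos (2 * Real.pi * t)) := by
  obtain ⟨A, B, hA, -, h⟩ :=
    exists_trig_poly (lam := lam) (α := α) (E := E) (-(((k : ℝ) - 1) / 2 * α)) (k + 1)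
  refine ⟨A, hA, fun t => ?_⟩
  have h1 := h t
  have h2 := h (-t)
  have h3 := dirDet_reflect (lam := lam) (α := α) (E := E) k (t - ((k : ℝ) - 1) / 2 * α)
  rw [show -(t - ((k : ℝ) - 1) / 2 * α) - ((k : ℝ) - 1) * α
    = -t + -(((k : ℝ) - 1) / 2 * α) by ring] at h3
  rw [show 2 * Real.pi * -t = -(2 * Real.pi * t) by ring, Real.cos_neg, Real.sin_neg] at h2
  rw [← sub_eq_add_neg] at h1
  linarith

end Algebra

section Growth

variable {lam α E : ℝ}

/-- The complexification of `dirDet`, multiplied by a power of `z` to make it entire. -/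
noncomputable def dirDetC (lam α E : ℝ) : ℕ → ℂ → ℂ
  | 0, _ => 0
  | 1, _ => 1
  | n + 2, z => (E * z - lam * (Complex.exp (2 * Real.pi * (n * α) * Complex.I) * z ^ 2
      + Complex.exp (-(2 * Real.pi * (n * α) * Complex.I)))) * dirDetC lam α E (n + 1) z
      - z ^ 2 * dirDetC lam α E n z

lemma dirDetC_differentiable (n : ℕ) : Differentiable ℂ (dirDetC lam α E n) := by
  induction n using Nat.strong_induction_on with
  | _ n ih =>
    match n with
    | 0 =>
      have : dirDetC lam α E 0 = fun _ => 0 := by ext z; rw [dirDetC]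
      rw [this]; fun_prop
    | 1 =>
      have : dirDetC lam α E 1 = fun _ => 1 := by ext z; rw [dirDetC]
      rw [this]; fun_prop
    | n + 2 =>
      have h1 := ih (n + 1) (by omega)
      have h0 := ih n (by omega)
      have : dirDetC lam α E (n + 2) = fun z =>
          (E * z - lam * (Complex.exp (2 * Real.pi * (n * α) * Complex.I) * z ^ 2
          + Complex.exp (-(2 * Real.pi * (n * α) * Complex.I)))) * dirDetC lam α E (n + 1) z
          - z ^ 2 * dirDetC lam α E n z := by ext z; rw [dirDetC]
      rw [this]; fun_prop

lemma norm_dirDetC_zero (hlam : 0 ≤ lam) (n : ℕ) :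
    ‖dirDetC lam α E (n + 1) 0‖ = lam ^ n := by
  induction n with
  | zero => rw [dirDetC]; simp
  | succ n ih =>
    rw [dirDetC]
    have h : ‖Complex.exp (-(2 * Real.pi * (n * α) * Complex.I))‖ = 1 := by
      rw [show -(2 * Real.pi * (n * α) * Complex.I) =
        ((-(2 * Real.pi * (n * α)) : ℝ) : ℂ) * Complex.I by push_cast; ring]
      exact Complex.norm_exp_ofReal_mul_I _
    simp only [mul_zero, ne_eq, OfNat.ofNat_ne_zero, not_false_eq_true, zero_pow, zero_add,
      zero_sub, zero_mul, sub_zero, norm_mul, norm_neg, ih, h, Complex.norm_real,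
      Real.norm_eq_abs, abs_of_nonneg hlam, mul_one]
    ring

lemma dirDetC_exp (θ : ℝ) (n : ℕ) :
    Complex.exp (2 * Real.pi * θ * Complex.I)
        * dirDetC lam α E n (Complex.exp (2 * Real.pi * θ * Complex.I))
      = Complex.exp (2 * Real.pi * θ * Complex.I) ^ n * dirDet lam α E n θ := by
  induction n using Nat.strong_induction_on with
  | _ n ih =>
    match n with
    | 0 => rw [dirDetC, dirDet]; simp
    | 1 => rw [dirDetC, dirDet]; simp
    | n + 2 =>
      have h1 := ih (n + 1) (by omega)
      have h0 := ih n (by omega)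
      set z := Complex.exp (2 * Real.pi * θ * Complex.I) with hz
      rw [dirDetC, dirDet_add_two]
      have key : Complex.exp (2 * Real.pi * (n * α) * Complex.I) * z ^ 2
          + Complex.exp (-(2 * Real.pi * (n * α) * Complex.I))
          = z * (2 * Complex.cos (2 * Real.pi * (θ + n * α))) := by
        rw [Complex.two_cos, mul_add, hz, ← Complex.exp_nat_mul, ← Complex.exp_add,
          ← Complex.exp_add, ← Complex.exp_add]
        congr 2 <;> push_cast <;> ring
      rw [key]
      push_cast
      linear_combination (z * E - z * lam * (2 * Complex.cos (2 * Real.pi * (θ + n * α)))) * h1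
        - z ^ 2 * h0

lemma pow_le_of_dirDet_le (hlam : 0 ≤ lam) (n : ℕ) {M : ℝ}
    (hM : ∀ θ, |dirDet lam α E (n + 1) θ| ≤ M) : lam ^ n ≤ M := by
  rw [← norm_dirDetC_zero (α := α) (E := E) hlam n]
  refine Complex.norm_le_of_forall_mem_frontier_norm_le (U := Metric.ball 0 1)
    Metric.isBounded_ball ((dirDetC_differentiable _).diffContOnCl) ?_ ?_
  · intro z hz
    rw [frontier_ball _ one_ne_zero] at hz
    have hz1 : ‖z‖ = 1 := by simpa using hz
    have hze : Complex.exp (2 * Real.pi * ((z.arg / (2 * Real.pi) : ℝ) : ℂ) * Complex.I) = z := by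
      have h2 : 2 * (Real.pi : ℂ) * ((z.arg / (2 * Real.pi) : ℝ) : ℂ) = (z.arg : ℂ) := by
        have : (Real.pi : ℂ) ≠ 0 := by exact_mod_cast Real.pi_ne_zero
        push_cast
        field_simp
      rw [h2]
      have := Complex.norm_mul_exp_arg_mul_I z
      rwa [hz1, Complex.ofReal_one, one_mul] at this
    have h := dirDetC_exp (lam := lam) (α := α) (E := E) (z.arg / (2 * Real.pi)) (n + 1)
    rw [hze] at h
    have h' := congrArg norm h
    rw [norm_mul, norm_mul, norm_pow, hz1, one_mul, one_pow, one_mul, Complex.norm_real,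
      Real.norm_eq_abs] at h'
    rw [h']
    exact hM _
  · exact subset_closure (by simp)

lemma abs_dirDet_le_pow (lam α E : ℝ) (n : ℕ) (θ : ℝ) :
    |dirDet lam α E n θ| ≤ (|E| + 2 * |lam| + 1) ^ n := by
  induction n using Nat.strong_induction_on with
  | _ n ih =>
    match n with
    | 0 => simp [dirDet_zero]
    | 1 =>
      have := abs_nonneg E
      have := abs_nonneg lam
      simp only [dirDet_one, abs_one, pow_one]; linarith
    | n + 2 =>
      have h1 := ih (n + 1) (by omega)
      have h0 := ih n (by omega)
      set W := |E| + 2 * |lam| + 1 with hW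
      have hW1 : 1 ≤ W := by
        have := abs_nonneg E
        have := abs_nonneg lam
        linarith
      have hw : |E - 2 * lam * Real.cos (2 * Real.pi * (θ + n * α))| ≤ W - 1 := by
        refine (abs_sub _ _).trans ?_
        rw [abs_mul, abs_mul, abs_two]
        have := Real.abs_cos_le_one (2 * Real.pi * (θ + n * α))
        have := mul_le_mul_of_nonneg_left this (by positivity : 0 ≤ 2 * |lam|)
        linarith
      rw [dirDet_add_two]
      refine (abs_sub _ _).trans ?_
      rw [abs_mul]
      calc _ ≤ (W - 1) * W ^ (n + 1) + W ^ n := by gcongr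
        _ ≤ (W - 1) * W ^ (n + 1) + W ^ (n + 1) := by
          gcongr
          omega
        _ = W ^ (n + 2) := by ring

lemma bddAbove_dirDet (lam α E : ℝ) (n : ℕ) :
    BddAbove (Set.range fun θ => |dirDet lam α E n θ|) :=
  ⟨_, by rintro _ ⟨θ, rfl⟩; exact abs_dirDet_le_pow lam α E n θ⟩

/-- The uniform exponential growth rate of the determinants exists and is positive. -/
lemma exists_growth_rate (α E : ℝ) (hlam : 1 < lam) :
    ∃ L > (0 : ℝ), ∀ ε > (0 : ℝ),
      (∃ N : ℕ, ∀ n ≥ N, ∀ θ, |dirDet lam α E n θ| ≤ Real.exp ((L + ε) * n)) ∧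
      ∃ N : ℕ, ∀ n ≥ N, ∃ θ, Real.exp ((L - ε) * n) ≤ |dirDet lam α E (n + 1) θ| ∨
        Real.exp ((L - ε) * n) ≤ |dirDet lam α E n θ| := by
  have hlam0 : 0 < lam := by linarith
  set a : ℕ → ℝ := fun n => ⨆ θ, |dirDet lam α E n θ| with ha
  have hle : ∀ n θ, |dirDet lam α E n θ| ≤ a n := fun n θ =>
    le_ciSup (bddAbove_dirDet lam α E n) θ
  have ha0 : ∀ n, 0 ≤ a n := fun n => (abs_nonneg _).trans (hle n 0)
  have hlow : ∀ n, lam ^ n ≤ a (n + 1) := fun n => pow_le_of_dirDet_le hlam0.le n (hle (n + 1))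
  set b : ℕ → ℝ := fun n => max (a (n + 1)) (a n) with hb
  have hb1 : ∀ n, a (n + 1) ≤ b n := fun n => le_max_left _ _
  have hb0 : ∀ n, a n ≤ b n := fun n => le_max_right _ _
  have hbpos : ∀ n, 0 < b n := fun n => lt_of_lt_of_le (pow_pos hlam0 n) ((hlow n).trans (hb1 n))
  set W := |E| + 2 * |lam| + 1 with hW
  have hW1 : 1 ≤ W := by
    have := abs_nonneg E
    have := abs_nonneg lam
    linarith
  have hw : ∀ x, |E - 2 * lam * Real.cos x| ≤ W - 1 := by
    intro x
    refine (abs_sub _ _).trans ?_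
    rw [abs_mul, abs_mul, abs_two]
    have := Real.abs_cos_le_one x
    have := mul_le_mul_of_nonneg_left this (by positivity : 0 ≤ 2 * |lam|)
    linarith
  have hback : ∀ l, a l ≤ W * b (l + 1) := by
    intro l
    refine ciSup_le fun θ => ?_
    have h := dirDet_add_two (lam := lam) (α := α) (E := E) l θ
    have h' : dirDet lam α E l θ =
      (E - 2 * lam * Real.cos (2 * Real.pi * (θ + l * α))) * dirDet lam α E (l + 1) θ
        - dirDet lam α E (l + 2) θ := by linarith
    rw [h']
    refine (abs_sub _ _).trans ?_
    rw [abs_mul]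
    have h1 : |dirDet lam α E (l + 1) θ| ≤ b (l + 1) := (hle _ _).trans (hb0 _)
    have h2 : |dirDet lam α E (l + 2) θ| ≤ b (l + 1) := (hle _ _).trans (hb1 _)
    calc _ ≤ (W - 1) * b (l + 1) + b (l + 1) := by gcongr; exact hw _
      _ = W * b (l + 1) := by ring
  have hsub1 : ∀ k l, a (k + l + 1) ≤ (1 + W) * b k * b l := by
    intro k l
    refine ciSup_le fun θ => ?_
    rw [dirDet_add]
    refine (abs_sub _ _).trans ?_
    rw [abs_mul, abs_mul]
    calc _ ≤ b k * b l + b k * b l := by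
          gcongr
          · exact (hbpos k).le
          · exact (hle _ _).trans (hb1 _)
          · exact (hle _ _).trans (hb1 _)
          · exact (hbpos k).le
          · exact (hle _ _).trans (hb0 _)
          · exact (hle _ _).trans (hb0 _)
      _ = (1 + 1) * (b k * b l) := by ring
      _ ≤ (1 + W) * (b k * b l) := by
          have := mul_pos (hbpos k) (hbpos l)
          gcongr
      _ = _ := by ring
  have hsub0 : ∀ k l, a (k + l) ≤ (1 + W) * b k * b l := by
    intro k l
    rcases l with _ | l
    · have h1 : 1 ≤ b 0 := by
        refine le_trans ?_ (hb1 0)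
        simpa using hlow 0
      calc a (k + 0) ≤ b k := hb0 k
        _ = 1 * b k * 1 := by ring
        _ ≤ (1 + W) * b k * b 0 := by
          have := hbpos k
          gcongr
          linarith
    · refine ciSup_le fun θ => ?_
      rw [← add_assoc, dirDet_add]
      refine (abs_sub _ _).trans ?_
      rw [abs_mul, abs_mul]
      calc _ ≤ b k * b (l + 1) + b k * (W * b (l + 1)) := by
            gcongr
            · exact (hbpos k).le
            · exact (hle _ _).trans (hb1 _)
            · exact (hle _ _).trans (hb0 _)
            · exact (hbpos k).le
            · exact (hle _ _).trans (hb0 _)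
            · exact (hle _ _).trans (hback _)
        _ = _ := by ring
  set f : ℕ → ℝ := fun n => Real.log ((1 + W) * b n) with hf
  have hWpos : 0 < 1 + W := by linarith
  have hfsub : Subadditive f := by
    intro k l
    rw [hf]
    simp only
    rw [← Real.log_mul (mul_pos hWpos (hbpos k)).ne' (mul_pos hWpos (hbpos l)).ne']
    refine Real.log_le_log (mul_pos hWpos (hbpos _)) ?_
    calc (1 + W) * b (k + l) ≤ (1 + W) * ((1 + W) * b k * b l) := by
          gcongr
          exact max_le (hsub1 k l) (hsub0 k l)
      _ = _ := by ring
  have hflow : ∀ n : ℕ, n * Real.log lam ≤ f n := by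
    intro n
    rw [hf, ← Real.log_pow]
    refine Real.log_le_log (pow_pos hlam0 n) ?_
    refine ((hlow n).trans (hb1 n)).trans ?_
    have := hbpos n
    nlinarith
  have hllam : 0 < Real.log lam := Real.log_pos hlam
  have hbdd : BddBelow (Set.range fun n => f n / n) := by
    refine ⟨0, ?_⟩
    rintro _ ⟨n, rfl⟩
    exact div_nonneg (le_trans (by positivity) (hflow n)) (Nat.cast_nonneg n)
  have hlim := hfsub.tendsto_lim hbdd
  refine ⟨hfsub.lim, ?_, ?_⟩
  · refine lt_of_lt_of_le hllam (ge_of_tendsto hlim ?_)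
    filter_upwards [Filter.eventually_gt_atTop 0] with n hn
    rw [le_div_iff₀ (by exact_mod_cast hn), mul_comm]
    exact hflow n
  · intro ε hε
    set L := hfsub.lim
    constructor
    · have h := hlim.eventually (gt_mem_nhds (show L < L + ε by linarith))
      obtain ⟨N, hN⟩ := Filter.eventually_atTop.1
        (h.and (Filter.eventually_gt_atTop 0))
      refine ⟨N, fun n hn θ => ?_⟩
      obtain ⟨h1, h2⟩ := hN n hn
      rw [div_lt_iff₀ (by exact_mod_cast h2)] at h1
      have h3 : (1 + W) * b n < Real.exp ((L + ε) * n) := by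
        rwa [← Real.log_lt_iff_lt_exp (mul_pos hWpos (hbpos n))]
      have h4 := (hle n θ).trans (hb0 n)
      have := hbpos n
      nlinarith
    · have h := hlim.eventually (lt_mem_nhds (show L - ε / 3 < L by linarith))
      have hc : ∀ᶠ n : ℕ in Filter.atTop, Real.log (1 + W) ≤ ε / 3 * n := by
        have : Filter.Tendsto (fun n : ℕ => ε / 3 * (n : ℝ)) Filter.atTop Filter.atTop :=
          tendsto_natCast_atTop_atTop.const_mul_atTop (by positivity)
        exact this.eventually_ge_atTop _
      obtain ⟨N, hN⟩ := Filter.eventually_atTop.1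
        ((h.and hc).and (Filter.eventually_gt_atTop 0))
      refine ⟨N, fun n hn => ?_⟩
      obtain ⟨⟨h1, h2⟩, h3⟩ := hN n hn
      have hn0 : (0 : ℝ) < n := by exact_mod_cast h3
      rw [lt_div_iff₀ hn0] at h1
      have h4 : f n = Real.log (1 + W) + Real.log (b n) :=
        Real.log_mul hWpos.ne' (hbpos n).ne'
      have h5 : Real.exp ((L - ε) * n) < b n := by
        rw [← Real.lt_log_iff_exp_lt (hbpos n)]
        nlinarith
      rcases lt_max_iff.1 h5 with h6 | h6
      · obtain ⟨θ, hθ⟩ := exists_lt_of_lt_ciSup h6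
        exact ⟨θ, Or.inl hθ.le⟩
      · obtain ⟨θ, hθ⟩ := exists_lt_of_lt_ciSup h6
        exact ⟨θ, Or.inr hθ.le⟩

end Growth

section SineProducts

open Finset

variable {α c : ℝ} {R : ℕ}

lemma norm_one_sub_exp (x : ℝ) :
    ‖1 - Complex.exp (2 * Real.pi * x * Complex.I)‖ = |2 * Real.sin (Real.pi * x)| := by
  rw [norm_sub_rev, show 2 * (Real.pi : ℂ) * x * Complex.I
    = Complex.I * ((2 * Real.pi * x : ℝ) : ℂ) by push_cast; ring,
    Complex.norm_exp_I_mul_ofReal_sub_one, Real.norm_eq_abs,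
    show 2 * Real.pi * x / 2 = Real.pi * x by ring]

lemma norm_exp_two_pi (x : ℝ) : ‖Complex.exp (2 * Real.pi * x * Complex.I)‖ = 1 := by
  rw [show 2 * (Real.pi : ℂ) * x = ((2 * Real.pi * x : ℝ) : ℂ) by push_cast; ring]
  exact Complex.norm_exp_ofReal_mul_I _

lemma norm_geom_sum_exp_le (hc : 0 < c)
    (hdio : ∀ n : ℕ, 0 < n → c / (n : ℝ) ^ R ≤ |Real.sin (Real.pi * (n * α))|)
    {m : ℕ} (hm : 0 < m) (n : ℕ) (x : ℝ) :
    ‖∑ j ∈ range n, Complex.exp (2 * Real.pi * ((x + j * α : ℝ) : ℂ) * Complex.I) ^ m‖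
      ≤ (m : ℝ) ^ R / c := by
  have hm' : (0 : ℝ) < m := by exact_mod_cast hm
  set w := Complex.exp (2 * Real.pi * ((m * α : ℝ) : ℂ) * Complex.I) with hw
  set v := Complex.exp (2 * Real.pi * ((m * x : ℝ) : ℂ) * Complex.I) with hv
  have h1 : ∀ j : ℕ, Complex.exp (2 * Real.pi * ((x + j * α : ℝ) : ℂ) * Complex.I) ^ m
      = v * w ^ j := by
    intro j
    rw [hv, hw, ← Complex.exp_nat_mul, ← Complex.exp_nat_mul, ← Complex.exp_add]
    congr 1
    push_cast
    ring
  have hs := hdio m hm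
  have hspos : 0 < |Real.sin (Real.pi * (m * α))| := lt_of_lt_of_le (by positivity) hs
  have hden : ‖w - 1‖ = 2 * |Real.sin (Real.pi * (m * α))| := by
    rw [norm_sub_rev, hw, norm_one_sub_exp, abs_mul, abs_two]
  have hw1 : w ≠ 1 := by
    intro h
    rw [h, sub_self, norm_zero] at hden
    linarith
  simp_rw [h1]
  rw [← mul_sum, norm_mul, hv, norm_exp_two_pi, one_mul, geom_sum_eq hw1, norm_div, hden]
  have h2 : ‖w ^ n - 1‖ ≤ 2 := by
    refine (norm_sub_le _ _).trans ?_
    rw [norm_pow, hw, norm_exp_two_pi, one_pow, norm_one]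
    norm_num
  rw [div_le_iff₀ (by linarith)]
  have h3 : 1 ≤ (m : ℝ) ^ R / c * |Real.sin (Real.pi * (m * α))| := by
    calc 1 = (m : ℝ) ^ R / c * (c / (m : ℝ) ^ R) := by field_simp
      _ ≤ _ := by gcongr
  linarith

lemma abs_sum_log_le (hc : 0 < c)
    (hdio : ∀ n : ℕ, 0 < n → c / (n : ℝ) ^ R ≤ |Real.sin (Real.pi * (n * α))|)
    {ρ : ℝ} (hρ0 : 0 < ρ) (hρ1 : ρ < 1) (n : ℕ) (x : ℝ) :
    |∑ j ∈ range n,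
        Real.log ‖1 - ρ * Complex.exp (2 * Real.pi * ((x + j * α : ℝ) : ℂ) * Complex.I)‖|
      ≤ (R.factorial : ℝ) / (c * (1 - ρ) ^ (R + 1)) := by
  set z : ℕ → ℂ := fun j => Complex.exp (2 * Real.pi * ((x + j * α : ℝ) : ℂ) * Complex.I) with hz
  have hzn : ∀ j, ‖z j‖ = 1 := fun j => norm_exp_two_pi _
  have hρz : ∀ j, ‖(ρ : ℂ) * z j‖ = ρ := fun j => by
    rw [norm_mul, hzn, mul_one, Complex.norm_real, Real.norm_eq_abs, abs_of_pos hρ0]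
  have hsum := hasSum_sum (s := range n) fun j _ =>
    Complex.hasSum_taylorSeries_neg_log (z := (ρ : ℂ) * z j) (by rw [hρz]; exact hρ1)
  have hgeo := hasSum_choose_mul_geometric_of_norm_lt_one R (r := ρ)
    (by rwa [Real.norm_eq_abs, abs_of_pos hρ0])
  have hbound := hgeo.mul_left ((R.factorial : ℝ) / c)
  have key := hsum.norm_le_of_bounded hbound (fun m => ?_)
  · have h2 : ∑ j ∈ range n, Real.log ‖1 - (ρ : ℂ) * z j‖
        = -(∑ j ∈ range n, -Complex.log (1 - (ρ : ℂ) * z j)).re := by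
      rw [Complex.re_sum, ← sum_neg_distrib]
      refine sum_congr rfl fun j _ => ?_
      rw [Complex.neg_re, Complex.log_re, neg_neg]
    rw [h2, abs_neg]
    refine (Complex.abs_re_le_norm _).trans (key.trans (le_of_eq ?_))
    rw [div_mul_div_comm, mul_one]
  · rcases Nat.eq_zero_or_pos m with rfl | hm
    · simp only [pow_zero, Nat.cast_zero, div_zero, sum_const_zero, norm_zero]
      positivity
    · have h1 : ∑ j ∈ range n, ((ρ : ℂ) * z j) ^ m / m
          = (ρ : ℂ) ^ m / m * ∑ j ∈ range n, z j ^ m := by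
        rw [mul_sum]
        refine sum_congr rfl fun j _ => ?_
        rw [mul_pow]; ring
      have hm1 : (1 : ℝ) ≤ m := by exact_mod_cast hm
      rw [h1, norm_mul, norm_div, norm_pow, Complex.norm_real, Real.norm_eq_abs,
        abs_of_pos hρ0, Complex.norm_natCast]
      have h3 : (m : ℝ) ^ R ≤ (R.factorial : ℝ) * ((m + R).choose R : ℝ) := by
        have h4 := Nat.pow_succ_le_ascFactorial (m + 1) R
        rw [Nat.ascFactorial_eq_factorial_mul_choose] at h4
        have h5 : m ^ R ≤ (m + 1) ^ R := Nat.pow_le_pow_left (by omega) R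
        exact_mod_cast h5.trans h4
      calc ρ ^ m / m * ‖∑ j ∈ range n, z j ^ m‖
          ≤ ρ ^ m / 1 * ((m : ℝ) ^ R / c) := by
            gcongr
            exact norm_geom_sum_exp_le hc hdio hm n x
        _ ≤ ρ ^ m / 1 * ((R.factorial : ℝ) * ((m + R).choose R : ℝ) / c) := by gcongr
        _ = _ := by ring

lemma sqrt_mul_norm_one_sub_le {ρ : ℝ} (hρ0 : 0 < ρ) {z : ℂ} (hz : ‖z‖ = 1) :
    √ρ * ‖1 - z‖ ≤ ‖1 - ρ * z‖ := by
  refine abs_le_of_sq_le_sq' ?_ (norm_nonneg _) |>.2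
  rw [mul_pow, Real.sq_sqrt hρ0.le, ← Complex.normSq_eq_norm_sq, ← Complex.normSq_eq_norm_sq]
  have h : z.re * z.re + z.im * z.im = 1 := by
    rw [← Complex.normSq_apply, Complex.normSq_eq_norm_sq, hz, one_pow]
  simp only [Complex.normSq_apply, Complex.sub_re, Complex.sub_im, Complex.one_re, Complex.one_im,
    Complex.mul_re, Complex.mul_im, Complex.ofReal_re, Complex.ofReal_im]
  nlinarith [sq_nonneg (1 - ρ)]

lemma norm_one_sub_mul_ge {ρ : ℝ} (hρ0 : 0 < ρ) {z : ℂ} (hz : ‖z‖ = 1) :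
    1 - ρ ≤ ‖1 - ρ * z‖ := by
  have := norm_sub_norm_le (1 : ℂ) (ρ * z)
  rwa [norm_mul, hz, mul_one, Complex.norm_real, Real.norm_eq_abs, abs_of_pos hρ0,
    norm_one] at this

lemma norm_one_sub_mul_le {ρ : ℝ} (hρ1 : ρ < 1) {z : ℂ} (hz : ‖z‖ = 1) :
    ‖1 - ρ * z‖ ≤ ‖1 - z‖ + (1 - ρ) := by
  have := norm_add_le (1 - z) ((1 - ρ : ℝ) * z)
  rw [norm_mul, hz, mul_one, Complex.norm_real, Real.norm_eq_abs,
    abs_of_pos (by linarith : (0 : ℝ) < 1 - ρ)] at this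
  rwa [show 1 - z + ((1 - ρ : ℝ) : ℂ) * z = 1 - ρ * z by push_cast; ring] at this

lemma prod_sin_range_le (hc : 0 < c)
    (hdio : ∀ n : ℕ, 0 < n → c / (n : ℝ) ^ R ≤ |Real.sin (Real.pi * (n * α))|)
    {ε : ℝ} (hε : 0 < ε) :
    ∃ N : ℕ, ∀ n ≥ N, ∀ (x : ℝ) (j₀ : ℕ),
      ∏ j ∈ (range n).erase j₀, |2 * Real.sin (Real.pi * (x + j * α))| ≤ Real.exp (ε * n) := by
  set ρ := Real.exp (-ε) with hρ
  have hρ0 : 0 < ρ := Real.exp_pos _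
  have hρ1 : ρ < 1 := by rw [hρ, Real.exp_lt_one_iff]; linarith
  set A := (R.factorial : ℝ) / (c * (1 - ρ) ^ (R + 1)) with hA
  have hev : ∀ᶠ n : ℕ in Filter.atTop, A - Real.log (1 - ρ) ≤ ε / 2 * n := by
    have : Filter.Tendsto (fun n : ℕ => ε / 2 * (n : ℝ)) Filter.atTop Filter.atTop :=
      tendsto_natCast_atTop_atTop.const_mul_atTop (by positivity)
    exact this.eventually_ge_atTop _
  obtain ⟨N, hN⟩ := Filter.eventually_atTop.1 hev
  refine ⟨N, fun n hn x j₀ => ?_⟩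
  have hN := hN n hn
  set z : ℕ → ℂ := fun j => Complex.exp (2 * Real.pi * ((x + j * α : ℝ) : ℂ) * Complex.I) with hz
  have hzn : ∀ j, ‖z j‖ = 1 := fun j => norm_exp_two_pi _
  have hge : ∀ j : ℕ, 1 - ρ ≤ ‖1 - ρ * z j‖ := fun j => norm_one_sub_mul_ge hρ0 (hzn j)
  have hpos : ∀ j : ℕ, 0 < ‖1 - ρ * z j‖ := fun j => lt_of_lt_of_le (by linarith) (hge j)
  have hterm : ∀ j : ℕ, |2 * Real.sin (Real.pi * (x + j * α))|
      ≤ Real.exp (ε / 2) * ‖1 - ρ * z j‖ := by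
    intro j
    rw [← norm_one_sub_exp]
    have h1 := sqrt_mul_norm_one_sub_le hρ0 (hzn j)
    have h2 : √ρ = Real.exp (-(ε / 2)) := by
      rw [hρ, show -ε = -(ε / 2) + -(ε / 2) by ring, Real.exp_add,
        Real.sqrt_mul_self (Real.exp_pos _).le]
    rw [h2] at h1
    calc ‖1 - z j‖ = Real.exp (ε / 2) * (Real.exp (-(ε / 2)) * ‖1 - z j‖) := by
          rw [← mul_assoc, ← Real.exp_add]; simp
      _ ≤ _ := by gcongr
  have hall : ∏ j ∈ range n, ‖1 - ρ * z j‖ ≤ Real.exp A := by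
    rw [← Real.log_le_iff_le_exp (prod_pos fun j _ => hpos j),
      Real.log_prod (fun j _ => (hpos j).ne')]
    exact (le_abs_self _).trans (abs_sum_log_le hc hdio hρ0 hρ1 n x)
  have herase : (1 - ρ) * ∏ j ∈ (range n).erase j₀, ‖1 - ρ * z j‖
      ≤ ∏ j ∈ range n, ‖1 - ρ * z j‖ := by
    have hp : 0 ≤ ∏ j ∈ (range n).erase j₀, ‖1 - ρ * z j‖ := prod_nonneg fun j _ => (hpos j).le
    by_cases hj : j₀ ∈ range n
    · rw [← mul_prod_erase _ _ hj]
      gcongr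
      exact hge j₀
    · rw [erase_eq_of_notMem hj] at hp ⊢
      nlinarith
  have h1ρ : 0 < 1 - ρ := by linarith
  calc ∏ j ∈ (range n).erase j₀, |2 * Real.sin (Real.pi * (x + j * α))|
      ≤ ∏ j ∈ (range n).erase j₀, Real.exp (ε / 2) * ‖1 - ρ * z j‖ :=
        prod_le_prod (fun _ _ => abs_nonneg _) fun j _ => hterm j
    _ = Real.exp (ε / 2) ^ ((range n).erase j₀).card
        * ∏ j ∈ (range n).erase j₀, ‖1 - ρ * z j‖ := by
        rw [prod_mul_distrib, prod_const]
    _ ≤ Real.exp (ε / 2) ^ n * (Real.exp A / (1 - ρ)) := by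
        gcongr
        · exact Real.one_le_exp (by positivity)
        · exact (card_erase_le).trans (card_range n).le
        · rw [le_div_iff₀ h1ρ, mul_comm]
          exact herase.trans hall
    _ = Real.exp (n * (ε / 2) + (A - Real.log (1 - ρ))) := by
        rw [Real.exp_add, Real.exp_sub, Real.exp_log h1ρ, ← Real.exp_nat_mul]
    _ ≤ Real.exp (ε * n) := by
        apply Real.exp_le_exp.2
        linarith

lemma abs_sin_sub_le (x y : ℝ) : |Real.sin (x - y)| ≤ |Real.sin x| + |Real.sin y| := by
  rw [Real.sin_sub]
  refine (abs_sub _ _).trans ?_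
  rw [abs_mul, abs_mul]
  have h1 := Real.abs_cos_le_one x
  have h2 := Real.abs_cos_le_one y
  nlinarith [abs_nonneg (Real.sin x), abs_nonneg (Real.sin y)]

lemma separation
    (hdio : ∀ n : ℕ, 0 < n → c / (n : ℝ) ^ R ≤ |Real.sin (Real.pi * (n * α))|)
    (x : ℝ) {i j : ℕ} (hij : i < j) :
    2 * (c / ((j - i : ℕ) : ℝ) ^ R) ≤ |2 * Real.sin (Real.pi * (x + i * α))|
      + |2 * Real.sin (Real.pi * (x + j * α))| := by
  have h1 := hdio (j - i) (by omega)
  have h2 := abs_sin_sub_le (Real.pi * (x + j * α)) (Real.pi * (x + i * α))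
  rw [show Real.pi * (x + j * α) - Real.pi * (x + i * α) = Real.pi * (((j - i : ℕ) : ℝ) * α) by
    rw [Nat.cast_sub hij.le]; ring] at h2
  rw [abs_mul, abs_mul, abs_two]
  linarith

lemma card_close_le (hc : 0 < c)
    (hdio : ∀ n : ℕ, 0 < n → c / (n : ℝ) ^ R ≤ |Real.sin (Real.pi * (n * α))|)
    (x : ℝ) {n K : ℕ} (hK : 0 < K) {B : Finset ℕ} (hB : B ⊆ range n)
    (hclose : ∀ j ∈ B, |2 * Real.sin (Real.pi * (x + j * α))| < c / (K : ℝ) ^ R) :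
    B.card ≤ n / K + 1 := by
  rw [← card_range (n / K + 1)]
  have key : ∀ i ∈ B, ∀ j ∈ B, i < j → i / K ≠ j / K := by
    intro i hi j hj hij h
    have h1 := separation hdio x hij
    have h2 := hclose i hi
    have h3 := hclose j hj
    have h4 : j - i ≤ K := by
      have a1 := Nat.div_add_mod i K
      have a2 := Nat.div_add_mod j K
      have a3 := Nat.mod_lt j hK
      rw [h] at a1
      omega
    have h5 : c / (K : ℝ) ^ R ≤ c / ((j - i : ℕ) : ℝ) ^ R := by
      have : (0 : ℝ) < ((j - i : ℕ) : ℝ) := by exact_mod_cast (by omega : 0 < j - i)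
      have h4' : ((j - i : ℕ) : ℝ) ≤ K := by exact_mod_cast h4
      gcongr
    linarith
  refine card_le_card_of_injOn (fun j => j / K) ?_ ?_
  · intro j hj
    have := mem_range.1 (hB hj)
    simp only [coe_range, Set.mem_Iio]
    have := Nat.div_le_div_right (c := K) this.le
    omega
  · intro i hi j hj h
    rcases lt_trichotomy i j with h1 | h1 | h1
    · exact absurd h (key i hi j hj h1)
    · exact h1
    · exact absurd h.symm (key j hj i hi h1)

lemma sum_log_sin_ge (hc : 0 < c)
    (hdio : ∀ n : ℕ, 0 < n → c / (n : ℝ) ^ R ≤ |Real.sin (Real.pi * (n * α))|)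
    {n K : ℕ} (hn : 0 < n) (hK : 0 < K) {h : ℝ} (hh0 : 0 < h) (hh1 : h < 1) (x : ℝ) (j₀ : ℕ)
    {δ : ℝ} (hδ0 : 0 < δ) (hδ1 : δ ≤ 1)
    (hδ : ∀ j ∈ (range n).erase j₀, δ ≤ |2 * Real.sin (Real.pi * (x + j * α))|) :
    Real.log δ - ((R.factorial : ℝ) / (c * h ^ (R + 1)) + 2 * Real.log 2 + n * (h * K ^ R / c)
        + ((n / K : ℕ) + 1) * Real.log (1 + n ^ R / c))
      ≤ ∑ j ∈ (range n).erase j₀, Real.log |2 * Real.sin (Real.pi * (x + j * α))| := by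
  classical
  set d : ℕ → ℝ := fun j => |2 * Real.sin (Real.pi * (x + j * α))| with hd
  set J := (range n).erase j₀ with hJ
  have hJn : J ⊆ range n := erase_subset _ _
  set ρ := 1 - h with hρ
  have hρ0 : 0 < ρ := by linarith
  have hρ1 : ρ < 1 := by linarith
  set z : ℕ → ℂ := fun j => Complex.exp (2 * Real.pi * ((x + j * α : ℝ) : ℂ) * Complex.I) with hz
  have hzn : ∀ j, ‖z j‖ = 1 := fun j => norm_exp_two_pi _
  have hdz : ∀ j, d j = ‖1 - z j‖ := fun j => (norm_one_sub_exp _).symm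
  have hpos : ∀ j : ℕ, 0 < ‖1 - ρ * z j‖ := fun j =>
    lt_of_lt_of_le (by linarith) (norm_one_sub_mul_ge hρ0 (hzn j))
  have hle2 : ∀ j, ‖1 - ρ * z j‖ ≤ 2 := by
    intro j
    refine (norm_sub_le _ _).trans ?_
    rw [norm_mul, hzn, mul_one, Complex.norm_real, Real.norm_eq_abs, abs_of_pos hρ0, norm_one]
    linarith
  have hdpos : ∀ j ∈ J, 0 < d j := fun j hj => hδ0.trans_le (hδ j hj)
  have hterm : ∀ j ∈ J, Real.log ‖1 - ρ * z j‖ - Real.log (1 + h / d j) ≤ Real.log (d j) := by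
    intro j hj
    have hdj := hdpos j hj
    have h1 : 0 < 1 + h / d j := by positivity
    rw [sub_le_iff_le_add, ← Real.log_mul hdj.ne' h1.ne']
    refine Real.log_le_log (hpos j) ?_
    have := norm_one_sub_mul_le hρ1 (hzn j)
    rw [← hdz] at this
    calc _ ≤ d j + (1 - ρ) := this
      _ = d j * (1 + h / d j) := by rw [hρ]; field_simp; ring
  have hmain : -((R.factorial : ℝ) / (c * h ^ (R + 1))) - Real.log 2
      ≤ ∑ j ∈ J, Real.log ‖1 - ρ * z j‖ := by
    have h1 := (abs_le.1 (abs_sum_log_le hc hdio hρ0 hρ1 n x)).1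
    rw [show 1 - ρ = h by rw [hρ]; ring] at h1
    have hl2 : 0 ≤ Real.log 2 := Real.log_nonneg (by norm_num)
    by_cases hj : j₀ ∈ range n
    · rw [← add_sum_erase _ _ hj] at h1
      have h2 := Real.log_le_log (hpos j₀) (hle2 j₀)
      linarith
    · rw [hJ, erase_eq_of_notMem hj]
      linarith
  set B := J.filter (fun j => d j < c / (K : ℝ) ^ R) with hB
  have hBJ : B ⊆ J := filter_subset _ _
  have hK' : (0 : ℝ) < K := by exact_mod_cast hK
  have hn' : (0 : ℝ) < n := by exact_mod_cast hn
  have hcard : B.card ≤ n / K + 1 :=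
    card_close_le hc hdio x hK (hBJ.trans hJn) fun j hj => (mem_filter.1 hj).2
  have hlogn : 0 ≤ Real.log (1 + n ^ R / c) :=
    Real.log_nonneg (by have : 0 ≤ (n : ℝ) ^ R / c := by positivity
                        linarith)
  have hfar : ∑ j ∈ J.filter (fun j => ¬ d j < c / (K : ℝ) ^ R), Real.log (1 + h / d j)
      ≤ n * (h * K ^ R / c) := by
    have h1 : ∀ j ∈ J.filter (fun j => ¬ d j < c / (K : ℝ) ^ R),
        Real.log (1 + h / d j) ≤ h * K ^ R / c := by
      intro j hj
      obtain ⟨hjJ, hj2⟩ := mem_filter.1 hj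
      have hdj := hdpos j hjJ
      have h2 : Real.log (1 + h / d j) ≤ 1 + h / d j - 1 :=
        Real.log_le_sub_one_of_pos (by positivity)
      refine h2.trans ?_
      rw [add_sub_cancel_left]
      calc h / d j ≤ h / (c / (K : ℝ) ^ R) := by
            gcongr
            exact not_lt.1 hj2
        _ = _ := by field_simp
    refine (sum_le_card_nsmul _ _ _ h1).trans ?_
    rw [nsmul_eq_mul]
    gcongr
    exact_mod_cast (card_le_card ((filter_subset _ _).trans hJn)).trans (card_range n).le
  have hnear : ∑ j ∈ B, Real.log (1 + h / d j)
      ≤ ((n / K : ℕ) + 1) * Real.log (1 + n ^ R / c) + (Real.log 2 - Real.log δ) := by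
    have hδl : 0 ≤ Real.log 2 - Real.log δ := by
      have := Real.log_nonpos hδ0.le hδ1
      have : 0 ≤ Real.log 2 := Real.log_nonneg (by norm_num)
      linarith
    rcases B.eq_empty_or_nonempty with hBe | hBne
    · rw [hBe, sum_empty]
      positivity
    · obtain ⟨j₁, hj₁, hmin⟩ := exists_min_image B d hBne
      rw [← sum_erase_add _ _ hj₁]
      refine add_le_add ?_ ?_
      · have h1 : ∀ j ∈ B.erase j₁, Real.log (1 + h / d j) ≤ Real.log (1 + n ^ R / c) := by
          intro j hj
          obtain ⟨hne, hjB⟩ := mem_erase.1 hj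
          have hdj := hdpos j (hBJ hjB)
          have hjn := mem_range.1 (hJn (hBJ hjB))
          have hjn1 := mem_range.1 (hJn (hBJ hj₁))
          have hm := hmin j hjB
          have hdc : c / (n : ℝ) ^ R ≤ d j := by
            rcases lt_or_gt_of_ne hne with hlt | hlt
            · have h3 := separation hdio x hlt
              have h5 : c / (n : ℝ) ^ R ≤ c / ((j₁ - j : ℕ) : ℝ) ^ R := by
                have : (0 : ℝ) < ((j₁ - j : ℕ) : ℝ) := by exact_mod_cast (by omega : 0 < j₁ - j)
                have h4' : ((j₁ - j : ℕ) : ℝ) ≤ n := by exact_mod_cast (by omega : j₁ - j ≤ n)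
                gcongr
              change _ ≤ d j + d j₁ at h3
              linarith
            · have h3 := separation hdio x hlt
              have h5 : c / (n : ℝ) ^ R ≤ c / ((j - j₁ : ℕ) : ℝ) ^ R := by
                have : (0 : ℝ) < ((j - j₁ : ℕ) : ℝ) := by exact_mod_cast (by omega : 0 < j - j₁)
                have h4' : ((j - j₁ : ℕ) : ℝ) ≤ n := by exact_mod_cast (by omega : j - j₁ ≤ n)
                gcongr
              change _ ≤ d j₁ + d j at h3
              linarith
          refine Real.log_le_log (by positivity) ?_
          refine add_le_add_right ?_ 1
          calc h / d j ≤ 1 / (c / (n : ℝ) ^ R) := by gcongr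
            _ = _ := by field_simp
        refine (sum_le_card_nsmul _ _ _ h1).trans ?_
        rw [nsmul_eq_mul]
        gcongr
        exact_mod_cast (card_erase_le).trans hcard
      · have hd1 := hδ j₁ (hBJ hj₁)
        rw [← Real.log_div two_ne_zero hδ0.ne']
        have hdj := hdpos j₁ (hBJ hj₁)
        refine Real.log_le_log (by positivity) ?_
        calc 1 + h / d j₁ ≤ 1 / δ + 1 / δ := by
              gcongr
              rwa [le_div_iff₀ hδ0, one_mul]
          _ = 2 / δ := by ring
  have hsplit : ∑ j ∈ J, Real.log (1 + h / d j)
      = ∑ j ∈ B, Real.log (1 + h / d j)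
        + ∑ j ∈ J.filter (fun j => ¬ d j < c / (K : ℝ) ^ R), Real.log (1 + h / d j) :=
    (sum_filter_add_sum_filter_not _ _ _).symm
  have hfin := sum_le_sum hterm
  rw [sum_sub_distrib] at hfin
  linarith

lemma exists_error_le (hc : 0 < c) (hR : 0 < R) {ε : ℝ} (hε : 0 < ε) :
    ∃ N : ℕ, ∀ n ≥ N, 0 < n ∧ ∃ (K : ℕ) (h : ℝ), 0 < K ∧ 0 < h ∧ h < 1 ∧
      (R.factorial : ℝ) / (c * h ^ (R + 1)) + 2 * Real.log 2 + n * (h * K ^ R / c)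
        + ((n / K : ℕ) + 1) * Real.log (1 + n ^ R / c) ≤ ε * n := by
  set D := 2 * R * (R + 1) + 1 with hD
  set C₁ : ℝ := (R.factorial : ℝ) / c * 2 ^ (R + 1) with hC₁
  set a : ℝ := C₁ + 2 * Real.log 2 + 1 / c + 2 * Real.log (1 + 1 / c) with ha
  set b : ℝ := 2 * (R * (D * Real.log 2)) with hb
  have hC₁0 : 0 ≤ C₁ := by positivity
  have hlim : Filter.Tendsto (fun t : ℕ => a * ((1 / 2 : ℝ) ^ t)
      + b * (((t : ℝ) * (1 / 2 : ℝ) ^ t) + (1 / 2 : ℝ) ^ t)) Filter.atTop (nhds 0) := by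
    have h1 : Filter.Tendsto (fun t : ℕ => (1 / 2 : ℝ) ^ t) Filter.atTop (nhds 0) :=
      tendsto_pow_atTop_nhds_zero_of_lt_one (by norm_num) (by norm_num)
    have h2 : Filter.Tendsto (fun t : ℕ => (t : ℝ) * (1 / 2 : ℝ) ^ t) Filter.atTop (nhds 0) :=
      tendsto_self_mul_const_pow_of_lt_one (by norm_num) (by norm_num)
    have := (h1.const_mul a).add ((h2.add h1).const_mul b)
    simpa using this
  obtain ⟨T, hT⟩ := Filter.eventually_atTop.1 (hlim.eventually (gt_mem_nhds hε))
  refine ⟨(2 ^ D) ^ T, fun n hn => ?_⟩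
  have hD1 : 1 < 2 ^ D := Nat.one_lt_two_pow (by omega)
  have hn0 : 0 < n := lt_of_lt_of_le (by positivity) hn
  obtain ⟨t, ht1, ht2⟩ := exists_nat_pow_near (x := n) (y := 2 ^ D) (by omega) hD1
  have htT : T ≤ t := by
    by_contra hlt
    have : (2 ^ D) ^ (t + 1) ≤ (2 ^ D) ^ T := Nat.pow_le_pow_right (by omega) (by omega)
    omega
  have hεt := (hT t htT).le
  refine ⟨hn0, 2 ^ t, (1 / 2 : ℝ) ^ (2 * R * t + 1), by positivity, by positivity,
    pow_lt_one₀ (by norm_num) (by norm_num) (by omega), ?_⟩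
  have hn' : (1 : ℝ) ≤ n := by exact_mod_cast hn0
  have ht1' : ((2 : ℝ) ^ D) ^ t ≤ n := by exact_mod_cast ht1
  have ht2' : (n : ℝ) ≤ ((2 : ℝ) ^ D) ^ (t + 1) := by exact_mod_cast ht2.le
  set s : ℝ := (1 / 2 : ℝ) ^ t with hs
  have hs0 : 0 < s := by positivity
  have hs2 : s * 2 ^ t = 1 := by rw [hs, ← mul_pow]; norm_num
  have hsn : 1 ≤ n * s := by
    have h1 : (2 : ℝ) ^ t ≤ n := by
      refine le_trans ?_ ht1'
      rw [← pow_mul]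
      exact pow_le_pow_right₀ (by norm_num) (Nat.le_mul_of_pos_left t (by omega))
    calc (1 : ℝ) = 2 ^ t * s := by rw [mul_comm]; exact hs2.symm
      _ ≤ n * s := by gcongr
  have hA : (R.factorial : ℝ) / (c * ((1 / 2 : ℝ) ^ (2 * R * t + 1)) ^ (R + 1)) ≤ C₁ * (n * s) := by
    have e1 : (R.factorial : ℝ) / (c * ((1 / 2 : ℝ) ^ (2 * R * t + 1)) ^ (R + 1))
        = C₁ * ((2 : ℝ) ^ (2 * R * (R + 1) * t)) := by
      rw [hC₁, one_div, inv_pow, inv_pow, ← pow_mul]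
      rw [show (2 * R * t + 1) * (R + 1) = (R + 1) + 2 * R * (R + 1) * t by ring, pow_add]
      field_simp
    rw [e1]
    gcongr
    have e2 : ((2 : ℝ) ^ D) ^ t = 2 ^ (2 * R * (R + 1) * t) * 2 ^ t := by
      rw [← pow_mul, ← pow_add, hD]; congr 1; ring
    calc (2 : ℝ) ^ (2 * R * (R + 1) * t) = 2 ^ (2 * R * (R + 1) * t) * 2 ^ t * s := by
          linear_combination (-(2 : ℝ) ^ (2 * R * (R + 1) * t)) * hs2
      _ ≤ n * s := by rw [← e2]; gcongr
  have hB : n * ((1 / 2 : ℝ) ^ (2 * R * t + 1) * ((2 ^ t : ℕ) : ℝ) ^ R / c) ≤ 1 / c * (n * s) := by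
    have e1 : (1 / 2 : ℝ) ^ (2 * R * t + 1) * ((2 ^ t : ℕ) : ℝ) ^ R ≤ s := by
      push_cast
      have e2 : (1 / 2 : ℝ) ^ (2 * R * t + 1) = (1 / 2) ^ (R * t + 1) * (1 / 2) ^ (t * R) := by
        rw [← pow_add]; congr 1; ring
      rw [e2, mul_assoc, ← pow_mul, ← mul_pow]
      norm_num only [one_div, inv_mul_cancel₀, one_pow, mul_one]
      rw [hs]
      refine pow_le_pow_of_le_one (by norm_num) (by norm_num) ?_
      have := Nat.le_mul_of_pos_left t hR
      omega
    calc _ ≤ n * (s / c) := by gcongr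
      _ = _ := by ring
  have hl : Real.log (1 + n ^ R / c) ≤ Real.log (1 + 1 / c) + R * ((t + 1) * (D * Real.log 2)) := by
    have e1 : Real.log (1 + n ^ R / c) ≤ Real.log ((1 + 1 / c) * n ^ R) := by
      refine Real.log_le_log (by positivity) ?_
      have : (1 : ℝ) ≤ (n : ℝ) ^ R := one_le_pow₀ hn'
      calc 1 + (n : ℝ) ^ R / c ≤ (n : ℝ) ^ R + (n : ℝ) ^ R / c := by gcongr
        _ = _ := by ring
    refine e1.trans ?_
    rw [Real.log_mul (by positivity) (by positivity), Real.log_pow]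
    gcongr
    have := Real.log_le_log (by positivity) ht2'
    rw [Real.log_pow, Real.log_pow] at this
    push_cast at this
    exact this
  have hq : (((n / 2 ^ t : ℕ) : ℝ) + 1) ≤ 2 * (n * s) := by
    have e1 : ((n / 2 ^ t : ℕ) : ℝ) ≤ n * s := by
      refine Nat.cast_div_le.trans (le_of_eq ?_)
      rw [hs]; push_cast; rw [one_div, inv_pow, div_eq_mul_inv]
    linarith
  have hl0 : 0 ≤ Real.log (1 + 1 / c) := Real.log_nonneg (by
    have : 0 < 1 / c := by positivity
    linarith)
  have hl2 : 0 ≤ Real.log 2 := Real.log_nonneg (by norm_num)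
  have hE : (((n / 2 ^ t : ℕ) : ℝ) + 1) * Real.log (1 + n ^ R / c)
      ≤ 2 * (n * s) * (Real.log (1 + 1 / c) + R * ((t + 1) * (D * Real.log 2))) := by
    refine (mul_le_mul_of_nonneg_left hl (by positivity)).trans ?_
    gcongr
  have h2 : 2 * Real.log 2 ≤ 2 * Real.log 2 * (n * s) := by nlinarith
  calc _ ≤ C₁ * (n * s) + 2 * Real.log 2 * (n * s) + 1 / c * (n * s)
        + 2 * (n * s) * (Real.log (1 + 1 / c) + R * ((t + 1) * (D * Real.log 2))) :=
        add_le_add (add_le_add (add_le_add hA h2) hB) hE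
    _ = n * (a * s + b * (t * s + s)) := by rw [ha, hb]; ring
    _ ≤ n * ε := by gcongr
    _ = ε * n := mul_comm _ _

lemma le_prod_sin_range (hc : 0 < c) (hR : 0 < R)
    (hdio : ∀ n : ℕ, 0 < n → c / (n : ℝ) ^ R ≤ |Real.sin (Real.pi * (n * α))|)
    {ε : ℝ} (hε : 0 < ε) :
    ∃ N : ℕ, ∀ n ≥ N, ∀ (x : ℝ) (j₀ : ℕ) (δ : ℝ), 0 < δ → δ ≤ 1 →
      (∀ j ∈ (range n).erase j₀, δ ≤ |2 * Real.sin (Real.pi * (x + j * α))|) →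
      δ * Real.exp (-(ε * n))
        ≤ ∏ j ∈ (range n).erase j₀, |2 * Real.sin (Real.pi * (x + j * α))| := by
  obtain ⟨N, hN⟩ := exists_error_le hc hR hε
  refine ⟨N, fun n hn x j₀ δ hδ0 hδ1 hδ => ?_⟩
  obtain ⟨hn0, K, h, hK, hh0, hh1, herr⟩ := hN n hn
  have h1 := sum_log_sin_ge hc hdio hn0 hK hh0 hh1 x j₀ hδ0 hδ1 hδ
  have hpos : ∀ j ∈ (range n).erase j₀, 0 < |2 * Real.sin (Real.pi * (x + j * α))| :=
    fun j hj => hδ0.trans_le (hδ j hj)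
  rw [← Real.log_prod fun j hj => (hpos j hj).ne'] at h1
  rw [← Real.log_le_log_iff (by positivity) (prod_pos hpos), Real.log_mul hδ0.ne'
    (Real.exp_pos _).ne', Real.log_exp]
  linarith

lemma exists_Ico_erase_eq (s : ℤ) (n : ℕ) (a : ℤ) :
    ∃ j₀ : ℕ, (Ico s (s + n)).erase a = ((range n).erase j₀).image fun j : ℕ => s + (j : ℤ) := by
  refine ⟨if s ≤ a then (a - s).toNat else n, ?_⟩
  ext b
  simp only [mem_erase, mem_Ico, mem_image, mem_range]
  constructor
  · rintro ⟨h1, h2, h3⟩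
    refine ⟨(b - s).toNat, ⟨?_, by omega⟩, by omega⟩
    split_ifs <;> omega
  · rintro ⟨j, ⟨h1, h2⟩, rfl⟩
    split_ifs at h1 <;> omega

lemma prod_shift (f : ℤ → ℝ) (s : ℤ) (J : Finset ℕ) :
    ∏ b ∈ J.image (fun j : ℕ => s + (j : ℤ)), f b = ∏ j ∈ J, f (s + j) :=
  prod_image fun i _ j _ h => by simpa using h

/-- Upper bound for products of sines along an orbit segment, with at most one factor omitted. -/
lemma prod_sin_Ico_le (hc : 0 < c)
    (hdio : ∀ n : ℕ, 0 < n → c / (n : ℝ) ^ R ≤ |Real.sin (Real.pi * (n * α))|)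
    {ε : ℝ} (hε : 0 < ε) :
    ∃ N : ℕ, ∀ n ≥ N, ∀ (x : ℝ) (s a : ℤ),
      ∏ b ∈ (Ico s (s + n)).erase a, |2 * Real.sin (Real.pi * (x + b * α))|
        ≤ Real.exp (ε * n) := by
  obtain ⟨N, hN⟩ := prod_sin_range_le hc hdio hε
  refine ⟨N, fun n hn x s a => ?_⟩
  obtain ⟨j₀, hj₀⟩ := exists_Ico_erase_eq s n a
  rw [hj₀, prod_shift]
  convert hN n hn (x + s * α) j₀ using 6
  push_cast; ring

/-- Lower bound for products of sines along an orbit segment, with at most one factor omitted,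
in terms of a lower bound for the smallest factor. -/
lemma le_prod_sin_Ico (hc : 0 < c) (hR : 0 < R)
    (hdio : ∀ n : ℕ, 0 < n → c / (n : ℝ) ^ R ≤ |Real.sin (Real.pi * (n * α))|)
    {ε : ℝ} (hε : 0 < ε) :
    ∃ N : ℕ, ∀ n ≥ N, ∀ (x : ℝ) (s a : ℤ) (δ : ℝ), 0 < δ → δ ≤ 1 →
      (∀ b ∈ (Ico s (s + n)).erase a, δ ≤ |2 * Real.sin (Real.pi * (x + b * α))|) →
      δ * Real.exp (-(ε * n))
        ≤ ∏ b ∈ (Ico s (s + n)).erase a, |2 * Real.sin (Real.pi * (x + b * α))| := by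
  obtain ⟨N, hN⟩ := le_prod_sin_range hc hR hdio hε
  refine ⟨N, fun n hn x s a δ hδ0 hδ1 hδ => ?_⟩
  obtain ⟨j₀, hj₀⟩ := exists_Ico_erase_eq s n a
  rw [hj₀] at hδ ⊢
  rw [prod_shift]
  have e : ∀ j : ℕ, x + ((s + (j : ℤ) : ℤ) : ℝ) * α = x + s * α + j * α := fun j => by
    push_cast; ring
  simp only [mem_image, forall_exists_index, and_imp, forall_apply_eq_imp_iff₂, e] at hδ ⊢
  exact hN n hn (x + s * α) j₀ δ hδ0 hδ1 hδ

end SineProducts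

section Interpolation

open Finset

variable {lam α ω E c : ℝ} {R : ℕ}

lemma abs_cos_sub_cos (t s : ℝ) :
    2 * |Real.cos (2 * Real.pi * t) - Real.cos (2 * Real.pi * s)|
      = |2 * Real.sin (Real.pi * (t + s))| * |2 * Real.sin (Real.pi * (s - t))| := by
  rw [Real.cos_sub_cos, show (2 * Real.pi * t + 2 * Real.pi * s) / 2 = Real.pi * (t + s) by ring,
    show (2 * Real.pi * t - 2 * Real.pi * s) / 2 = -(Real.pi * (s - t)) by ring, Real.sin_neg,
    abs_mul, abs_mul, abs_neg, abs_neg, abs_mul, abs_mul, abs_two]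
  ring

lemma abs_eval_le_of_nodes {ι : Type*} [DecidableEq ι] (S : Finset ι) (v : ι → ℝ)
    (P : Polynomial ℝ) (hP : P.degree < S.card) (hv : Set.InjOn v S) {B Q : ℝ} (hB : 0 ≤ B)
    (hB' : ∀ a ∈ S, |P.eval (v a)| ≤ B) (x : ℝ)
    (hQ : ∀ a ∈ S, ∏ b ∈ S.erase a, |x - v b| ≤ Q * ∏ b ∈ S.erase a, |v a - v b|) :
    |P.eval x| ≤ S.card * (B * Q) := by
  rw [Lagrange.eq_interpolate hv hP, Lagrange.interpolate_apply, Polynomial.eval_finsetSum]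
  refine (abs_sum_le_sum_abs _ _).trans ?_
  rw [← nsmul_eq_mul]
  refine sum_le_card_nsmul _ _ _ fun a ha => ?_
  rw [Polynomial.eval_mul, Polynomial.eval_C, abs_mul]
  refine mul_le_mul (hB' a ha) ?_ (abs_nonneg _) hB
  have hpos : 0 < ∏ b ∈ S.erase a, |v a - v b| := prod_pos fun b hb => by
    rw [abs_pos, sub_ne_zero]
    intro h
    exact (ne_of_mem_erase hb) (hv (mem_of_mem_erase hb) ha h.symm)
  rw [Lagrange.basis, Polynomial.eval_prod, abs_prod]
  simp only [Lagrange.basisDivisor, Polynomial.eval_mul, Polynomial.eval_C, Polynomial.eval_sub,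
    Polynomial.eval_X, abs_mul, abs_inv]
  rw [prod_mul_distrib, prod_inv_distrib, inv_mul_le_iff₀ hpos, mul_comm]
  exact hQ a ha

lemma dio_int (hdio : ∀ n : ℕ, 0 < n → c / (n : ℝ) ^ R ≤ |Real.sin (Real.pi * (n * α))|)
    {n : ℤ} (hn : n ≠ 0) : c / (n.natAbs : ℝ) ^ R ≤ |Real.sin (Real.pi * (n * α))| := by
  have h := hdio n.natAbs (by omega)
  rcases Int.natAbs_eq n with h1 | h1
  · have : (n : ℝ) = (n.natAbs : ℝ) := by
      rw [← Int.cast_natCast (R := ℝ) n.natAbs, ← h1]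
    rwa [this]
  · have : (n : ℝ) = -(n.natAbs : ℝ) := by
      rw [← Int.cast_natCast (R := ℝ) n.natAbs, ← Int.cast_neg, ← h1]
    rwa [this, neg_mul, mul_neg, Real.sin_neg, abs_neg]

/-- If the determinants are at most `B` at the phases of two orbit segments, one close to a fixed
site `p` and one close to a distant site `y`, then they are essentially at most `B` everywhere. -/
lemma abs_dirDet_le_of_nodes (hc : 0 < c) (hR : 0 < R)
    (hdio : ∀ n : ℕ, 0 < n → c / (n : ℝ) ^ R ≤ |Real.sin (Real.pi * (n * α))|)
    (hres : ∀ ε > (0 : ℝ), ∃ N : ℕ, ∀ n : ℤ, (N : ℤ) ≤ n →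
      Real.exp (-(ε * n)) ≤ |Real.sin (Real.pi * (2 * ω + n * α))|)
    (p : ℤ) {ε : ℝ} (hε : 0 < ε) :
    ∃ M : ℕ, ∀ m : ℕ, M ≤ m → ∀ k : ℕ, k ≤ 20 * m → 20 * m ≤ k + 1 →
      ∀ y : ℤ, 40 * m ≤ y → y ≤ 40 * m + 40 → ∀ B : ℝ, 0 ≤ B →
      (∀ a ∈ Ico (p - 9 * m) (p - 9 * m + (7 * m : ℕ)),
        |dirDet lam α E (k + 1) (ω + a * α)| ≤ B) →
      (∀ a ∈ Ico (y - 18 * m) (y - 18 * m + (k + 1 - 7 * m : ℕ)),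
        |dirDet lam α E (k + 1) (ω + a * α)| ≤ B) →
      ∀ θ, |dirDet lam α E (k + 1) θ| ≤ (k + 1) * (B * Real.exp (ε * m)) := by
  set η := ε / 100 with hη
  have hη0 : 0 < η := by positivity
  obtain ⟨N₁, hN₁⟩ := prod_sin_Ico_le hc hdio hη0
  obtain ⟨N₂, hN₂⟩ := le_prod_sin_Ico hc hR hdio hη0
  obtain ⟨N₃, hN₃⟩ := hres (η / 200) (by positivity)
  have hev : ∀ᶠ m : ℕ in Filter.atTop, Real.exp (-(η * m)) ≤ c / ((100 * m : ℕ) : ℝ) ^ R := by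
    have h1 : Filter.Tendsto (fun m : ℕ => (m : ℝ) ^ R * Real.exp (-η * m)) Filter.atTop
        (nhds 0) := by
      have h2 := (Real.tendsto_pow_mul_exp_neg_atTop_nhds_zero R).comp
        ((tendsto_natCast_atTop_atTop (R := ℝ)).const_mul_atTop hη0)
      have h3 := h2.const_mul ((1 / η) ^ R)
      rw [mul_zero] at h3
      refine h3.congr fun m => ?_
      simp only [Function.comp]
      rw [← mul_assoc, ← mul_pow, ← mul_assoc, one_div, inv_mul_cancel₀ hη0.ne', one_mul, neg_mul]
    filter_upwards [h1.eventually (gt_mem_nhds (show 0 < c / 100 ^ R by positivity)),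
      Filter.eventually_gt_atTop 0] with m hm hm0
    have hm0' : (0 : ℝ) < m := by exact_mod_cast hm0
    rw [lt_div_iff₀ (by positivity)] at hm
    rw [le_div_iff₀ (by positivity)]
    push_cast
    rw [mul_pow, ← neg_mul]
    linarith
  obtain ⟨N₄, hN₄⟩ := Filter.eventually_atTop.1 hev
  refine ⟨N₁ + N₂ + N₃ + N₄ + 2 * p.natAbs + 2, ?_⟩
  intro m hm k hk1 hk2 y hy1 hy2 B hB hB1 hB2 θ
  set W₁ := Ico (p - 9 * m) (p - 9 * m + (7 * m : ℕ)) with hW₁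
  set W₂ := Ico (y - 18 * m) (y - 18 * m + (k + 1 - 7 * m : ℕ)) with hW₂
  obtain ⟨P, hPdeg, hP⟩ := exists_cos_poly lam α E k
  set κ : ℝ := ((k : ℝ) - 1) / 2 * α with hκ
  set τ : ℤ → ℝ := fun a => ω + κ + a * α with hτ
  set v : ℤ → ℝ := fun a => Real.cos (2 * Real.pi * τ a) with hv
  have hPv : ∀ a, P.eval (v a) = dirDet lam α E (k + 1) (ω + a * α) := by
    intro a
    rw [hv, ← hP, hτ]
    congr 1
    ring
  set S := W₁ ∪ W₂ with hS
  have hdisj : Disjoint W₁ W₂ := by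
    rw [disjoint_left]
    intro a h1 h2
    rw [hW₁, mem_Ico] at h1
    rw [hW₂, mem_Ico] at h2
    omega
  have hcard : S.card = k + 1 := by
    rw [hS, card_union_of_disjoint hdisj, hW₁, hW₂, Int.card_Ico, Int.card_Ico]
    omega
  have hSlow : ∀ a ∈ S, p - 9 * m ≤ a ∧ a ≤ 80 * m := by
    intro a ha
    rcases mem_union.1 ha with h | h
    · rw [hW₁, mem_Ico] at h; omega
    · rw [hW₂, mem_Ico] at h; omega
  set d := Real.exp (-(η * m)) with hd
  have hd0 : 0 < d := Real.exp_pos _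
  have hd1 : d ≤ 1 := by
    rw [hd, Real.exp_le_one_iff]
    have : 0 ≤ η * m := by positivity
    linarith
  have hsum : ∀ a ∈ S, ∀ b ∈ S, d ≤ |2 * Real.sin (Real.pi * (τ a + τ b))| := by
    intro a ha b hb
    obtain ⟨ha1, ha2⟩ := hSlow a ha
    obtain ⟨hb1, hb2⟩ := hSlow b hb
    have h1 := hN₃ (a + b + k - 1) (by omega)
    have h2 : Real.pi * (2 * ω + ((a + b + k - 1 : ℤ) : ℝ) * α) = Real.pi * (τ a + τ b) := by
      rw [hτ, hκ]; push_cast; ring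
    rw [h2] at h1
    have h3 : ((a + b + k - 1 : ℤ) : ℝ) ≤ 200 * m := by
      exact_mod_cast (by omega : a + b + k - 1 ≤ 200 * (m : ℤ))
    have h4 : d ≤ Real.exp (-(η / 200 * ((a + b + k - 1 : ℤ) : ℝ))) := by
      refine Real.exp_le_exp.2 ?_
      nlinarith
    rw [abs_mul, abs_two]
    linarith [abs_nonneg (Real.sin (Real.pi * (τ a + τ b)))]
  have hdiff : ∀ a ∈ S, ∀ b ∈ S, b ≠ a → d ≤ |2 * Real.sin (Real.pi * (τ b - τ a))| := by
    intro a ha b hb hne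
    obtain ⟨ha1, ha2⟩ := hSlow a ha
    obtain ⟨hb1, hb2⟩ := hSlow b hb
    have h1 := dio_int hdio (n := b - a) (sub_ne_zero.2 hne)
    have h2 : Real.pi * (((b - a : ℤ) : ℝ) * α) = Real.pi * (τ b - τ a) := by
      rw [hτ]; push_cast; ring
    rw [h2] at h1
    have h3 : c / ((100 * m : ℕ) : ℝ) ^ R ≤ c / ((b - a).natAbs : ℝ) ^ R := by
      have h5 : (0 : ℝ) < ((b - a).natAbs : ℝ) := by
        exact_mod_cast (by omega : 0 < (b - a).natAbs)
      have h6 : ((b - a).natAbs : ℝ) ≤ ((100 * m : ℕ) : ℝ) := by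
        exact_mod_cast (by omega : (b - a).natAbs ≤ 100 * m)
      gcongr
    have h4 := hN₄ m (by omega)
    rw [abs_mul, abs_two]
    linarith [abs_nonneg (Real.sin (Real.pi * (τ b - τ a)))]
  have hinj : Set.InjOn v S := by
    intro a ha b hb hab
    by_contra hne
    have h1 := abs_cos_sub_cos (τ a) (τ b)
    have h2 : Real.cos (2 * Real.pi * τ a) = Real.cos (2 * Real.pi * τ b) := hab
    rw [h2, sub_self, abs_zero, mul_zero] at h1
    have h3 := hsum a ha b hb
    have h4 := hdiff a ha b hb (Ne.symm hne)
    have := mul_pos (hd0.trans_le h3) (hd0.trans_le h4)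
    linarith
  have herase : ∀ (a : ℤ) (f : ℤ → ℝ), ∏ b ∈ S.erase a, f b
      = (∏ b ∈ W₁.erase a, f b) * ∏ b ∈ W₂.erase a, f b := by
    intro a f
    rw [hS, erase_union_distrib, prod_union]
    exact disjoint_of_subset_left (erase_subset _ _)
      (disjoint_of_subset_right (erase_subset _ _) hdisj)
  have hn : ((7 * m : ℕ) : ℝ) + ((k + 1 - 7 * m : ℕ) : ℝ) ≤ 21 * m := by
    exact_mod_cast (by omega : 7 * m + (k + 1 - 7 * m) ≤ 21 * m)
  have hup : ∀ (a : ℤ) (x : ℝ), ∏ b ∈ S.erase a, |2 * Real.sin (Real.pi * (x + b * α))|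
      ≤ Real.exp (η * (21 * m)) := by
    intro a x
    rw [herase]
    calc _ ≤ Real.exp (η * (7 * m : ℕ)) * Real.exp (η * (k + 1 - 7 * m : ℕ)) := by
          gcongr
          · exact hN₁ _ (by omega) _ _ _
          · exact hN₁ _ (by omega) _ _ _
      _ = Real.exp (η * (((7 * m : ℕ) : ℝ) + ((k + 1 - 7 * m : ℕ) : ℝ))) := by
          rw [← Real.exp_add, mul_add]
      _ ≤ _ := by gcongr
  have hlow : ∀ (a : ℤ) (x : ℝ),
      (∀ b ∈ S.erase a, d ≤ |2 * Real.sin (Real.pi * (x + b * α))|) →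
      d ^ 2 * Real.exp (-(η * (21 * m)))
        ≤ ∏ b ∈ S.erase a, |2 * Real.sin (Real.pi * (x + b * α))| := by
    intro a x hx
    rw [herase]
    have hsub1 : W₁.erase a ⊆ S.erase a := erase_subset_erase _ subset_union_left
    have hsub2 : W₂.erase a ⊆ S.erase a := erase_subset_erase _ subset_union_right
    calc d ^ 2 * Real.exp (-(η * (21 * m)))
        ≤ d ^ 2 * Real.exp (-(η * (((7 * m : ℕ) : ℝ) + ((k + 1 - 7 * m : ℕ) : ℝ)))) := by gcongr
      _ = (d * Real.exp (-(η * (7 * m : ℕ)))) * (d * Real.exp (-(η * (k + 1 - 7 * m : ℕ)))) := by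
          rw [mul_add, neg_add, Real.exp_add]; ring
      _ ≤ _ := by
          gcongr
          · exact hN₂ _ (by omega) _ _ _ _ hd0 hd1 fun b hb => hx b (hsub1 hb)
          · exact hN₂ _ (by omega) _ _ _ _ hd0 hd1 fun b hb => hx b (hsub2 hb)
  have hfac : ∀ (a : ℤ) (t : ℝ), 2 ^ (S.erase a).card
        * ∏ b ∈ S.erase a, |Real.cos (2 * Real.pi * t) - v b|
      = (∏ b ∈ S.erase a, |2 * Real.sin (Real.pi * (t + ω + κ + b * α))|)
        * ∏ b ∈ S.erase a, |2 * Real.sin (Real.pi * (ω + κ - t + b * α))| := by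
    intro a t
    rw [← prod_const, ← prod_mul_distrib, ← prod_mul_distrib]
    refine prod_congr rfl fun b _ => ?_
    rw [abs_cos_sub_cos, hτ]
    congr 4 <;> ring
  have hθ : dirDet lam α E (k + 1) θ = P.eval (Real.cos (2 * Real.pi * (θ + κ))) := by
    rw [← hP]; congr 1; ring
  rw [hθ, show ((k : ℝ) + 1) = (S.card : ℝ) by rw [hcard]; push_cast; ring]
  refine abs_eval_le_of_nodes S v P (by rw [hcard]; exact hPdeg) hinj hB ?_ _ ?_
  · intro a ha
    rw [hPv]
    rcases mem_union.1 ha with h | h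
    · exact hB1 a h
    · exact hB2 a h
  · intro a ha
    have h2pos : (0 : ℝ) < 2 ^ (S.erase a).card := by positivity
    rw [← mul_le_mul_iff_right₀ h2pos, mul_left_comm, hfac, show v a =
      Real.cos (2 * Real.pi * τ a) from rfl, hfac]
    calc _ ≤ Real.exp (η * (21 * m)) * Real.exp (η * (21 * m)) := by
          gcongr
          · exact hup _ _
          · exact hup _ _
      _ ≤ Real.exp (ε * m) * ((d ^ 2 * Real.exp (-(η * (21 * m))))
            * (d ^ 2 * Real.exp (-(η * (21 * m))))) := by
          rw [hd, ← Real.exp_nat_mul, ← Real.exp_add, ← Real.exp_add, ← Real.exp_add,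
            ← Real.exp_add]
          refine Real.exp_le_exp.2 ?_
          have : 0 ≤ η * m := by positivity
          rw [show ε = 100 * η by rw [hη]; ring]
          push_cast
          linarith
      _ ≤ _ := by
          gcongr
          · refine hlow _ _ fun b hb => ?_
            have := hsum a ha b (mem_of_mem_erase hb)
            rwa [show τ a + τ b = τ a + ω + κ + b * α by rw [hτ]; ring] at this
          · refine hlow _ _ fun b hb => ?_
            have := hdiff a ha b (mem_of_mem_erase hb) (ne_of_mem_erase hb)
            rwa [show τ b - τ a = ω + κ - τ a + b * α by rw [hτ]; ring] at this

end Interpolation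

section Green

open Finset

variable {lam α ω E : ℝ}

lemma eventually_poly_le_exp (δ K : ℝ) (hK : 0 < K) (hδ : 0 < δ) {η : ℝ} (hη : 0 < η) :
    ∃ N : ℕ, ∀ m : ℕ, N ≤ m → K * (1 + 200 * (m : ℝ)) ^ δ ≤ Real.exp (η * m) := by
  have h1 := (isLittleO_rpow_exp_pos_mul_atTop δ (show 0 < η / 201 by positivity)).bound
    (show 0 < 1 / K by positivity)
  have h2 := ((tendsto_natCast_atTop_atTop (R := ℝ)).const_mul_atTop
    (show (0 : ℝ) < 201 by norm_num)).eventually h1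
  obtain ⟨N, hN⟩ := Filter.eventually_atTop.1 h2
  refine ⟨N + 1, fun m hm => ?_⟩
  have h3 := hN m (by omega)
  have hm1 : (1 : ℝ) ≤ m := by exact_mod_cast (by omega : 1 ≤ m)
  rw [Real.norm_of_nonneg (by positivity), Real.norm_of_nonneg (by positivity),
    one_div, inv_mul_eq_div, le_div_iff₀ hK] at h3
  calc K * (1 + 200 * (m : ℝ)) ^ δ ≤ K * (201 * (m : ℝ)) ^ δ := by
        gcongr; linarith
    _ ≤ Real.exp (η / 201 * (201 * m)) := by linarith
    _ = _ := by congr 1; ring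

/-- A large determinant on an interval around `z` forces a solution to be small at `z`. -/
lemma abs_mul_dirDet_le {L : ℝ} (hL : 0 < L)
    (hgrow : ∀ ε > 0, ∃ N : ℕ, ∀ n ≥ N, ∀ θ,
      |dirDet lam α E n θ| ≤ Real.exp ((L + ε) * n))
    {u : ℤ → ℝ}
    (hsol : ∀ n : ℤ,
      u (n + 1) + u (n - 1) + 2 * lam * Real.cos (2 * Real.pi * (ω + n * α)) * u n = E * u n)
    {C δ : ℝ} (hC : 0 < C) (hδ : 0 < δ)
    (hpoly : ∀ n : ℤ, |u n| ≤ C * (1 + |(n : ℝ)|) ^ δ) {ε : ℝ} (hε : 0 < ε) :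
    ∃ M : ℕ, ∀ m : ℕ, M ≤ m → ∀ k : ℕ, k ≤ 20 * m → 20 * m ≤ k + 1 →
      ∀ z : ℤ, |z| ≤ 100 * m → ∀ a : ℤ, 2 * m ≤ z - a → z - a ≤ 18 * m →
        |u z| * |dirDet lam α E (k + 1) (ω + a * α)| ≤ Real.exp (18 * L * m + ε * m) := by
  set η := ε / 100 with hη
  have hη0 : 0 < η := by positivity
  obtain ⟨N₁, hN₁⟩ := hgrow η hη0
  obtain ⟨N₂, hN₂⟩ := eventually_poly_le_exp δ (2 * C * Real.exp (L + η)) (by positivity) hδ hη0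
  refine ⟨N₁ + N₂ + 2, ?_⟩
  intro m hm k hk1 hk2 z hz a ha1 ha2
  have hz' := abs_le.1 hz
  obtain ⟨i, hi⟩ := Int.eq_ofNat_of_zero_le (show 0 ≤ z - a by omega)
  obtain ⟨l, hl⟩ : ∃ l, k + 1 = i + l + 2 := ⟨k - 1 - i, by omega⟩
  have hzi : z = a + i := by omega
  have heq := solution_eq hsol a i l
  rw [← hl, ← hzi] at heq
  have hu : ∀ b : ℤ, |b| ≤ 200 * m → |u b| ≤ C * (1 + 200 * (m : ℝ)) ^ δ := by
    intro b hb
    have hb' : |(b : ℝ)| ≤ 200 * m := by exact_mod_cast hb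
    refine (hpoly b).trans ?_
    gcongr
  have hd : ∀ n : ℕ, N₁ ≤ n → n ≤ 18 * m + 1 → ∀ θ,
      |dirDet lam α E n θ| ≤ Real.exp ((L + η) * (18 * m + 1)) := by
    intro n h1 h2 θ
    have h3 : (n : ℝ) ≤ 18 * m + 1 := by exact_mod_cast h2
    refine (hN₁ n h1 θ).trans ?_
    gcongr
  rw [← abs_mul, heq]
  refine (abs_add_le _ _).trans ?_
  rw [abs_mul, abs_mul]
  calc _ ≤ Real.exp ((L + η) * (18 * m + 1)) * (C * (1 + 200 * (m : ℝ)) ^ δ)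
        + Real.exp ((L + η) * (18 * m + 1)) * (C * (1 + 200 * (m : ℝ)) ^ δ) := by
        gcongr
        · exact hd _ (by omega) (by omega) _
        · exact hu _ (abs_le.2 ⟨by omega, by omega⟩)
        · exact hd _ (by omega) (by omega) _
        · exact hu _ (abs_le.2 ⟨by omega, by omega⟩)
    _ = Real.exp ((L + η) * (18 * m))
        * (2 * C * Real.exp (L + η) * (1 + 200 * (m : ℝ)) ^ δ) := by
        rw [mul_add, mul_one, Real.exp_add]; ring
    _ ≤ Real.exp ((L + η) * (18 * m)) * Real.exp (η * m) := by
        gcongr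
        exact hN₂ m (by omega)
    _ ≤ _ := by
        rw [← Real.exp_add]
        refine Real.exp_le_exp.2 ?_
        have : 0 ≤ η * m := by positivity
        rw [show ε = 100 * η by rw [hη]; ring]
        linarith

end Green

section HalfLine

open Finset

variable {lam α ω E c : ℝ} {R : ℕ}

lemma exists_exp_decay_nonneg (hlam : 1 < lam) (hc : 0 < c) (hR : 0 < R)
    (hdio : ∀ n : ℕ, 0 < n → c / (n : ℝ) ^ R ≤ |Real.sin (Real.pi * (n * α))|)
    (hres : ∀ ε > (0 : ℝ), ∃ N : ℕ, ∀ n : ℤ, (N : ℤ) ≤ n →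
      Real.exp (-(ε * n)) ≤ |Real.sin (Real.pi * (2 * ω + n * α))|)
    {u : ℤ → ℝ} (hu0 : u ≠ 0)
    (hsol : ∀ n : ℤ,
      u (n + 1) + u (n - 1) + 2 * lam * Real.cos (2 * Real.pi * (ω + n * α)) * u n = E * u n)
    {C δ : ℝ} (hC : 0 < C) (hδ : 0 < δ)
    (hpoly : ∀ n : ℤ, |u n| ≤ C * (1 + |(n : ℝ)|) ^ δ) :
    ∃ C' > (0 : ℝ), ∃ β > (0 : ℝ), ∀ n : ℕ, |u n| ≤ C' * Real.exp (-β * n) := by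
  obtain ⟨p, hp⟩ := Function.ne_iff.1 hu0
  have hp0 : 0 < |u p| := abs_pos.2 hp
  obtain ⟨L, hL, hgrow⟩ := exists_growth_rate α E hlam
  set ε := L / 24 with hε
  have hε0 : 0 < ε := by positivity
  obtain ⟨-, N₁, hN₁⟩ := hgrow ε hε0
  obtain ⟨N₂, hN₂⟩ := abs_dirDet_le_of_nodes (lam := lam) (E := E) hc hR hdio hres p hε0
  obtain ⟨N₃, hN₃⟩ := abs_mul_dirDet_le hL (fun ε h => (hgrow ε h).1) hsol hC hδ hpoly hε0
  obtain ⟨N₄, hN₄⟩ := eventually_poly_le_exp 1 1 one_pos one_pos hε0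
  have hdecay : ∃ N : ℕ, ∀ m : ℕ, N ≤ m → Real.exp (-(L * m)) < |u p| := by
    have h := Real.tendsto_exp_neg_atTop_nhds_zero.comp
      ((tendsto_natCast_atTop_atTop (R := ℝ)).const_mul_atTop hL)
    exact Filter.eventually_atTop.1 (h.eventually (gt_mem_nhds hp0))
  obtain ⟨N₅, hN₅⟩ := hdecay
  set M := N₁ + N₂ + N₃ + N₄ + N₅ + p.natAbs + 2 with hM
  have key : ∀ m : ℕ, M ≤ m → ∀ y : ℤ, 40 * m ≤ y → y ≤ 40 * m + 40 →
      |u y| ≤ Real.exp (-(L * m)) := by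
    intro m hm y hy1 hy2
    have hm0 : (0 : ℝ) < m := by exact_mod_cast (by omega : 0 < m)
    obtain ⟨θ, k, hk1, hk2, hθ⟩ : ∃ θ : ℝ, ∃ k : ℕ, k ≤ 20 * m ∧ 20 * m ≤ k + 1 ∧
        Real.exp ((L - ε) * (20 * m : ℕ)) ≤ |dirDet lam α E (k + 1) θ| := by
      obtain ⟨θ, h | h⟩ := hN₁ (20 * m) (by omega)
      · exact ⟨θ, 20 * m, le_rfl, by omega, h⟩
      · refine ⟨θ, 20 * m - 1, by omega, by omega, ?_⟩
        rwa [Nat.sub_add_cancel (by omega)]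
    set B := Real.exp (20 * L * m - 23 * ε * m) with hB
    have hsmall : ∀ z : ℤ, |z| ≤ 100 * m → ∀ a : ℤ, 2 * m ≤ z - a → z - a ≤ 18 * m →
        B < |dirDet lam α E (k + 1) (ω + a * α)| → |u z| ≤ Real.exp (-(L * m)) := by
      intro z hz a ha1 ha2 hBa
      have h := hN₃ m (by omega) k hk1 hk2 z hz a ha1 ha2
      have h1 : |u z| * B ≤ Real.exp (18 * L * m + ε * m) :=
        (mul_le_mul_of_nonneg_left hBa.le (abs_nonneg _)).trans h
      rw [← le_div_iff₀ (Real.exp_pos _), ← Real.exp_sub] at h1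
      refine h1.trans (le_of_eq ?_)
      congr 1
      rw [hε]; ring
    by_contra hcon
    have hnodes := hN₂ m (by omega) k hk1 hk2 y hy1 hy2 B (Real.exp_pos _).le ?_ ?_ θ
    · have h1 := hN₄ m (by omega)
      rw [Real.rpow_one, one_mul] at h1
      have h2 : (k : ℝ) + 1 ≤ Real.exp (ε * m) := by
        have : (k : ℝ) ≤ 20 * m := by exact_mod_cast hk1
        linarith
      have h3 : ((k : ℝ) + 1) * (B * Real.exp (ε * m))
          ≤ Real.exp (ε * m) * (B * Real.exp (ε * m)) := by gcongr
      have h4 := hθ.trans (hnodes.trans h3)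
      rw [hB, ← Real.exp_add, ← Real.exp_add, Real.exp_le_exp] at h4
      have h5 : 0 < ε * m := by positivity
      push_cast at h4
      linarith
    · intro a ha
      rw [mem_Ico] at ha
      by_contra h
      have h1 := hsmall p (abs_le.2 ⟨by omega, by omega⟩) a (by omega) (by omega) (not_le.1 h)
      exact absurd h1 (not_le.2 (hN₅ m (by omega)))
    · intro a ha
      rw [mem_Ico] at ha
      by_contra h
      exact hcon (hsmall y (abs_le.2 ⟨by omega, by omega⟩) a (by omega) (by omega) (not_le.1 h))
  refine ⟨Real.exp L + C * (1 + 40 * M) ^ δ * Real.exp (L * M), by positivity, L / 40,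
    by positivity, fun n => ?_⟩
  rw [add_mul]
  rcases le_or_gt (40 * M) n with hn | hn
  · have h := key (n / 40) (by omega) n (by omega) (by omega)
    have h1 : (n : ℝ) / 40 - 1 ≤ ((n / 40 : ℕ) : ℝ) := by
      have : (n : ℝ) ≤ 40 * ((n / 40 : ℕ) : ℝ) + 40 := by
        exact_mod_cast (by omega : n ≤ 40 * (n / 40) + 40)
      linarith
    have h2 : Real.exp (-(L * ((n / 40 : ℕ) : ℝ))) ≤ Real.exp L * Real.exp (-(L / 40) * n) := by
      rw [← Real.exp_add]
      refine Real.exp_le_exp.2 ?_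
      nlinarith
    have h3 : 0 ≤ C * (1 + 40 * (M : ℝ)) ^ δ * Real.exp (L * M) * Real.exp (-(L / 40) * n) := by
      positivity
    linarith
  · have hn' : (n : ℝ) ≤ 40 * M := by exact_mod_cast hn.le
    have h1 : |u n| ≤ C * (1 + 40 * (M : ℝ)) ^ δ := by
      refine (hpoly n).trans ?_
      rw [Int.cast_natCast, Nat.abs_cast]
      gcongr
    have h2 : 1 ≤ Real.exp (L * M) * Real.exp (-(L / 40) * n) := by
      rw [← Real.exp_add, Real.one_le_exp_iff]
      nlinarith
    have h3 : C * (1 + 40 * (M : ℝ)) ^ δ * 1 ≤ C * (1 + 40 * (M : ℝ)) ^ δ *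
        (Real.exp (L * M) * Real.exp (-(L / 40) * n)) := by gcongr
    have h4 : 0 ≤ Real.exp L * Real.exp (-(L / 40) * n) := by positivity
    linarith

end HalfLine

section Phases

variable {α ω : ℝ}

lemma exists_pow_dio {c r : ℝ}
    (hdio : ∀ n : ℤ, n ≠ 0 → c / |(n : ℝ)| ^ r < |Real.sin (2 * Real.pi * n * α)|)
    (hc : 0 < c) (n : ℕ) (hn : 0 < n) :
    c / 2 / (n : ℝ) ^ ⌈r⌉₊ ≤ |Real.sin (Real.pi * (n * α))| := by
  have h := hdio n (by exact_mod_cast hn.ne')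
  rw [Int.cast_natCast, Nat.abs_cast,
    show 2 * Real.pi * n * α = 2 * (Real.pi * (n * α)) by ring, Real.sin_two_mul, abs_mul,
    abs_mul, abs_two] at h
  have hn1 : (1 : ℝ) ≤ n := by exact_mod_cast hn
  have h1 : (n : ℝ) ^ r ≤ (n : ℝ) ^ ⌈r⌉₊ := by
    rw [← Real.rpow_natCast]
    exact Real.rpow_le_rpow_of_exponent_le hn1 (Nat.le_ceil r)
  have h2 : c / (n : ℝ) ^ ⌈r⌉₊ ≤ c / (n : ℝ) ^ r := by
    have : 0 < (n : ℝ) ^ r := by positivity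
    gcongr
  have h3 := Real.abs_cos_le_one (Real.pi * (n * α))
  have h4 := mul_le_mul_of_nonneg_left h3 (abs_nonneg (Real.sin (Real.pi * (n * α))))
  rw [div_div, mul_comm 2, ← div_div]
  linarith

lemma exists_exp_le_abs_sin {s : ℝ} (hs : s < 1)
    (hres : {n : ℤ | |Real.sin (2 * Real.pi * (ω + (n : ℝ) / 2 * α))| <
      Real.exp (-(|(n : ℝ)| ^ s)) }.Finite) {ε : ℝ} (hε : 0 < ε) :
    ∃ N : ℕ, ∀ n : ℤ, (N : ℤ) ≤ |n| →
      Real.exp (-(ε * |(n : ℝ)|)) ≤ |Real.sin (Real.pi * (2 * ω + n * α))| := by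
  obtain ⟨X, hX⟩ := Filter.eventually_atTop.1
    (((tendsto_rpow_neg_atTop (sub_pos.2 hs)).eventually (gt_mem_nhds hε)).and
      (Filter.eventually_gt_atTop 0))
  obtain ⟨K, hK⟩ := (hres.image fun n => |n|).bddAbove
  refine ⟨⌈X⌉₊ + K.natAbs + 1, fun n hn => ?_⟩
  have hnK : n ∉ {n : ℤ | |Real.sin (2 * Real.pi * (ω + (n : ℝ) / 2 * α))| <
      Real.exp (-(|(n : ℝ)| ^ s)) } := by
    intro h
    have : |n| ≤ K := hK (Set.mem_image_of_mem _ h)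
    omega
  rw [Set.mem_ofPred_eq, not_lt] at hnK
  have hnX : X ≤ |(n : ℝ)| := by
    refine (Nat.le_ceil X).trans ?_
    have : ((⌈X⌉₊ : ℕ) : ℤ) ≤ |n| := by omega
    exact_mod_cast this
  obtain ⟨h1, h0⟩ := hX _ hnX
  have h2 : |(n : ℝ)| ^ s ≤ ε * |(n : ℝ)| := by
    calc |(n : ℝ)| ^ s = |(n : ℝ)| ^ (-(1 - s)) * |(n : ℝ)| := by
          rw [← Real.rpow_add_one h0.ne']
          congr 1
          ring
      _ ≤ _ := by gcongr
  rw [show Real.pi * (2 * ω + n * α) = 2 * Real.pi * (ω + (n : ℝ) / 2 * α) by ring]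
  exact (Real.exp_le_exp.2 (neg_le_neg h2)).trans hnK

end Phases

end AlmostMathieu


/-- Jitomirskaya's localization theorem, solution form: suppose `λ > 1`, `α` is irrational
and Diophantine with constants `c > 0`, `r > 1`, and `ω` is non-resonant for `α` (the
resonance inequality holds for only finitely many `n`). Then every nonzero polynomially
bounded solution of the almost Mathieu difference equation decays exponentially. -/
theorem jitomirskaya_localization (lam α ω E : ℝ) (hlam : 1 < lam)
    (hirr : Irrational α) (c r : ℝ) (hc : 0 < c) (hr : 1 < r)
    (hdio : ∀ n : ℤ, n ≠ 0 → c / |(n : ℝ)| ^ r < |Real.sin (2 * Real.pi * n * α)|)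
    (hres : {n : ℤ |
        |Real.sin (2 * Real.pi * (ω + (n : ℝ) / 2 * α))| <
          Real.exp (-(|(n : ℝ)| ^ (1 / (2 * r)))) }.Finite)
    (u : ℤ → ℝ) (hu0 : u ≠ 0)
    (hsol : ∀ n : ℤ,
      u (n + 1) + u (n - 1) + 2 * lam * Real.cos (2 * Real.pi * (ω + n * α)) * u n = E * u n)
    (C δ : ℝ) (hC : 0 < C) (hδ : 0 < δ)
    (hpoly : ∀ n : ℤ, |u n| ≤ C * (1 + |(n : ℝ)|) ^ δ) :
    ∃ C' > (0 : ℝ), ∃ β > (0 : ℝ),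
      ∀ n : ℤ, |u n| ≤ C' * Real.exp (-β * |(n : ℝ)|) := by
  have hs : 1 / (2 * r) < 1 := by
    rw [div_lt_one (by positivity)]
    linarith
  have hdio' := AlmostMathieu.exists_pow_dio hdio hc
  have hR : 0 < ⌈r⌉₊ := Nat.ceil_pos.2 (by linarith)
  have hres' := fun (ε : ℝ) (hε : ε > 0) => AlmostMathieu.exists_exp_le_abs_sin hs hres hε
  obtain ⟨C₁, hC₁, β₁, hβ₁, h₁⟩ := AlmostMathieu.exists_exp_decay_nonneg hlam (half_pos hc) hR
    hdio' (fun ε hε => by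
      obtain ⟨N, hN⟩ := hres' ε hε
      refine ⟨N, fun n hn => ?_⟩
      have h0 : 0 ≤ n := by omega
      have h := hN n (by rwa [abs_of_nonneg h0])
      rwa [abs_of_nonneg (by exact_mod_cast h0)] at h) hu0 hsol hC hδ hpoly
  obtain ⟨C₂, hC₂, β₂, hβ₂, h₂⟩ := AlmostMathieu.exists_exp_decay_nonneg (ω := -ω) (E := E)
    (u := fun n => u (-n)) hlam (half_pos hc) hR
    hdio' (fun ε hε => by
      obtain ⟨N, hN⟩ := hres' ε hε
      refine ⟨N, fun n hn => ?_⟩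
      have h0 : 0 ≤ n := by omega
      have h := hN (-n) (by rwa [abs_neg, abs_of_nonneg h0])
      rw [Int.cast_neg, abs_neg, abs_of_nonneg (by exact_mod_cast h0)] at h
      rwa [show Real.pi * (2 * ω + -(n : ℝ) * α) = -(Real.pi * (2 * -ω + n * α)) by ring,
        Real.sin_neg, abs_neg] at h)
    (fun h => hu0 (funext fun n => by simpa using congrFun h (-n)))
    (fun n => by
      have h := hsol (-n)
      rw [Int.cast_neg, show 2 * Real.pi * (ω + -(n : ℝ) * α)
        = -(2 * Real.pi * (-ω + n * α)) by ring, Real.cos_neg] at h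
      rw [show -(n + 1) = -n - 1 by ring, show -(n - 1) = -n + 1 by ring]
      linarith)
    hC hδ (fun n => by simpa using hpoly (-n))
  refine ⟨max C₁ C₂, lt_max_of_lt_left hC₁, min β₁ β₂, lt_min hβ₁ hβ₂, fun n => ?_⟩
  obtain ⟨k, rfl | rfl⟩ := Int.eq_nat_or_neg n
  · rw [Int.cast_natCast, Nat.abs_cast]
    refine (h₁ k).trans ?_
    gcongr
    · exact le_max_left _ _
    · exact min_le_left _ _
  · rw [Int.cast_neg, Int.cast_natCast, abs_neg, Nat.abs_cast]
    refine (h₂ k).trans ?_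
    gcongr
    · exact le_max_right _ _
    · exact min_le_right _ _
end

section
/- For every λ > 0 and every irrational α ∈ ℝ, the spectrum of the almost Mathieu operator H^{λ,α}_ω is independent of ω: there is a compact set Σ^{λ,α} ⊆ ℝ such that σ(H^{λ,α}_ω) = Σ^{λ,α} for every ω ∈ ℝ. -/
/-- Translation by `k` on `ℓ²(ℤ, ℂ)`: `(latticeShift k ψ) n = ψ (n + k)`. -/
noncomputable def latticeShift (k : ℤ) :
    lp (fun _ : ℤ => ℂ) 2 →L[ℂ] lp (fun _ : ℤ => ℂ) 2 :=
  LinearMap.mkContinuous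
    { toFun := fun ψ => ⟨fun n => ψ (n + k), by
        have h := (lp.memℓp ψ).summable (by norm_num)
        exact memℓp_gen (h.comp_injective (add_left_injective k))⟩
      map_add' := fun _ _ => rfl
      map_smul' := fun _ _ => rfl } 1 (by
    intro ψ
    rw [one_mul, lp.norm_eq_tsum_rpow (by norm_num), lp.norm_eq_tsum_rpow (by norm_num)]
    exact le_of_eq (congrArg (· ^ _)
      ((Equiv.addRight k).tsum_eq fun n => ‖ψ n‖ ^ (2 : ENNReal).toReal)))

theorem latticeShift_apply (k : ℤ) (ψ : lp (fun _ : ℤ => ℂ) 2) (n : ℤ) :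
    latticeShift k ψ n = ψ (n + k) := rfl

theorem latticeShift_mul_neg (k : ℤ) : latticeShift k * latticeShift (-k) = 1 := by
  ext ψ n
  simp [latticeShift_apply]

/-- Translation by `k` as an invertible operator. -/
noncomputable def latticeShiftUnit (k : ℤ) :
    (lp (fun _ : ℤ => ℂ) 2 →L[ℂ] lp (fun _ : ℤ => ℂ) 2)ˣ where
  val := latticeShift k
  inv := latticeShift (-k)
  val_inv := latticeShift_mul_neg k
  inv_val := by simpa using latticeShift_mul_neg (-k)

theorem inner_latticeShift_left (k : ℤ) (ψ φ : lp (fun _ : ℤ => ℂ) 2) :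
    inner ℂ (latticeShift k ψ) φ = inner ℂ ψ (latticeShift (-k) φ) := by
  rw [lp.inner_eq_tsum, lp.inner_eq_tsum,
    ← (Equiv.addRight k).tsum_eq fun n => inner ℂ (ψ n) (latticeShift (-k) φ n)]
  simp [latticeShift_apply]

/-- A bounded operator on `ℓ²(ℤ, ℂ)` given by nearest-neighbour hopping plus a real potential is
self-adjoint. -/
theorem isSelfAdjoint_of_hopping_add_potential
    {T : lp (fun _ : ℤ => ℂ) 2 →L[ℂ] lp (fun _ : ℤ => ℂ) 2} {v : ℤ → ℝ}
    (hT : ∀ (ψ : lp (fun _ : ℤ => ℂ) 2) (n : ℤ),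
      (T ψ) n = ψ (n + 1) + ψ (n - 1) + (v n : ℂ) * ψ n) : IsSelfAdjoint T := by
  rw [ContinuousLinearMap.isSelfAdjoint_iff_isSymmetric]
  set D := T - latticeShift 1 - latticeShift (-1) with hD
  have hDn (ψ : lp (fun _ : ℤ => ℂ) 2) (n : ℤ) : (D ψ) n = (v n : ℂ) * ψ n := by
    simp [hD, hT, latticeShift_apply, ← sub_eq_add_neg]
    ring
  have hDsymm (ψ φ : lp (fun _ : ℤ => ℂ) 2) : inner ℂ (D ψ) φ = inner ℂ ψ (D φ) := by
    rw [lp.inner_eq_tsum, lp.inner_eq_tsum]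
    refine tsum_congr fun n => ?_
    simp [hDn]
    ring
  have hsum : T = latticeShift 1 + latticeShift (-1) + D := by rw [hD]; abel
  intro ψ φ
  rw [hsum]
  simp only [ContinuousLinearMap.coe_coe, add_apply, inner_add_left,
    inner_add_right, inner_latticeShift_left, hDsymm, neg_neg]
  ring

/-- An operator acting coordinatewise as multiplication by a sequence bounded by `C` has norm at
most `C`. -/
theorem opNorm_le_of_diagonal {T : lp (fun _ : ℤ => ℂ) 2 →L[ℂ] lp (fun _ : ℤ => ℂ) 2}
    {w : ℤ → ℂ} {C : ℝ} (hC : 0 ≤ C) (hw : ∀ n, ‖w n‖ ≤ C)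
    (hT : ∀ (ψ : lp (fun _ : ℤ => ℂ) 2) (n : ℤ), (T ψ) n = w n * ψ n) : ‖T‖ ≤ C := by
  refine T.opNorm_le_bound hC fun ψ => ?_
  have h : ‖T ψ‖ ≤ ‖(C : ℂ) • ψ‖ := lp.norm_mono (by norm_num) fun n => by
    rw [hT, lp.coeFn_smul, Pi.smul_apply, norm_smul, norm_mul, Complex.norm_real,
      Real.norm_of_nonneg hC]
    gcongr
    exact hw n
  rwa [norm_smul, Complex.norm_real, Real.norm_of_nonneg hC] at h

section AlmostMathieu

variable {lam α : ℝ} {Hop : ℝ → (lp (fun _ : ℤ => ℂ) 2 →L[ℂ] lp (fun _ : ℤ => ℂ) 2)}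

theorem continuous_almostMathieu
    (hHop : ∀ (ω : ℝ) (ψ : lp (fun _ : ℤ => ℂ) 2) (n : ℤ),
      (Hop ω ψ) n = ψ (n + 1) + ψ (n - 1) +
        (↑(2 * lam * Real.cos (2 * Real.pi * (ω + n * α))) : ℂ) * ψ n) :
    Continuous Hop := by
  refine (LipschitzWith.of_dist_le_mul (K := (|2 * lam| * (2 * Real.pi)).toNNReal)
    fun x y => ?_).continuous
  rw [Real.coe_toNNReal _ (by positivity), dist_eq_norm]
  refine opNorm_le_of_diagonal
    (w := fun n => ((2 * lam * Real.cos (2 * Real.pi * (x + n * α)) -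
      2 * lam * Real.cos (2 * Real.pi * (y + n * α)) : ℝ) : ℂ)) (by positivity) ?_ ?_
  · intro n
    rw [Complex.norm_real, ← mul_sub, norm_mul, Real.norm_eq_abs, Real.norm_eq_abs,
      mul_assoc |2 * lam|]
    refine mul_le_mul_of_nonneg_left ?_ (abs_nonneg _)
    refine (Real.abs_cos_sub_cos_le _ _).trans (le_of_eq ?_)
    rw [← mul_sub, add_sub_add_right_eq_sub, abs_mul, abs_of_pos Real.two_pi_pos, Real.dist_eq]
  · intro ψ n
    simp only [sub_apply, lp.coeFn_sub, Pi.sub_apply, hHop]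
    push_cast
    ring

theorem spectrum_almostMathieu_add
    (hHop : ∀ (ω : ℝ) (ψ : lp (fun _ : ℤ => ℂ) 2) (n : ℤ),
      (Hop ω ψ) n = ψ (n + 1) + ψ (n - 1) +
        (↑(2 * lam * Real.cos (2 * Real.pi * (ω + n * α))) : ℂ) * ψ n)
    (ω : ℝ) (k m : ℤ) : spectrum ℂ (Hop (ω + (k * α + m))) = spectrum ℂ (Hop ω) := by
  have hconj : Hop (ω + (k * α + m)) =
      (latticeShiftUnit k : lp (fun _ : ℤ => ℂ) 2 →L[ℂ] lp (fun _ : ℤ => ℂ) 2) * Hop ω *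
        ((latticeShiftUnit k)⁻¹ : (lp (fun _ : ℤ => ℂ) 2 →L[ℂ] lp (fun _ : ℤ => ℂ) 2)ˣ) := by
    ext ψ n
    have hcos : Real.cos (2 * Real.pi * (ω + (k * α + m) + n * α)) =
        Real.cos (2 * Real.pi * (ω + (n + k : ℤ) * α)) := by
      rw [← Real.cos_add_int_mul_two_pi (2 * Real.pi * (ω + (n + k : ℤ) * α)) m]
      congr 1
      push_cast
      ring
    change _ = (latticeShift k (Hop ω (latticeShift (-k) ψ))) n
    simp only [latticeShift_apply, hHop, hcos]
    rw [show n + k + 1 + -k = n + 1 by ring, show n + k - 1 + -k = n - 1 by ring,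
      show n + k + -k = n by ring]
  rw [hconj, spectrum.units_conjugate]

theorem spectrum_almostMathieu_subset (hα : Irrational α)
    (hHop : ∀ (ω : ℝ) (ψ : lp (fun _ : ℤ => ℂ) 2) (n : ℤ),
      (Hop ω ψ) n = ψ (n + 1) + ψ (n - 1) +
        (↑(2 * lam * Real.cos (2 * Real.pi * (ω + n * α))) : ℂ) * ψ n)
    (ω ω' : ℝ) : spectrum ℂ (Hop ω) ⊆ spectrum ℂ (Hop ω') := by
  intro z hz
  by_contra hz'
  have hopen : IsOpen {t : ℝ | IsUnit (algebraMap ℂ _ z - Hop (ω + t))} :=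
    Units.isOpen.preimage (continuous_const.sub
      ((continuous_almostMathieu hHop).comp (continuous_const.add continuous_id)))
  have hdense : Dense (AddSubgroup.closure {α, 1} : Set ℝ) :=
    dense_addSubgroupClosure_pair_iff.2 (by simpa using hα)
  obtain ⟨t, ht, htmem⟩ := hdense.inter_open_nonempty _ hopen
    ⟨ω' - ω, by simpa [spectrum.mem_iff] using hz'⟩
  obtain ⟨k, m, rfl⟩ := AddSubgroup.mem_closure_pair.1 htmem
  have hadd := spectrum_almostMathieu_add hHop ω k m
  rw [← hadd, spectrum.mem_iff] at hz
  exact hz (by simpa using ht)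

end AlmostMathieu


/-- For `λ > 0` and irrational `α`, the spectrum of the almost Mathieu operator
`(Hop ω ψ)(n) = ψ(n+1) + ψ(n−1) + 2λ cos(2π(ω + nα))ψ(n)` on `ℓ²(ℤ, ℂ)` is independent
of `ω`: there is a compact set `Σ ⊆ ℝ` with `σ(Hop ω) = Σ` for every `ω ∈ ℝ`. -/
theorem amo_spectrum_omega_independent (lam α : ℝ) (hlam : 0 < lam) (hα : Irrational α)
    (Hop : ℝ → (lp (fun _ : ℤ => ℂ) 2 →L[ℂ] lp (fun _ : ℤ => ℂ) 2))
    (hHop : ∀ (ω : ℝ) (ψ : lp (fun _ : ℤ => ℂ) 2) (n : ℤ),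
      (Hop ω ψ) n = ψ (n + 1) + ψ (n - 1) +
        (↑(2 * lam * Real.cos (2 * Real.pi * (ω + n * α))) : ℂ) * ψ n) :
    ∃ S : Set ℝ, IsCompact S ∧
      ∀ ω : ℝ, spectrum ℂ (Hop ω) = (fun x : ℝ => (x : ℂ)) '' S := by
  refine ⟨Complex.re '' spectrum ℂ (Hop 0),
    (spectrum.isCompact (Hop 0)).image Complex.continuous_re, fun ω => ?_⟩
  rw [(spectrum_almostMathieu_subset hα hHop ω 0).antisymm
    (spectrum_almostMathieu_subset hα hHop 0 ω), Set.image_image]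
  have hre (z : ℂ) (hz : z ∈ spectrum ℂ (Hop 0)) : ((z.re : ℝ) : ℂ) = z :=
    ((isSelfAdjoint_of_hopping_add_potential (hHop 0)).mem_spectrum_eq_re hz).symm
  rw [Set.image_congr hre, Set.image_id']
end

section
/- (Avron–Simon duality of spectra) For every λ > 0 and every irrational α ∈ ℝ, the common spectrum satisfies Σ^{λ,α} = λ · Σ^{λ^{−1},α}, i.e., σ(H^{λ,α}_ω) = { λE : E ∈ σ(H^{λ^{−1},α}_ω) } for every ω ∈ ℝ. -/
open Filter Topology

/-- The character `t ↦ exp (2πit)` with values in `ℂ`. -/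
noncomputable def unitExp (t : ℝ) : ℂ := (Real.fourierChar t : ℂ)

lemma unitExp_add (s t : ℝ) : unitExp (s + t) = unitExp s * unitExp t := by
  simp [unitExp, AddChar.map_add_eq_mul]

@[simp] lemma norm_unitExp (t : ℝ) : ‖unitExp t‖ = 1 := Circle.norm_coe _

@[simp] lemma unitExp_zero : unitExp 0 = 1 := by simp [unitExp]

lemma conj_unitExp (t : ℝ) : (starRingEnd ℂ) (unitExp t) = unitExp (-t) := by
  rw [unitExp, unitExp, AddChar.map_neg_eq_inv, Circle.coe_inv_eq_conj]

lemma unitExp_nat_mul (n : ℕ) (t : ℝ) : unitExp (n * t) = unitExp t ^ n := by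
  induction n with
  | zero => simp
  | succ n ih => rw [Nat.cast_succ, add_mul, one_mul, unitExp_add, ih, pow_succ]

lemma two_cos_eq_unitExp (t : ℝ) :
    (2 * Real.cos (2 * Real.pi * t) : ℂ) = unitExp t + unitExp (-t) := by
  rw [unitExp, unitExp, Real.fourierChar_apply, Real.fourierChar_apply, Complex.ofReal_cos,
    Complex.two_cos]
  push_cast
  congr 2
  ring

lemma unitExp_ne_one {t : ℝ} (ht : Irrational t) : unitExp t ≠ 1 := by
  rw [unitExp, Real.fourierChar_apply, Ne, Complex.exp_eq_one_iff]
  rintro ⟨n, hn⟩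
  have hpi : (2 * Real.pi * Complex.I : ℂ) ≠ 0 := Complex.two_pi_I_ne_zero
  have h : (t : ℂ) = n := by
    apply mul_left_cancel₀ hpi
    push_cast at hn
    linear_combination hn
  exact ht.ne_int n (by exact_mod_cast h)

lemma tendsto_average_pow {z : ℂ} (hz : ‖z‖ = 1) (hz1 : z ≠ 1) :
    Tendsto (fun N : ℕ => (N : ℂ)⁻¹ * ∑ m ∈ Finset.range N, z ^ m) atTop (𝓝 0) := by
  have hinv : Tendsto (fun N : ℕ => (N : ℝ)⁻¹ * (2 / ‖z - 1‖)) atTop (𝓝 0) := by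
    simpa using (tendsto_inv_atTop_nhds_zero_nat (𝕜 := ℝ)).mul_const (2 / ‖z - 1‖)
  refine squeeze_zero_norm (fun N => ?_) hinv
  rw [geom_sum_eq hz1, norm_mul, norm_inv, Complex.norm_natCast, norm_div]
  gcongr
  calc ‖z ^ N - 1‖ ≤ ‖z ^ N‖ + ‖(1 : ℂ)‖ := norm_sub_le _ _
    _ = 2 := by rw [norm_pow, hz]; norm_num

lemma tendsto_average_unitExp {α : ℝ} (hα : Irrational α) (ω : ℝ) (k : ℤ) :
    Tendsto (fun N : ℕ => (N : ℂ)⁻¹ * ∑ m ∈ Finset.range N, unitExp (k * (ω + m * α))) atTop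
      (𝓝 (if k = 0 then 1 else 0)) := by
  split_ifs with hk
  · refine tendsto_const_nhds.congr' ?_
    filter_upwards [eventually_ne_atTop 0] with N hN
    have : (N : ℂ) ≠ 0 := by exact_mod_cast hN
    simp [hk, this]
  · have h := (tendsto_average_pow (norm_unitExp (k * α))
      (unitExp_ne_one (hα.intCast_mul hk))).const_mul (unitExp (k * ω))
    rw [mul_zero] at h
    refine h.congr fun N => ?_
    rw [mul_left_comm, Finset.mul_sum]
    congr 1
    refine Finset.sum_congr rfl fun m _ => ?_
    rw [← unitExp_nat_mul, ← unitExp_add]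
    congr 1
    ring

/-- The trigonometric series with coefficients `a`. -/
noncomputable def trigSeries (a : ℤ → ℂ) (y : ℝ) : ℂ := ∑' n : ℤ, a n * unitExp (n * y)

lemma hasSum_trigSeries {a : ℤ → ℂ} (ha : a.support.Finite) (y : ℝ) :
    HasSum (fun n : ℤ => a n * unitExp (n * y)) (trigSeries a y) :=
  (summable_of_hasFiniteSupport
    (ha.subset (Function.support_mul_subset_left a _))).hasSum

lemma norm_trigSeries_le {a : ℤ → ℂ} (ha : a.support.Finite) (y : ℝ) :
    ‖trigSeries a y‖ ≤ ∑' n, ‖a n‖ := by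
  refine (norm_tsum_le_tsum_norm ?_).trans_eq (by simp)
  simp only [norm_mul, norm_unitExp, mul_one]
  exact summable_of_hasFiniteSupport (ha.subset fun n hn h => hn (by simp [h]))

/-- Parseval's identity for trigonometric polynomials, as an average along an orbit of the
irrational rotation. -/
lemma tendsto_average_trigSeries {a : ℤ → ℂ} (ha : a.support.Finite) {α : ℝ}
    (hα : Irrational α) (ω : ℝ) :
    Tendsto (fun N : ℕ => (N : ℝ)⁻¹ * ∑ m ∈ Finset.range N, ‖trigSeries a (ω + m * α)‖ ^ 2)
      atTop (𝓝 (∑ n ∈ ha.toFinset, ‖a n‖ ^ 2)) := by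
  set S := ha.toFinset
  have htrig (y : ℝ) : trigSeries a y = ∑ n ∈ S, a n * unitExp (n * y) := by
    refine tsum_eq_sum fun n hn => ?_
    have : a n = 0 := by simpa [S] using hn
    simp [this]
  have hsq (y : ℝ) : ((‖trigSeries a y‖ ^ 2 : ℝ) : ℂ) =
      ∑ n ∈ S, ∑ k ∈ S, a n * (starRingEnd ℂ) (a k) * unitExp ((n - k : ℤ) * y) := by
    rw [Complex.ofReal_pow, ← Complex.mul_conj', htrig, map_sum, Finset.sum_mul_sum]
    refine Finset.sum_congr rfl fun n _ => Finset.sum_congr rfl fun k _ => ?_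
    rw [map_mul, conj_unitExp, mul_mul_mul_comm, ← unitExp_add]
    congr 2
    push_cast
    ring
  rw [← Filter.tendsto_ofReal_iff]
  have h : Tendsto (fun N : ℕ => ∑ n ∈ S, ∑ k ∈ S, a n * (starRingEnd ℂ) (a k) *
      ((N : ℂ)⁻¹ * ∑ m ∈ Finset.range N, unitExp ((n - k : ℤ) * (ω + m * α)))) atTop
      (𝓝 (∑ n ∈ S, ∑ k ∈ S, a n * (starRingEnd ℂ) (a k) * if n - k = 0 then 1 else 0)) :=
    tendsto_finsetSum _ fun n _ => tendsto_finsetSum _ fun k _ =>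
      (tendsto_average_unitExp hα ω (n - k)).const_mul _
  convert h using 1
  · ext N
    simp only [Complex.ofReal_mul, Complex.ofReal_inv, Complex.ofReal_natCast,
      Complex.ofReal_sum, hsq, Finset.mul_sum]
    rw [Finset.sum_comm]
    refine Finset.sum_congr rfl fun n _ => ?_
    rw [Finset.sum_comm]
    refine Finset.sum_congr rfl fun k _ => Finset.sum_congr rfl fun m _ => ?_
    ring
  · congr 1
    simp only [sub_eq_zero, mul_ite, mul_one, mul_zero, Finset.sum_ite_eq, Complex.ofReal_sum]
    refine Finset.sum_congr rfl fun n hn => ?_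
    rw [if_pos hn, Complex.mul_conj', Complex.ofReal_pow]

/-- Fourier duality of the almost Mathieu difference expressions with couplings `lam⁻¹`
and `lam`. -/
lemma dual_difference_equation {lam : ℝ} (hlam : lam ≠ 0) (α ω : ℝ) (E : ℂ) {a b : ℤ → ℂ}
    (ha : a.support.Finite) (hb : b.support.Finite)
    (hab : ∀ n : ℤ, b n = a (n + 1) + a (n - 1) +
      (↑(2 * lam⁻¹ * Real.cos (2 * Real.pi * (ω + n * α))) : ℂ) * a n - E * a n) (m : ℤ) :
    unitExp ((m + 1 : ℤ) * ω) * trigSeries a (ω + (m + 1 : ℤ) * α) +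
      unitExp ((m - 1 : ℤ) * ω) * trigSeries a (ω + (m - 1 : ℤ) * α) +
      (↑(2 * lam * Real.cos (2 * Real.pi * (ω + m * α))) : ℂ) *
        (unitExp (m * ω) * trigSeries a (ω + m * α)) -
      lam * E * (unitExp (m * ω) * trigSeries a (ω + m * α)) =
    lam * (unitExp (m * ω) * trigSeries b (ω + m * α)) := by
  have hlam' : (lam : ℂ) ≠ 0 := by exact_mod_cast hlam
  set y : ℝ := ω + m * α with hy
  have hup := (Equiv.addRight (1 : ℤ)).hasSum_iff.mpr (hasSum_trigSeries ha y)
  have hdown := (Equiv.subRight (1 : ℤ)).hasSum_iff.mpr (hasSum_trigSeries ha y)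
  have hadd := ((((hasSum_trigSeries ha (ω + (m + 1 : ℤ) * α)).mul_left (unitExp ω)).add
    ((hasSum_trigSeries ha (ω + (m - 1 : ℤ) * α)).mul_left (unitExp (-ω)))).add
    (((hup.mul_left (unitExp (-y))).add (hdown.mul_left (unitExp y))).mul_left (lam : ℂ))).sub
    ((hasSum_trigSeries ha y).mul_left (lam * E))
  have hkey := ((hasSum_trigSeries hb y).mul_left (lam : ℂ)).unique (hadd.congr_fun ?_)
  · rw [show (((m + 1 : ℤ) : ℝ) * ω) = m * ω + ω by push_cast; ring,
      show (((m - 1 : ℤ) : ℝ) * ω) = m * ω + -ω by push_cast; ring, unitExp_add, unitExp_add,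
      show (2 * lam * Real.cos (2 * Real.pi * y)) = lam * (2 * Real.cos (2 * Real.pi * y)) by ring,
      Complex.ofReal_mul lam, Complex.ofReal_mul 2, Complex.ofReal_ofNat, two_cos_eq_unitExp]
    linear_combination (-unitExp (m * ω)) * hkey
  · intro n
    have hc : (↑(2 * lam⁻¹ * Real.cos (2 * Real.pi * (ω + n * α))) : ℂ) =
        (lam : ℂ)⁻¹ * (unitExp ω * unitExp (n * α) + unitExp (-ω) * unitExp (-(n * α))) := by
      rw [← unitExp_add, ← unitExp_add, ← neg_add, ← two_cos_eq_unitExp]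
      push_cast
      ring
    have h1 : unitExp (n * (ω + (m + 1 : ℤ) * α)) = unitExp (n * y) * unitExp (n * α) := by
      rw [← unitExp_add]; congr 1; rw [hy]; push_cast; ring
    have h2 : unitExp (n * (ω + (m - 1 : ℤ) * α)) = unitExp (n * y) * unitExp (-(n * α)) := by
      rw [← unitExp_add]; congr 1; rw [hy]; push_cast; ring
    have h3 : unitExp (-y) * unitExp ((n + 1 : ℤ) * y) = unitExp (n * y) := by
      rw [← unitExp_add]; congr 1; push_cast; ring
    have h4 : unitExp y * unitExp ((n - 1 : ℤ) * y) = unitExp (n * y) := by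
      rw [← unitExp_add]; congr 1; push_cast; ring
    simp only [Function.comp_apply, Equiv.coe_addRight, Equiv.subRight_apply]
    rw [hab, hc, h1, h2]
    linear_combination (-lam * a (n + 1)) * h3 + (-lam * a (n - 1)) * h4 +
      (unitExp ω * unitExp (n * α) + unitExp (-ω) * unitExp (-(n * α))) * a n *
        unitExp (n * y) * mul_inv_cancel₀ hlam'


/-- The square-summable sequence which agrees with `f` on `[0, N)` and vanishes elsewhere. -/
noncomputable def truncation (N : ℕ) (f : ℤ → ℂ) : lp (fun _ : ℤ => ℂ) 2 :=
  ∑ m ∈ (Finset.range N).map Nat.castEmbedding, lp.single 2 m (f m)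

lemma truncation_apply (N : ℕ) (f : ℤ → ℂ) (m : ℤ) :
    truncation N f m = if 0 ≤ m ∧ m < N then f m else 0 := by
  have hmem : m ∈ (Finset.range N).map (Nat.castEmbedding (R := ℤ)) ↔ 0 ≤ m ∧ m < N := by
    simp only [Finset.mem_map, Finset.mem_range, Nat.castEmbedding_apply]
    constructor
    · rintro ⟨k, hk, rfl⟩
      omega
    · rintro ⟨h0, hN⟩
      exact ⟨m.toNat, by omega, by omega⟩
  simp only [truncation, lp.coeFn_sum, lp.coeFn_single, Finset.sum_apply, Finset.sum_pi_single,
    hmem]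

lemma norm_sq_truncation (N : ℕ) (f : ℤ → ℂ) :
    ‖truncation N f‖ ^ 2 = ∑ m ∈ Finset.range N, ‖f m‖ ^ 2 := by
  have h := lp.norm_sum_single (p := 2) (by norm_num) f
    ((Finset.range N).map Nat.castEmbedding)
  simpa [truncation] using h

lemma norm_sq_eq_sum_of_finite_support {ψ : lp (fun _ : ℤ => ℂ) 2}
    (hψ : (Function.support ψ).Finite) : ‖ψ‖ ^ 2 = ∑ n ∈ hψ.toFinset, ‖ψ n‖ ^ 2 := by
  have h := lp.norm_rpow_eq_tsum (p := 2) (by norm_num) ψ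
  rw [tsum_eq_sum (s := hψ.toFinset)] at h
  · simpa using h
  · intro n hn
    have : ψ n = 0 := by simpa using hn
    simp [this]

/-- Truncating a bounded sequence changes the action of a discrete Schrödinger operator only by
boundary terms. -/
lemma norm_truncation_le {H : lp (fun _ : ℤ => ℂ) 2 →L[ℂ] lp (fun _ : ℤ => ℂ) 2} {V : ℤ → ℂ}
    (hH : ∀ (ψ : lp (fun _ : ℤ => ℂ) 2) (n : ℤ), (H ψ) n = ψ (n + 1) + ψ (n - 1) + V n * ψ n)
    (z : ℂ) {f g : ℤ → ℂ} (hfg : ∀ m, f (m + 1) + f (m - 1) + V m * f m - z * f m = g m)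
    {B : ℝ} (hB : ∀ m, ‖f m‖ ≤ B) (N : ℕ) :
    ‖H (truncation N f) - z • truncation N f‖ ≤ ‖truncation N g‖ + 4 * B := by
  have hB0 : 0 ≤ B := (norm_nonneg _).trans (hB 0)
  rcases Nat.eq_zero_or_pos N with rfl | hN
  · have h0 : truncation 0 f = 0 := by simp [truncation]
    rw [h0]
    simp only [map_zero, smul_zero, sub_zero, norm_zero]
    positivity
  have hN' : (0 : ℤ) < N := by exact_mod_cast hN
  have heq : H (truncation N f) - z • truncation N f = truncation N g + lp.single 2 (-1) (f 0)
      - lp.single 2 (N - 1 : ℤ) (f N) + lp.single 2 (N : ℤ) (f (N - 1))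
      - lp.single 2 0 (f (-1)) := by
    ext m
    have hHm := hH (truncation N f) m
    simp only [lp.coeFn_sub, lp.coeFn_add, lp.coeFn_smul, lp.coeFn_single, Pi.sub_apply,
      Pi.add_apply, Pi.smul_apply, smul_eq_mul, hHm, truncation_apply, Pi.single_apply, ← hfg]
    by_cases h1 : m = -1
    · subst h1
      by_cases hN1 : (N : ℤ) = 1
      all_goals grind
    · grind
  have hs (i j : ℤ) : ‖(lp.single 2 i (f j) : lp (fun _ : ℤ => ℂ) 2)‖ ≤ B := by
    rw [lp.norm_single (by norm_num)]
    exact hB j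
  rw [heq]
  refine (norm_sub_le _ _).trans ?_
  have h1 := norm_add_le (truncation N g + lp.single 2 (-1) (f 0) - lp.single 2 (N - 1 : ℤ) (f N))
    (lp.single 2 (N : ℤ) (f (N - 1)))
  have h2 := norm_sub_le (truncation N g + lp.single 2 (-1) (f 0)) (lp.single 2 (N - 1 : ℤ) (f N))
  have h3 := norm_add_le (truncation N g) (lp.single 2 (-1) (f 0))
  linarith [hs (-1) 0, hs (N - 1) N, hs N (N - 1), hs 0 (-1)]

lemma tendsto_norm_truncation_wave {ψ : lp (fun _ : ℤ => ℂ) 2}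
    (hψ : (Function.support ψ).Finite) {α : ℝ} (hα : Irrational α) (ω : ℝ) :
    Tendsto (fun N : ℕ => (√N)⁻¹ *
      ‖truncation N (fun m => unitExp (m * ω) * trigSeries ψ (ω + m * α))‖) atTop (𝓝 ‖ψ‖) := by
  have h := (tendsto_average_trigSeries hψ hα ω).sqrt
  rw [← norm_sq_eq_sum_of_finite_support hψ, Real.sqrt_sq (norm_nonneg _)] at h
  refine h.congr fun N => ?_
  rw [Real.sqrt_mul (by positivity), Real.sqrt_inv,
    ← Real.sqrt_sq (norm_nonneg (truncation N _)), norm_sq_truncation]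
  simp

lemma summable_norm_sq (ψ : lp (fun _ : ℤ => ℂ) 2) : Summable fun n => ‖ψ n‖ ^ 2 := by
  simpa using (lp.memℓp ψ).summable (by norm_num)

/-- The Wronskian of the complex conjugate of `φ` and `ψ`. -/
noncomputable def wronskian (φ ψ : ℤ → ℂ) (n : ℤ) : ℂ :=
  (starRingEnd ℂ) (φ (n + 1)) * ψ n - (starRingEnd ℂ) (φ n) * ψ (n + 1)

lemma summable_wronskian (φ ψ : lp (fun _ : ℤ => ℂ) 2) : Summable (wronskian φ ψ) := by
  have hφ := summable_norm_sq φ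
  have hψ := summable_norm_sq ψ
  have hφ' := (Equiv.addRight (1 : ℤ)).summable_iff.mpr hφ
  have hψ' := (Equiv.addRight (1 : ℤ)).summable_iff.mpr hψ
  refine Summable.of_norm_bounded ((hφ'.add hψ).add (hφ.add hψ')) fun n => ?_
  refine (norm_sub_le _ _).trans ?_
  simp only [norm_mul, RCLike.norm_conj, Function.comp_apply, Equiv.coe_addRight]
  nlinarith [sq_nonneg (‖φ (n + 1)‖ - ‖ψ n‖), sq_nonneg (‖φ n‖ - ‖ψ (n + 1)‖),
    sq_nonneg (‖φ (n + 1)‖ + ‖ψ n‖), sq_nonneg (‖φ n‖ + ‖ψ (n + 1)‖)]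

lemma hasSum_wronskian_sub (φ ψ : lp (fun _ : ℤ => ℂ) 2) :
    HasSum (fun n => wronskian φ ψ n - wronskian φ ψ (n - 1)) 0 := by
  have hw := (summable_wronskian φ ψ).hasSum
  simpa using hw.sub ((Equiv.subRight (1 : ℤ)).hasSum_iff.mpr hw)

section Spectrum

variable {F : Type*} [NormedAddCommGroup F] [InnerProductSpace ℂ F]

lemma exists_lower_bound_of_notMem_spectrum {T : F →L[ℂ] F} {z : ℂ} (hz : z ∉ spectrum ℂ T) :
    ∃ c > 0, ∀ x, c * ‖x‖ ≤ ‖T x - z • x‖ := by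
  obtain ⟨u, hu⟩ := spectrum.notMem_iff.mp hz
  have hpos : 0 < ‖(↑u⁻¹ : F →L[ℂ] F)‖ + 1 := by positivity
  refine ⟨(‖(↑u⁻¹ : F →L[ℂ] F)‖ + 1)⁻¹, inv_pos.mpr hpos, fun x => ?_⟩
  rw [inv_mul_le_iff₀ hpos, norm_sub_rev]
  have hux : (u : F →L[ℂ] F) x = z • x - T x := by
    rw [hu]
    simp [Algebra.algebraMap_eq_smul_one]
  have hx : (↑u⁻¹ : F →L[ℂ] F) ((u : F →L[ℂ] F) x) = x := by
    rw [← mul_apply_eq_comp, u.inv_mul, one_apply_eq_self]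
  calc ‖x‖ = ‖(↑u⁻¹ : F →L[ℂ] F) (z • x - T x)‖ := by rw [← hux, hx]
    _ ≤ ‖(↑u⁻¹ : F →L[ℂ] F)‖ * ‖z • x - T x‖ := ContinuousLinearMap.le_opNorm _ _
    _ ≤ (‖(↑u⁻¹ : F →L[ℂ] F)‖ + 1) * ‖z • x - T x‖ := by gcongr; linarith

lemma notMem_spectrum_of_lower_bound [CompleteSpace F] {T : F →L[ℂ] F} (hT : IsSelfAdjoint T)
    {z : ℂ} {c : ℝ} (hc : 0 < c) (h : ∀ x, c * ‖x‖ ≤ ‖T x - z • x‖) : z ∉ spectrum ℂ T := by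
  rw [spectrum.notMem_iff]
  set A : F →L[ℂ] F := algebraMap ℂ _ z - T
  have hA (x : F) : c * ‖x‖ ≤ ‖A x‖ := by
    refine (h x).trans_eq ?_
    rw [norm_sub_rev]
    simp [A, Algebra.algebraMap_eq_smul_one]
  have hcomm : Commute (star A) A := by
    have hstar : star A = algebraMap ℂ _ (star z) - T := by
      rw [star_sub, hT.star_eq, Algebra.algebraMap_eq_smul_one, Algebra.algebraMap_eq_smul_one,
        star_smul, star_one]
    rw [hstar]
    exact (Algebra.commute_algebraMap_left _ _).sub_left
      ((Algebra.commute_algebraMap_right _ _).sub_right (Commute.refl T))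
  refine (hcomm.isUnit_mul_iff.mp ?_).2
  refine ContinuousLinearMap.isUnit_of_forall_le_norm_inner_map _ (c := (c ^ 2).toNNReal)
    (Real.toNNReal_pos.mpr (pow_pos hc 2)) fun x => ?_
  rw [mul_apply_eq_comp, ContinuousLinearMap.star_eq_adjoint,
    ContinuousLinearMap.adjoint_inner_left, inner_self_eq_norm_sq_to_K, norm_pow,
    RCLike.norm_ofReal, abs_norm, Real.coe_toNNReal _ (sq_nonneg c), ← mul_pow, mul_comm]
  exact pow_le_pow_left₀ (by positivity) (hA x) 2

end Spectrum

/-- The operator `H` is the almost Mathieu operator with coupling `lam`, frequency `α` and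
phase `ω`. -/
def IsAlmostMathieu (lam α ω : ℝ) (H : lp (fun _ : ℤ => ℂ) 2 →L[ℂ] lp (fun _ : ℤ => ℂ) 2) :
    Prop :=
  ∀ (ψ : lp (fun _ : ℤ => ℂ) 2) (n : ℤ), (H ψ) n = ψ (n + 1) + ψ (n - 1) +
    (↑(2 * lam * Real.cos (2 * Real.pi * (ω + n * α))) : ℂ) * ψ n

namespace IsAlmostMathieu

variable {lam α ω : ℝ} {H H₁ H₂ : lp (fun _ : ℤ => ℂ) 2 →L[ℂ] lp (fun _ : ℤ => ℂ) 2}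

lemma finite_support_sub_smul (hH : IsAlmostMathieu lam α ω H) (E : ℂ)
    {ψ : lp (fun _ : ℤ => ℂ) 2} (hψ : (Function.support ψ).Finite) :
    (Function.support (H ψ - E • ψ : lp (fun _ : ℤ => ℂ) 2)).Finite := by
  refine ((hψ.union (hψ.preimage (add_left_injective (1 : ℤ)).injOn)).union
    (hψ.preimage (sub_left_injective (b := (1 : ℤ))).injOn)).subset fun n hn => ?_
  by_contra hcon
  simp only [Set.mem_union, Set.mem_preimage, Function.mem_support, not_or, not_not] at hcon
  apply hn
  have h := hH ψ n
  simp only [lp.coeFn_sub, lp.coeFn_smul, Pi.sub_apply, Pi.smul_apply, h, hcon]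
  simp

lemma dual_lower_bound_of_finite_support (hlam : 0 < lam) (hα : Irrational α)
    (hH₁ : IsAlmostMathieu lam α ω H₁) (hH₂ : IsAlmostMathieu lam⁻¹ α ω H₂) {c : ℝ} {E : ℂ}
    (h : ∀ φ, c * ‖φ‖ ≤ ‖H₁ φ - (lam * E) • φ‖) {ψ : lp (fun _ : ℤ => ℂ) 2}
    (hψ : (Function.support ψ).Finite) : c * ‖ψ‖ ≤ lam * ‖H₂ ψ - E • ψ‖ := by
  set η := H₂ ψ - E • ψ
  have hη : (Function.support η).Finite := hH₂.finite_support_sub_smul E hψ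
  set f : ℤ → ℂ := fun m => unitExp (m * ω) * trigSeries ψ (ω + m * α)
  set g : ℤ → ℂ := fun m => unitExp (m * ω) * trigSeries η (ω + m * α)
  have hηψ (n : ℤ) : η n = ψ (n + 1) + ψ (n - 1) +
      (↑(2 * lam⁻¹ * Real.cos (2 * Real.pi * (ω + n * α))) : ℂ) * ψ n - E * ψ n := by
    rw [← hH₂ ψ n]
    rfl
  have hf (m : ℤ) : ‖f m‖ ≤ ∑' n, ‖ψ n‖ := by
    simpa [f] using norm_trigSeries_le hψ (ω + m * α)
  have hg (N : ℕ) : ‖truncation N (fun m => lam * g m)‖ = lam * ‖truncation N g‖ := by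
    have : truncation N (fun m => lam * g m) = (lam : ℂ) • truncation N g := by
      ext m
      simp only [lp.coeFn_smul, Pi.smul_apply, smul_eq_mul, truncation_apply, mul_ite, mul_zero]
    rw [this, norm_smul, Complex.norm_of_nonneg hlam.le]
  have hN (N : ℕ) : c * ((√N)⁻¹ * ‖truncation N f‖) ≤
      lam * ((√N)⁻¹ * ‖truncation N g‖) + (√N)⁻¹ * (4 * ∑' n, ‖ψ n‖) := by
    have hle := (h (truncation N f)).trans (norm_truncation_le hH₁ (lam * E)
      (dual_difference_equation hlam.ne' α ω E hψ hη hηψ) hf N)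
    rw [hg] at hle
    have := mul_le_mul_of_nonneg_left hle (inv_nonneg.mpr (Real.sqrt_nonneg N))
    linarith
  have hzero : Tendsto (fun N : ℕ => (√N)⁻¹ * (4 * ∑' n, ‖ψ n‖)) atTop (𝓝 0) := by
    simpa using (Real.tendsto_sqrt_atTop.comp
      tendsto_natCast_atTop_atTop).inv_tendsto_atTop.mul_const (4 * ∑' n, ‖ψ n‖)
  have hlim := ((tendsto_norm_truncation_wave hη hα ω).const_mul lam).add hzero
  rw [add_zero] at hlim
  exact le_of_tendsto_of_tendsto' ((tendsto_norm_truncation_wave hψ hα ω).const_mul c) hlim hN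

lemma dual_lower_bound (hlam : 0 < lam) (hα : Irrational α)
    (hH₁ : IsAlmostMathieu lam α ω H₁) (hH₂ : IsAlmostMathieu lam⁻¹ α ω H₂) {c : ℝ} {E : ℂ}
    (h : ∀ φ, c * ‖φ‖ ≤ ‖H₁ φ - (lam * E) • φ‖) (ψ : lp (fun _ : ℤ => ℂ) 2) :
    c * ‖ψ‖ ≤ lam * ‖H₂ ψ - E • ψ‖ := by
  have hψ : Tendsto (fun S : Finset ℤ => ∑ n ∈ S, lp.single 2 n (ψ n)) atTop (𝓝 ψ) :=
    lp.hasSum_single (by norm_num) ψ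
  refine le_of_tendsto_of_tendsto' (hψ.norm.const_mul c)
    ((((H₂.continuous.tendsto ψ).comp hψ).sub (hψ.const_smul E)).norm.const_mul lam) fun S => ?_
  refine dual_lower_bound_of_finite_support hlam hα hH₁ hH₂ h (S.finite_toSet.subset fun n hn => ?_)
  by_contra hnS
  apply hn
  have : n ∉ S := hnS
  simp only [lp.coeFn_sum, lp.coeFn_single, Finset.sum_apply, Finset.sum_pi_single, if_neg this]

lemma isSelfAdjoint (hH : IsAlmostMathieu lam α ω H) : IsSelfAdjoint H := by
  rw [ContinuousLinearMap.isSelfAdjoint_iff_isSymmetric]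
  intro φ ψ
  have hsum := (lp.hasSum_inner (𝕜 := ℂ) (H φ) ψ).sub (lp.hasSum_inner (𝕜 := ℂ) φ (H ψ))
  have hterm (n : ℤ) : inner ℂ ((H φ) n) (ψ n) - inner ℂ (φ n) ((H ψ) n) =
      wronskian φ ψ n - wronskian φ ψ (n - 1) := by
    simp only [wronskian, RCLike.inner_apply, hH _ n, map_add, map_mul, Complex.conj_ofReal,
      sub_add_cancel]
    ring
  simp only [hterm] at hsum
  exact sub_eq_zero.mp (hsum.unique (hasSum_wronskian_sub φ ψ))

lemma mem_spectrum_dual (hlam : 0 < lam) (hα : Irrational α)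
    (hH₁ : IsAlmostMathieu lam α ω H₁) (hH₂ : IsAlmostMathieu lam⁻¹ α ω H₂) {E : ℂ}
    (hE : E ∈ spectrum ℂ H₂) : lam * E ∈ spectrum ℂ H₁ := by
  by_contra hmem
  obtain ⟨c, hc, h⟩ := exists_lower_bound_of_notMem_spectrum hmem
  refine notMem_spectrum_of_lower_bound hH₂.isSelfAdjoint (div_pos hc hlam) (fun ψ => ?_) hE
  rw [div_mul_eq_mul_div, div_le_iff₀' hlam]
  exact dual_lower_bound hlam hα hH₁ hH₂ h ψ

end IsAlmostMathieu

/-- Avron–Simon duality of spectra: for `λ > 0` and irrational `α`, if `H₁` is the almost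
Mathieu operator with coupling `λ` and `H₂` the one with coupling `λ⁻¹` (both at frequency
`α` and phase `ω`), then `σ(H₁) = λ · σ(H₂)`. -/
theorem aubry_duality_spectra (lam α ω : ℝ) (hlam : 0 < lam) (hα : Irrational α)
    (H₁ H₂ : lp (fun _ : ℤ => ℂ) 2 →L[ℂ] lp (fun _ : ℤ => ℂ) 2)
    (hH₁ : ∀ (ψ : lp (fun _ : ℤ => ℂ) 2) (n : ℤ),
      (H₁ ψ) n = ψ (n + 1) + ψ (n - 1) +
        (↑(2 * lam * Real.cos (2 * Real.pi * (ω + n * α))) : ℂ) * ψ n)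
    (hH₂ : ∀ (ψ : lp (fun _ : ℤ => ℂ) 2) (n : ℤ),
      (H₂ ψ) n = ψ (n + 1) + ψ (n - 1) +
        (↑(2 * lam⁻¹ * Real.cos (2 * Real.pi * (ω + n * α))) : ℂ) * ψ n) :
    spectrum ℂ H₁ = (fun z : ℂ => (lam : ℂ) * z) '' spectrum ℂ H₂ := by
  have hH₂' : IsAlmostMathieu lam⁻¹ α ω H₂ := hH₂
  have hlam' : (lam : ℂ) ≠ 0 := by exact_mod_cast hlam.ne'
  ext z
  constructor
  · intro hz
    refine ⟨(lam⁻¹ : ℝ) * z, ?_, ?_⟩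
    · refine hH₂'.mem_spectrum_dual (inv_pos.mpr hlam) hα ?_ hz
      rwa [inv_inv]
    · simp [hlam']
  · rintro ⟨E, hE, rfl⟩
    exact IsAlmostMathieu.mem_spectrum_dual hlam hα hH₁ hH₂' hE
end
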